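/- Assume m + p > 2. Then the profile equation (SSODE) admits at least one good profile with interface of Type I and at least one good profile with interface of Type II. -/

import Mathlib

open Real Filter Set Topology

noncomputable def alphaC (m p σ : ℝ) : ℝ := (σ + 2) / (σ * (m - 1) + 2 * (p - 1))

noncomputable def betaC (m p σ : ℝ) : ℝ := (m - p) / (σ * (m - 1) + 2 * (p - 1))

/-- The self-similar profile ODE (SSODE) at the point `ξ`. -/
def SSODE (N : ℕ) (m p σ : ℝ) (f : ℝ → ℝ) (ξ : ℝ) : Prop :=
  deriv (deriv fun x => f x ^ m) ξ + ((N : ℝ) - 1) / ξ * deriv (fun x => f x ^ m) ξ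
    - alphaC m p σ * f ξ + betaC m p σ * ξ * deriv f ξ + ξ ^ σ * f ξ ^ p = 0

/-- `f` is a profile with interface at `ξ0`. -/
def ProfileWithInterface (N : ℕ) (m p σ : ℝ) (f : ℝ → ℝ) (ξ0 : ℝ) : Prop :=
  0 < ξ0 ∧
  ContinuousOn f (Icc 0 ξ0) ∧
  (∀ ξ ∈ Ioo 0 ξ0, 0 < f ξ) ∧
  ContDiffOn ℝ 2 f (Ioo 0 ξ0) ∧
  (∀ ξ ∈ Ioo 0 ξ0, SSODE N m p σ f ξ) ∧
  f ξ0 = 0 ∧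
  Tendsto (fun ξ => deriv (fun x => f x ^ m) ξ) (𝓝[<] ξ0) (𝓝 0)

/-- Interface of Type I: `f(ξ) ~ (ξ0 - ξ)^(1/(m-1))` as `ξ → ξ0⁻`. -/
def TypeI (m : ℝ) (f : ℝ → ℝ) (ξ0 : ℝ) : Prop :=
  ∃ c, 0 < c ∧ Tendsto (fun ξ => f ξ * (ξ0 - ξ) ^ (-(1 / (m - 1)))) (𝓝[<] ξ0) (𝓝 c)

/-- Interface of Type II: `f(ξ) ~ (ξ0 - ξ)^(1/(1-p))` as `ξ → ξ0⁻`. -/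
def TypeII (p : ℝ) (f : ℝ → ℝ) (ξ0 : ℝ) : Prop :=
  ∃ c, 0 < c ∧ Tendsto (fun ξ => f ξ * (ξ0 - ξ) ^ (-(1 / (1 - p)))) (𝓝[<] ξ0) (𝓝 c)

/-- Behavior (B1) at the origin. -/
def BehB1 (N : ℕ) (m p σ : ℝ) (f : ℝ → ℝ) : Prop :=
  0 < f 0 ∧ Tendsto (fun ξ => (f ξ ^ (m - 1) - f 0 ^ (m - 1)) / ξ ^ 2)
    (𝓝[>] 0) (𝓝 (alphaC m p σ * (m - 1) / (2 * m * (N : ℝ))))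

/-- Behavior (B2) at the origin. -/
def BehB2 (N : ℕ) (m : ℝ) (f : ℝ → ℝ) : Prop :=
  f 0 = 0 ∧ Tendsto (fun ξ => f ξ * ξ ^ (-(2 / (m - 1)))) (𝓝[>] 0)
    (𝓝 (((m - 1) / (2 * m * (m * (N : ℝ) - (N : ℝ) + 2))) ^ (1 / (m - 1))))

/-- Behavior (B3) at the origin. -/
def BehB3 (m p σ : ℝ) (f : ℝ → ℝ) : Prop :=
  f 0 = 0 ∧ ∃ K, 0 < K ∧
    Tendsto (fun ξ => f ξ * ξ ^ (-((σ + 2) / (m - p)))) (𝓝[>] 0) (𝓝 K)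

/-- A good profile with interface at `ξ0`. -/
def GoodProfile (N : ℕ) (m p σ : ℝ) (f : ℝ → ℝ) (ξ0 : ℝ) : Prop :=
  ProfileWithInterface N m p σ f ξ0 ∧
  (BehB1 N m p σ f ∨ BehB2 N m f ∨ BehB3 m p σ f)

noncomputable def xiMax (m p σ : ℝ) : ℝ := (betaC m p σ ^ 2 / (4 * m)) ^ (1 / (σ - 2))


section Flow
variable {E : Type*} [NormedAddCommGroup E] [NormedSpace ℝ E]

lemma traj_ball {V : E → E} (hb : ∀ x, ‖V x‖ ≤ 1) {γ : ℝ → E} {T : ℝ} (hT : 0 ≤ T)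
    (h : ∀ t ∈ Icc (-T) T, HasDerivWithinAt γ (V (γ t)) (Icc (-T) T) t) {t : ℝ}
    (ht : t ∈ Icc (-T) T) : γ t ∈ Metric.closedBall (γ 0) T := by
  have h0 : (0:ℝ) ∈ Icc (-T) T := ⟨by linarith, hT⟩
  have := Convex.norm_image_sub_le_of_norm_hasDerivWithin_le (C := 1) h (fun x _ => hb _)
    (convex_Icc _ _) h0 ht
  rw [mem_closedBall_iff_norm]
  refine this.trans ?_
  rw [one_mul, sub_zero, Real.norm_eq_abs, abs_le]
  exact ht

lemma exists_traj [FiniteDimensional ℝ E] {V : E → E} (hV : ContDiff ℝ 1 V)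
    (hb : ∀ x, ‖V x‖ ≤ 1) (p : E) :
    ∃ γ : ℝ → E, γ 0 = p ∧ ∀ t, HasDerivAt γ (V (γ t)) t := by
  have : ProperSpace E := FiniteDimensional.proper ℝ E
  have lip : ∀ T : ℝ, ∃ K, LipschitzOnWith K V (Metric.closedBall p T) := fun T =>
    (hV.contDiffOn).exists_lipschitzOnWith (by simp) (convex_closedBall _ _)
      (isCompact_closedBall _ _)
  have ex : ∀ n : ℕ, ∃ γ : ℝ → E, γ 0 = p ∧ ∀ t ∈ Icc (-(n+1:ℝ)) (n+1),
      HasDerivWithinAt γ (V (γ t)) (Icc (-(n+1:ℝ)) (n+1)) t := by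
    intro n
    obtain ⟨K, hK⟩ := lip (n+1)
    have hn : (0:ℝ) ≤ n + 1 := by positivity
    have hPL : IsPicardLindelof (fun _ => V) (⟨0, by constructor <;> linarith⟩ :
        Icc (-(n+1:ℝ)) (n+1)) p (n+1) 0 1 K := by
      apply IsPicardLindelof.of_time_independent
      · intro x _; simpa using hb x
      · simpa using hK
      · simp
    obtain ⟨γ, h1, h2⟩ := hPL.exists_eq_forall_mem_Icc_hasDerivWithinAt₀
    exact ⟨γ, h1, h2⟩
  choose γ hγ0 hγ using ex
  have agree : ∀ n k : ℕ, n ≤ k → EqOn (γ n) (γ k) (Ioo (-(n+1:ℝ)) (n+1)) := by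
    intro n k hnk
    have hnk' : (n:ℝ) ≤ k := by exact_mod_cast hnk
    have hn : (0:ℝ) ≤ n := by positivity
    obtain ⟨K, hK⟩ := lip (k+1)
    refine ODE_solution_unique_of_mem_Ioo (v := fun _ => V) (s := fun _ => Metric.closedBall p (k+1))
      (K := K) (t₀ := 0) (fun t _ => hK) ⟨by linarith, by linarith⟩ ?_ ?_ (by rw [hγ0, hγ0])
    · intro t ht
      refine ⟨(hγ n t (Ioo_subset_Icc_self ht)).hasDerivAt (Icc_mem_nhds ht.1 ht.2), ?_⟩
      have := traj_ball hb (by positivity) (hγ n) (Ioo_subset_Icc_self ht)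
      rw [hγ0] at this
      exact Metric.closedBall_subset_closedBall (by linarith) this
    · intro t ht
      have ht' : t ∈ Ioo (-(k+1:ℝ)) (k+1) := ⟨by linarith [ht.1], by linarith [ht.2]⟩
      refine ⟨(hγ k t (Ioo_subset_Icc_self ht')).hasDerivAt (Icc_mem_nhds ht'.1 ht'.2), ?_⟩
      have := traj_ball hb (by positivity) (hγ k) (Ioo_subset_Icc_self ht')
      rw [hγ0] at this
      exact this
  refine ⟨fun t => γ ⌈|t|⌉₊ t, by simp [hγ0], fun t => ?_⟩
  set n := ⌈|t|⌉₊ with hn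
  have h1 : |t| ≤ n := Nat.le_ceil _
  have h1' := abs_le.1 h1
  have hder : HasDerivAt (γ (n+1)) (V (γ (n+1) t)) t :=
    (hγ (n+1) t ⟨by push_cast; linarith, by push_cast; linarith⟩).hasDerivAt
      (Icc_mem_nhds (by push_cast; linarith) (by push_cast; linarith))
  have hEq : ∀ s : ℝ, |s| < (n:ℝ) + 1 → γ ⌈|s|⌉₊ s = γ (n+1) s := by
    intro s hs
    have h2 : ⌈|s|⌉₊ ≤ n + 1 := Nat.ceil_le.2 (by push_cast; linarith)
    have h3 : |s| ≤ ⌈|s|⌉₊ := Nat.le_ceil _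
    have h3' := abs_le.1 h3
    exact agree _ _ h2 ⟨by linarith, by linarith⟩
  have hev : (fun t => γ ⌈|t|⌉₊ t) =ᶠ[𝓝 t] γ (n+1) := by
    have : {s : ℝ | |s| < n + 1} ∈ 𝓝 t :=
      (isOpen_lt continuous_abs continuous_const).mem_nhds (by simp only [mem_ofPred_eq]; linarith)
    filter_upwards [this] with s hs using hEq s hs
  have := hder.congr_of_eventuallyEq hev
  rwa [← hEq t (by linarith)] at this

lemma traj_dist_fwd {V : E → E} (hb : ∀ x, ‖V x‖ ≤ 1) {K : NNReal} {c : E} {R T : ℝ} (hT : 0 ≤ T)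
    (hK : LipschitzOnWith K V (Metric.closedBall c (R + T)))
    {γ δ : ℝ → E} (hγ : ∀ t, HasDerivAt γ (V (γ t)) t) (hδ : ∀ t, HasDerivAt δ (V (δ t)) t)
    (h1 : γ 0 ∈ Metric.closedBall c R) (h2 : δ 0 ∈ Metric.closedBall c R) {t : ℝ}
    (ht : t ∈ Icc 0 T) : dist (γ t) (δ t) ≤ dist (γ 0) (δ 0) * exp (K * T) := by
  have mem : ∀ η : ℝ → E, (∀ t, HasDerivAt η (V (η t)) t) → η 0 ∈ Metric.closedBall c R →
      ∀ t ∈ Ico 0 T, η t ∈ Metric.closedBall c (R + T) := by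
    intro η hη h0 t ht
    have := traj_ball hb hT (fun t _ => (hη t).hasDerivWithinAt) (t := t)
      ⟨by linarith [ht.1], by linarith [ht.2]⟩
    rw [Metric.mem_closedBall] at *
    linarith [dist_triangle (η t) (η 0) c]
  have := dist_le_of_trajectories_ODE_of_mem (v := fun _ => V) (a := 0) (b := T)
    (s := fun _ => Metric.closedBall c (R+T)) (K := K) (fun t _ => hK)
    (f := γ) (g := δ) (fun t _ => (hγ t).continuousAt.continuousWithinAt)
    (fun t _ => (hγ t).hasDerivWithinAt) (mem γ hγ h1)
    (fun t _ => (hδ t).continuousAt.continuousWithinAt)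
    (fun t _ => (hδ t).hasDerivWithinAt) (mem δ hδ h2) le_rfl t ht
  refine this.trans ?_
  gcongr
  linarith [ht.2]

/-- Global flow of a bounded `C¹` vector field. -/
lemma exists_flow [FiniteDimensional ℝ E] {V : E → E} (hV : ContDiff ℝ 1 V)
    (hb : ∀ x, ‖V x‖ ≤ 1) :
    ∃ Φ : ℝ → E → E, (∀ p, Φ 0 p = p) ∧ (∀ p t, HasDerivAt (fun t => Φ t p) (V (Φ t p)) t) ∧
      Continuous (fun q : ℝ × E => Φ q.1 q.2) := by
  have : ProperSpace E := FiniteDimensional.proper ℝ E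
  choose γ h0 hγ using exists_traj hV hb
  refine ⟨fun t p => γ p t, h0, hγ, ?_⟩
  have lip : ∀ (p : E) (T : ℝ), ∃ K, LipschitzOnWith K V (Metric.closedBall p T) := fun p T =>
    (hV.contDiffOn).exists_lipschitzOnWith (by simp) (convex_closedBall _ _)
      (isCompact_closedBall _ _)
  have tl : ∀ p s t, dist (γ p s) (γ p t) ≤ dist s t := by
    intro p s t
    have := Convex.norm_image_sub_le_of_norm_hasDerivWithin_le (C := 1) (s := univ)
      (fun x _ => (hγ p x).hasDerivWithinAt) (fun x _ => hb _)
      convex_univ (mem_univ t) (mem_univ s)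
    rw [dist_eq_norm, dist_eq_norm]
    linarith
  rw [continuous_iff_continuousAt]
  rintro ⟨t0, p0⟩
  set T := |t0| + 1 with hT
  have hT0 : 0 ≤ T := by positivity
  obtain ⟨K, hK⟩ := lip p0 (1 + T)
  have key : ∀ t ∈ Icc (-T) T, ∀ p ∈ Metric.closedBall p0 1,
      dist (γ p t) (γ p0 t) ≤ dist p p0 * exp (K * T) := by
    intro t ht p hp
    rcases le_total 0 t with h | h
    · have := traj_dist_fwd hb hT0 hK (hγ p) (hγ p0) (by rwa [h0])
        (by rw [h0]; exact Metric.mem_closedBall_self zero_le_one) (t := t) ⟨h, ht.2⟩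
      simpa [h0] using this
    · have hneg : ∀ q s, HasDerivAt (fun s => γ q (-s)) ((fun x => - V x) ((fun s => γ q (-s)) s)) s := by
        intro q s
        have := (hγ q (-s)).scomp s (hasDerivAt_neg s)
        simpa [Function.comp_def] using this
      have hK' : LipschitzOnWith K (fun x => - V x) (Metric.closedBall p0 (1+T)) := by
        intro x hx y hy
        simpa [edist_neg_neg] using hK hx hy
      have := traj_dist_fwd (V := fun x => - V x) (by simpa using hb) hT0 hK' (hneg p) (hneg p0)
        (by simpa [h0] using hp)
        (by simp [h0]) (t := -t) ⟨by linarith, by linarith [ht.1]⟩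
      simpa [h0] using this
  rw [Metric.continuousAt_iff']
  intro ε hε
  have hc : Tendsto (fun q : ℝ × E => dist q.2 p0 * exp (K * T) + dist q.1 t0) (𝓝 (t0, p0)) (𝓝 0) := by
    have : Continuous (fun q : ℝ × E => dist q.2 p0 * exp (K * T) + dist q.1 t0) := by fun_prop
    have h := this.tendsto (t0, p0)
    simpa using h
  have hp : ∀ᶠ q : ℝ × E in 𝓝 (t0, p0), q.2 ∈ Metric.closedBall p0 1 :=
    continuous_snd.tendsto (t0, p0) (Metric.closedBall_mem_nhds _ one_pos)
  have ht : ∀ᶠ q : ℝ × E in 𝓝 (t0, p0), q.1 ∈ Icc (-T) T :=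
    continuous_fst.tendsto (t0, p0) (Icc_mem_nhds (by simp only; linarith [neg_abs_le t0])
      (by simp only; linarith [le_abs_self t0]))
  filter_upwards [hc.eventually (gt_mem_nhds hε), hp, ht] with q h1 h2 h3
  calc dist (γ q.2 q.1) (γ p0 t0) ≤ dist (γ q.2 q.1) (γ p0 q.1) + dist (γ p0 q.1) (γ p0 t0) :=
        dist_triangle _ _ _
    _ ≤ dist q.2 p0 * exp (K * T) + dist q.1 t0 := add_le_add (key _ h3 _ h2) (tl _ _ _)
    _ < ε := h1

end Flow


section Calc

lemma mvt_ge {g g' : ℝ → ℝ} {a b k : ℝ} (hab : a ≤ b)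
    (h : ∀ t ∈ Icc a b, HasDerivAt g (g' t) t) (hk : ∀ t ∈ Icc a b, k ≤ g' t) :
    k * (b - a) ≤ g b - g a := by
  rcases hab.eq_or_lt with rfl | hab
  · simp
  obtain ⟨c, hc, hc'⟩ := exists_hasDerivAt_eq_slope g g' hab
    (fun t ht => (h t ht).continuousAt.continuousWithinAt)
    (fun t ht => h t (Ioo_subset_Icc_self ht))
  have := hk c (Ioo_subset_Icc_self hc)
  rw [hc', le_div_iff₀ (by linarith)] at this
  exact this

lemma mvt_le {g g' : ℝ → ℝ} {a b k : ℝ} (hab : a ≤ b)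
    (h : ∀ t ∈ Icc a b, HasDerivAt g (g' t) t) (hk : ∀ t ∈ Icc a b, g' t ≤ k) :
    g b - g a ≤ k * (b - a) := by
  have := mvt_ge (g := fun t => - g t) (g' := fun t => - g' t) (k := -k) hab
    (fun t ht => (h t ht).neg) (fun t ht => by simpa using hk t ht)
  linarith

lemma mvt_gt {g g' : ℝ → ℝ} {a b k : ℝ} (hab : a < b)
    (h : ∀ t ∈ Icc a b, HasDerivAt g (g' t) t) (hk : ∀ t ∈ Icc a b, k < g' t) :
    k * (b - a) < g b - g a := by
  obtain ⟨c, hc, hc'⟩ := exists_hasDerivAt_eq_slope g g' hab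
    (fun t ht => (h t ht).continuousAt.continuousWithinAt)
    (fun t ht => h t (Ioo_subset_Icc_self ht))
  have := hk c (Ioo_subset_Icc_self hc)
  rw [hc', lt_div_iff₀ (by linarith)] at this
  exact this

lemma exp_ge {g g' : ℝ → ℝ} {a b k : ℝ} (hab : a ≤ b)
    (h : ∀ t ∈ Icc a b, HasDerivAt g (g' t) t) (hk : ∀ t ∈ Icc a b, k * g t ≤ g' t) :
    g a * exp (k * (b - a)) ≤ g b := by
  have h1 : ∀ t ∈ Icc a b, HasDerivAt (fun t => g t * exp (-(k * (t - a))))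
      ((g' t - k * g t) * exp (-(k * (t - a)))) t := by
    intro t ht
    have h2 : HasDerivAt (fun t : ℝ => exp (-(k * (t - a)))) (exp (-(k * (t - a))) * (-(k * 1))) t :=
      (((hasDerivAt_id t).sub_const a).const_mul k).neg.exp
    exact ((h t ht).mul h2).congr_deriv (by ring)
  have := mvt_ge (k := 0) hab h1 (fun t ht => mul_nonneg (by linarith [hk t ht]) (exp_pos _).le)
  simp only [sub_self, mul_zero, neg_zero, exp_zero, mul_one, zero_mul] at this
  have h3 : g a ≤ g b * exp (-(k * (b - a))) := by linarith
  rw [exp_neg, ← div_eq_mul_inv, le_div_iff₀ (exp_pos _)] at h3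
  exact h3

lemma exp_le' {g g' : ℝ → ℝ} {a b k : ℝ} (hab : a ≤ b)
    (h : ∀ t ∈ Icc a b, HasDerivAt g (g' t) t) (hk : ∀ t ∈ Icc a b, g' t ≤ k * g t) :
    g b ≤ g a * exp (k * (b - a)) := by
  have := exp_ge (g := fun t => - g t) (g' := fun t => - g' t) (k := k) hab
    (fun t ht => (h t ht).neg) (fun t ht => by have := hk t ht; linarith)
  linarith

/-- derivative at a left-sided minimum -/
lemma deriv_nonpos_of_left {g : ℝ → ℝ} {a t d : ℝ} (hat : a < t) (h : HasDerivAt g d t)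
    (hl : ∀ s ∈ Ico a t, 0 ≤ g s) (h0 : g t ≤ 0) : d ≤ 0 := by
  by_contra hd
  push Not at hd
  have h1 := hasDerivAt_iff_tendsto_slope_left_right.1 h |>.1
  have h2 := h1.eventually (lt_mem_nhds hd)
  have h3 : ∀ᶠ s in 𝓝[<] t, s ∈ Ico a t := Ico_mem_nhdsLT hat
  obtain ⟨s, hs1, hs2⟩ := (h2.and h3).exists
  rw [slope_def_field] at hs1
  have : (g s - g t) / (s - t) ≤ 0 :=
    div_nonpos_of_nonneg_of_nonpos (by linarith [hl s hs2]) (by linarith [hs2.2])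
  linarith

lemma deriv_nonneg_of_right {g : ℝ → ℝ} {a t d : ℝ} (hat : t < a) (h : HasDerivAt g d t)
    (hl : ∀ s ∈ Ioc t a, 0 ≤ g s) (h0 : g t ≤ 0) : 0 ≤ d := by
  have h1 : HasDerivAt (fun s => g (-s)) (-d) (-t) := by
    have h' : HasDerivAt g d (- -t) := by simpa using h
    simpa [Function.comp_def] using h'.comp (-t) (hasDerivAt_neg (-t))
  have := deriv_nonpos_of_left (g := fun s => g (-s)) (a := -a) (t := -t) (by linarith) h1
    (fun s hs => hl _ ⟨by linarith [hs.2], by linarith [hs.1]⟩) (by simpa using h0)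
  linarith

/-- strict barrier, forward -/
lemma barrier_cont {g : ℝ → ℝ} {a b : ℝ} (hg : ContinuousOn g (Icc a b)) (ha : 0 < g a)
    (h : ∀ t ∈ Ioc a b, (∀ s ∈ Ico a t, 0 < g s) → g t = 0 → False) :
    ∀ t ∈ Icc a b, 0 < g t := by
  intro t ht
  by_contra hneg
  push Not at hneg
  set S := Icc a t ∩ g ⁻¹' (Iic 0) with hS
  have hgt : ContinuousOn g (Icc a t) := hg.mono (Icc_subset_Icc_right ht.2)
  have hSc : IsClosed S := hgt.preimage_isClosed_of_isClosed isClosed_Icc isClosed_Iic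
  have hSn : S.Nonempty := ⟨t, ⟨ht.1, le_rfl⟩, hneg⟩
  have hSb : BddBelow S := ⟨a, fun s hs => hs.1.1⟩
  have hm := hSc.csInf_mem hSn hSb
  set u := sInf S
  have hlt : ∀ s ∈ Ico a u, 0 < g s := by
    intro s hs
    by_contra hc
    push Not at hc
    exact absurd (csInf_le hSb (show s ∈ S from ⟨⟨hs.1, hs.2.le.trans hm.1.2⟩, hc⟩)) (not_le.2 hs.2)
  have hau : a < u := by
    rcases hm.1.1.eq_or_lt with h' | h'
    · have h2 := hm.2
      simp only [mem_preimage, mem_Iic, ← h'] at h2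
      linarith
    · exact h'
  have hu0 : g u = 0 := by
    refine le_antisymm hm.2 ?_
    have hcu : ContinuousWithinAt g (Icc a t) u := hgt u hm.1
    have : Tendsto g (𝓝[Ico a u] u) (𝓝 (g u)) :=
      hcu.mono_left (nhdsWithin_mono _ (fun s hs => ⟨hs.1, hs.2.le.trans hm.1.2⟩))
    have hne : (𝓝[Ico a u] u).NeBot := by
      rw [nhdsWithin_Ico_eq_nhdsLT hau]; infer_instance
    exact ge_of_tendsto this (eventually_mem_nhdsWithin.mono fun s hs => (hlt s hs).le)
  exact h u ⟨hau, hm.1.2.trans ht.2⟩ hlt hu0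

lemma barrier {g g' : ℝ → ℝ} {a b : ℝ} (hg : ∀ t ∈ Icc a b, HasDerivAt g (g' t) t) (ha : 0 < g a)
    (h : ∀ t ∈ Ioc a b, (∀ s ∈ Ico a t, 0 < g s) → g t = 0 → 0 < g' t) :
    ∀ t ∈ Icc a b, 0 < g t := by
  refine barrier_cont (fun t ht => (hg t ht).continuousAt.continuousWithinAt) ha ?_
  intro t ht h1 h2
  have := deriv_nonpos_of_left ht.1 (hg t (Ioc_subset_Icc_self ht)) (fun s hs => (h1 s hs).le) h2.le
  linarith [h t ht h1 h2]

lemma eventually_pos_right {g : ℝ → ℝ} {a d : ℝ} (h : HasDerivAt g d a) (ha : 0 ≤ g a)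
    (hd : g a = 0 → 0 < d) : ∀ᶠ t in 𝓝[>] a, 0 < g t := by
  rcases ha.eq_or_lt with h0 | h0
  · have h1 := hasDerivAt_iff_tendsto_slope_left_right.1 h |>.2
    have h2 := h1.eventually (lt_mem_nhds (hd h0.symm))
    filter_upwards [h2, self_mem_nhdsWithin] with s hs hs'
    rw [slope_def_field, ← h0, sub_zero] at hs
    simp only [mem_Ioi] at hs'
    exact (div_pos_iff_of_pos_right (by linarith)).1 hs
  · exact nhdsWithin_le_nhds (h.continuousAt.eventually (lt_mem_nhds h0))

/-- barrier with nonstrict start -/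
lemma barrier0 {g g' : ℝ → ℝ} {a b : ℝ} (hg : ∀ t ∈ Icc a b, HasDerivAt g (g' t) t) (ha : 0 ≤ g a)
    (h : ∀ t ∈ Icc a b, (∀ s ∈ Ioo a t, 0 < g s) → g t = 0 → 0 < g' t) :
    ∀ t ∈ Ioc a b, 0 < g t := by
  intro t ht
  have hab : a ≤ b := (ht.1.trans_le ht.2).le
  have h1 := eventually_pos_right (hg a ⟨le_rfl, hab⟩) ha
    (h a ⟨le_rfl, hab⟩ (by intro s hs; exact absurd (hs.1.trans hs.2) (lt_irrefl _)))
  rw [eventually_nhdsWithin_iff, Metric.eventually_nhds_iff] at h1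
  obtain ⟨ε, hε, h1⟩ := h1
  set c := a + min (ε/2) ((t-a)/2)
  have hta := ht.1
  have hc0 : 0 < min (ε/2) ((t-a)/2) := lt_min (by linarith) (by linarith)
  have hc1 : min (ε/2) ((t-a)/2) ≤ ε/2 := min_le_left _ _
  have hc2 : min (ε/2) ((t-a)/2) ≤ (t-a)/2 := min_le_right _ _
  have hpos : ∀ s ∈ Ioc a c, 0 < g s := by
    intro s hs
    refine h1 ?_ hs.1
    rw [Real.dist_eq, abs_of_pos (by linarith [hs.1])]
    have := hs.2
    simp only [c] at this
    linarith
  have hac : a < c := by simp only [c]; linarith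
  have hct : c < t := by simp only [c]; linarith
  refine barrier (g := g) (g' := g') (a := c) (b := b)
    (fun s hs => hg s ⟨hac.le.trans hs.1, hs.2⟩) (hpos c ⟨hac, le_rfl⟩) ?_ t ⟨hct.le, ht.2⟩
  intro s hs h2 h3
  refine h s ⟨hac.le.trans hs.1.le, hs.2⟩ ?_ h3
  intro w hw
  rcases le_or_gt w c with hwc | hwc
  · exact hpos w ⟨hw.1, hwc⟩
  · exact h2 w ⟨hwc.le, hw.2⟩

lemma hasDerivAt_reflect {g : ℝ → ℝ} {d t : ℝ} (h : HasDerivAt g d (-t)) :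
    HasDerivAt (fun s => g (-s)) (-d) t := by
  simpa [Function.comp_def] using h.comp t (hasDerivAt_neg t)

/-- backward barrier -/
lemma barrier_back {g g' : ℝ → ℝ} {a b : ℝ} (hg : ∀ t ∈ Icc a b, HasDerivAt g (g' t) t)
    (hb : 0 < g b)
    (h : ∀ t ∈ Ico a b, (∀ s ∈ Ioc t b, 0 < g s) → g t = 0 → g' t < 0) :
    ∀ t ∈ Icc a b, 0 < g t := by
  intro t ht
  have := barrier (g := fun s => g (-s)) (g' := fun s => - g' (-s)) (a := -b) (b := -a)
    (fun s hs => hasDerivAt_reflect (hg _ ⟨by linarith [hs.2], by linarith [hs.1]⟩))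
    (by simpa using hb) (fun s hs h1 h2 => by
      have := h (-s) ⟨by linarith [hs.2], by linarith [hs.1]⟩ (fun w hw => by
        have := h1 (-w) ⟨by linarith [hw.2], by linarith [hw.1]⟩
        simpa using this) h2
      linarith) (-t) ⟨by linarith [ht.2], by linarith [ht.1]⟩
  simpa using this

lemma barrier_back0 {g g' : ℝ → ℝ} {a b : ℝ} (hg : ∀ t ∈ Icc a b, HasDerivAt g (g' t) t)
    (hb : 0 ≤ g b)
    (h : ∀ t ∈ Icc a b, (∀ s ∈ Ioo t b, 0 < g s) → g t = 0 → g' t < 0) :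
    ∀ t ∈ Ico a b, 0 < g t := by
  intro t ht
  have := barrier0 (g := fun s => g (-s)) (g' := fun s => - g' (-s)) (a := -b) (b := -a)
    (fun s hs => hasDerivAt_reflect (hg _ ⟨by linarith [hs.2], by linarith [hs.1]⟩))
    (by simpa using hb) (fun s hs h1 h2 => by
      have := h (-s) ⟨by linarith [hs.2], by linarith [hs.1]⟩ (fun w hw => by
        have := h1 (-w) ⟨by linarith [hw.2], by linarith [hw.1]⟩
        simpa using this) h2
      linarith) (-t) ⟨by linarith [ht.2], by linarith [ht.1]⟩
  simpa using this

/-- finite-time decay below a level -/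
lemma finite_decay {g g' : ℝ → ℝ} {a b c k : ℝ} (hab : a < b) (hk : 0 < k)
    (hg : ∀ t ∈ Ico a b, HasDerivAt g (g' t) t)
    (h : ∀ t ∈ Ico a b, c ≤ g t → g' t ≤ - k / (b - t)) :
    ∃ t0 ∈ Ico a b, ∀ t ∈ Ico t0 b, g t < c := by
  by_cases hex : ∃ t0 ∈ Ico a b, g t0 < c
  · obtain ⟨t0, ht0, hc⟩ := hex
    refine ⟨t0, ht0, fun t ht => ?_⟩
    have := barrier (g := fun s => c - g s) (g' := fun s => - g' s) (a := t0) (b := t)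
      (fun s hs => (hg s ⟨ht0.1.trans hs.1, hs.2.trans_lt ht.2⟩).const_sub c) (by linarith)
      (fun s hs _ h0 => by
        have hsb : s < b := hs.2.trans_lt ht.2
        have := h s ⟨ht0.1.trans hs.1.le, hsb⟩ (by linarith)
        have h2 : 0 < k / (b - s) := div_pos hk (by linarith)
        rw [neg_div] at this
        linarith) t ⟨ht.1, le_rfl⟩
    linarith
  · exfalso
    push Not at hex
    have key : ∀ t ∈ Ico a b, g t - k * log (b - t) ≤ g a - k * log (b - a) := by
      intro t ht
      have := mvt_le (g := fun s => g s - k * log (b - s))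
        (g' := fun s => g' s - k * ((-1) / (b - s))) (k := 0) ht.1 (fun s hs => by
          have hsb : s < b := hs.2.trans_lt ht.2
          exact (hg s ⟨hs.1, hsb⟩).sub
            ((((hasDerivAt_id s).const_sub b).log (by simp only [id]; linarith)).const_mul k))
        (fun s hs => by
          have hsb : s < b := hs.2.trans_lt ht.2
          have := h s ⟨hs.1, hsb⟩ (hex s ⟨hs.1, hsb⟩)
          have e : -k / (b - s) = k * (-1 / (b - s)) := by ring
          linarith)
      linarith
    have hlim : Tendsto (fun t => log (b - t)) (𝓝[<] b) atBot := by
      refine Real.tendsto_log_nhdsGT_zero.comp ?_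
      rw [tendsto_nhdsWithin_iff]
      constructor
      · have : Continuous (fun t : ℝ => b - t) := by fun_prop
        have := this.tendsto b
        simp only [sub_self] at this
        exact this.mono_left nhdsWithin_le_nhds
      · filter_upwards [self_mem_nhdsWithin] with t ht
        simp only [mem_Iio] at ht
        simp only [mem_Ioi]; linarith
    have h1 := hlim.eventually (eventually_lt_atBot ((c - g a + k * log (b - a)) / k))
    have h3 : ∀ᶠ s in 𝓝[<] b, s ∈ Ico a b := Ico_mem_nhdsLT hab
    obtain ⟨t, ht1, ht2⟩ := (h1.and h3).exists
    rw [lt_div_iff₀ hk] at ht1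
    have := key t ht2
    have := hex t ht2
    linarith

/-- bounded below on a left half line -/
lemma left_bound {g g' : ℝ → ℝ} {T B c k : ℝ} (hk : 0 < k)
    (hg : ∀ t ≤ T, HasDerivAt g (g' t) t) (hB : ∀ t ≤ T, B ≤ g t)
    (h : ∀ t ≤ T, g t ≤ c → k ≤ g' t) : ∀ t ≤ T, c < g t := by
  intro t0 ht0
  by_contra hc
  push Not at hc
  have key : ∀ t ≤ t0, g t ≤ c := by
    intro t ht
    rcases ht.eq_or_lt with rfl | ht
    · exact hc
    have := barrier_back0 (g := fun s => c - g s) (g' := fun s => - g' s) (a := t) (b := t0)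
      (fun s hs => (hg s (hs.2.trans ht0)).const_sub c) (by linarith)
      (fun s hs _ h0 => by
        have := h s (hs.2.trans ht0) (by linarith)
        linarith) t ⟨le_rfl, ht⟩
    linarith
  set t := t0 - (c - B + 1) / k
  have hcB : 0 ≤ c - B + 1 := by linarith [hB t0 ht0]
  have htt : t ≤ t0 := by
    have : 0 ≤ (c - B + 1) / k := by positivity
    simp only [t]; linarith
  have := mvt_ge (g := g) (g' := g') (k := k) htt (fun s hs => hg s (hs.2.trans ht0))
    (fun s hs => h s (hs.2.trans ht0) (key s hs.2))
  have e : k * (t0 - t) = c - B + 1 := by simp only [t]; field_simp; ring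
  have := hB t (htt.trans ht0)
  linarith

end Calc


/-- Parameters of the profile equation. -/
structure Par where
  m : ℝ
  p : ℝ
  s : ℝ
  n : ℝ
  α : ℝ
  β : ℝ
  hm : 1 < m
  hp0 : 0 < p
  hp1 : p < 1
  hs : 0 < s
  hn : 1 ≤ n
  hα : 0 < α
  hβ : 0 < β
  hmp : 2 < m + p
  hab : α * (m - 1) - 2 * β = 1
  hab2 : α * (m - p) = (s + 2) * β
  hg : 2 * (1 - p) < s * (m - 1)

namespace Par

noncomputable def r (P : Par) : ℝ := (1 - P.p) / (P.m - 1)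
noncomputable def g0 (P : Par) : ℝ := P.s - 2 * P.r
noncomputable def q (P : Par) : ℝ := P.α / P.β
noncomputable def ζ (P : Par) : ℝ := P.m ^ P.r
noncomputable def s' (P : Par) : ℝ := P.s - (1 - P.p) * P.q

variable (P : Par)

lemma hm1 : 0 < P.m - 1 := by linarith [P.hm]
lemma r_pos : 0 < P.r := div_pos (by linarith [P.hp1]) P.hm1
lemma r_mul : P.r * (P.m - 1) = 1 - P.p := by
  have := P.hm1
  unfold r; field_simp
lemma g0_pos : 0 < P.g0 := by
  have h := P.hm1
  have h1 := P.r_mul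
  have h2 := P.hg
  unfold g0
  by_contra hc
  push Not at hc
  nlinarith
lemma ζ_pos : 0 < P.ζ := rpow_pos_of_pos (by linarith [P.hm]) _
lemma q_pos : 0 < P.q := div_pos P.hα P.hβ
lemma q_mul : P.q * P.β = P.α := by
  have := P.hβ
  unfold q; field_simp
lemma q_m : 2 < (P.m - 1) * P.q := by
  have h := P.hβ
  have h1 := P.q_mul
  have h2 := P.hab
  by_contra hc
  push Not at hc
  have := mul_le_mul_of_nonneg_right hc h.le
  rw [mul_assoc, h1] at this
  linarith
lemma q_mp : P.q * (P.m - P.p) = P.s + 2 := by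
  have h := P.hβ
  have h2 := P.hab2
  unfold q
  field_simp
  linarith
lemma s'_eq : P.s' = (P.m - 1) * P.q - 2 := by
  have := P.q_mp
  unfold s'; linarith
lemma s'_pos : 0 < P.s' := by
  rw [s'_eq]; linarith [P.q_m]
lemma n_pos : 0 < P.n := by linarith [P.hn]

end Par

/-- A solution of the phase system on a set of (logarithmic) times. -/
structure Sol (P : Par) (I : Set ℝ) (X A Z : ℝ → ℝ) : Prop where
  dX : ∀ t ∈ I, HasDerivAt X ((P.m - 1) * A t - 2 * X t) t
  dA : ∀ t ∈ I, HasDerivAt A (P.α - P.n * A t - A t * (A t + P.β) / X t - Z t) t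
  dZ : ∀ t ∈ I, HasDerivAt Z (Z t * (P.s - (1 - P.p) * A t / X t)) t
  pX : ∀ t ∈ I, 0 < X t
  pZ : ∀ t ∈ I, 0 < Z t
  link : ∀ t ∈ I, Z t = P.ζ * exp (P.g0 * t) * X t ^ (- P.r)

lemma Sol.mono {P : Par} {I J : Set ℝ} {X A Z : ℝ → ℝ} (h : Sol P I X A Z) (hJ : J ⊆ I) :
    Sol P J X A Z :=
  ⟨fun t ht => h.dX t (hJ ht), fun t ht => h.dA t (hJ ht), fun t ht => h.dZ t (hJ ht),
    fun t ht => h.pX t (hJ ht), fun t ht => h.pZ t (hJ ht), fun t ht => h.link t (hJ ht)⟩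

namespace Par
variable (P : Par)

abbrev E := ℝ × ℝ × ℝ

noncomputable def cX (c : E) : ℝ := exp c.2.1
noncomputable def cA (c : E) : ℝ := c.2.2
noncomputable def cZ (c : E) : ℝ := P.ζ * exp (P.g0 * c.1 - P.r * c.2.1)

noncomputable def W2 (c : E) : ℝ := (P.m - 1) * c.2.2 * exp (- c.2.1) - 2
noncomputable def W3 (c : E) : ℝ :=
  P.α - P.n * c.2.2 - c.2.2 * (c.2.2 + P.β) * exp (- c.2.1) - P.cZ c
noncomputable def ρ (c : E) : ℝ := 1 / (1 + P.W2 c ^ 2 + P.W3 c ^ 2)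
noncomputable def V (c : E) : E := (P.ρ c, P.ρ c * P.W2 c, P.ρ c * P.W3 c)

lemma contDiff_W2 : ContDiff ℝ 1 P.W2 := by unfold W2; fun_prop
lemma contDiff_W3 : ContDiff ℝ 1 P.W3 := by unfold W3 cZ; fun_prop
lemma contDiff_ρ : ContDiff ℝ 1 P.ρ := by
  have h2 := P.contDiff_W2
  have h3 := P.contDiff_W3
  unfold ρ
  refine contDiff_const.div (by fun_prop) (fun c => by positivity)
lemma contDiff_V : ContDiff ℝ 1 P.V := by
  have h2 := P.contDiff_W2
  have h3 := P.contDiff_W3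
  have h4 := P.contDiff_ρ
  unfold V; fun_prop
lemma ρ_pos (c : E) : 0 < P.ρ c := by unfold ρ; positivity

lemma V_le (c : E) : ‖P.V c‖ ≤ 1 := by
  have aux : ∀ a b : ℝ, |1 / (1 + a ^ 2 + b ^ 2) * a| ≤ 1 := by
    intro a b
    have h : (0:ℝ) < 1 + a ^ 2 + b ^ 2 := by positivity
    rw [abs_mul, abs_of_pos (by positivity), one_div_mul_eq_div, div_le_one h]
    nlinarith [sq_nonneg (|a| - 1), sq_abs a, sq_nonneg b]
  unfold V
  simp only [Prod.norm_mk, Real.norm_eq_abs, sup_le_iff]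
  refine ⟨?_, aux _ _, ?_⟩
  · rw [abs_of_pos (P.ρ_pos c)]
    unfold ρ
    rw [div_le_one (by positivity)]
    nlinarith [sq_nonneg (P.W2 c), sq_nonneg (P.W3 c)]
  · have := aux (P.W3 c) (P.W2 c)
    unfold ρ
    rwa [show 1 + P.W3 c ^ 2 + P.W2 c ^ 2 = 1 + P.W2 c ^ 2 + P.W3 c ^ 2 by ring] at this

noncomputable def Φ : ℝ → E → E := (exists_flow P.contDiff_V P.V_le).choose

lemma Φ_zero (c : E) : P.Φ 0 c = c := (exists_flow P.contDiff_V P.V_le).choose_spec.1 c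
lemma Φ_deriv (c : E) (τ : ℝ) : HasDerivAt (fun τ => P.Φ τ c) (P.V (P.Φ τ c)) τ :=
  (exists_flow P.contDiff_V P.V_le).choose_spec.2.1 c τ
lemma Φ_cont : Continuous (fun q : ℝ × E => P.Φ q.1 q.2) :=
  (exists_flow P.contDiff_V P.V_le).choose_spec.2.2

noncomputable def T (c : E) (τ : ℝ) : ℝ := (P.Φ τ c).1

lemma T_deriv (c : E) (τ : ℝ) : HasDerivAt (P.T c) (P.ρ (P.Φ τ c)) τ := by
  have := (P.Φ_deriv c τ)
  exact (hasFDerivAt_fst.comp_hasDerivAt τ this)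

lemma x_deriv (c : E) (τ : ℝ) : HasDerivAt (fun τ => (P.Φ τ c).2.1)
    (P.ρ (P.Φ τ c) * P.W2 (P.Φ τ c)) τ := by
  have := (P.Φ_deriv c τ)
  exact (hasFDerivAt_fst.comp_hasDerivAt τ (hasFDerivAt_snd.comp_hasDerivAt τ this))

lemma A_deriv (c : E) (τ : ℝ) : HasDerivAt (fun τ => cA (P.Φ τ c))
    (P.ρ (P.Φ τ c) * P.W3 (P.Φ τ c)) τ := by
  have := (P.Φ_deriv c τ)
  exact (hasFDerivAt_snd.comp_hasDerivAt τ (hasFDerivAt_snd.comp_hasDerivAt τ this))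

lemma W2_eq (c : E) : P.W2 c = (P.m - 1) * cA c / cX c - 2 := by
  unfold W2 cA cX; rw [exp_neg]; ring
lemma W3_eq (c : E) : P.W3 c = P.α - P.n * cA c - cA c * (cA c + P.β) / cX c - P.cZ c := by
  unfold W3 cA cX; rw [exp_neg]; ring
lemma cX_pos (c : E) : 0 < cX c := exp_pos _
lemma cZ_pos (c : E) : 0 < P.cZ c := mul_pos P.ζ_pos (exp_pos _)

lemma X_deriv (c : E) (τ : ℝ) : HasDerivAt (fun τ => cX (P.Φ τ c))
    (P.ρ (P.Φ τ c) * ((P.m - 1) * cA (P.Φ τ c) - 2 * cX (P.Φ τ c))) τ := by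
  have h := (P.x_deriv c τ).exp
  refine h.congr_deriv ?_
  rw [W2_eq]
  have := cX_pos (P.Φ τ c)
  change cX (P.Φ τ c) * _ = _
  field_simp

lemma Z_deriv (c : E) (τ : ℝ) : HasDerivAt (fun τ => P.cZ (P.Φ τ c))
    (P.ρ (P.Φ τ c) * (P.cZ (P.Φ τ c) *
      (P.s - (1 - P.p) * cA (P.Φ τ c) / cX (P.Φ τ c)))) τ := by
  have h := ((((P.T_deriv c τ).const_mul P.g0).sub ((P.x_deriv c τ).const_mul P.r)).exp).const_mul P.ζ
  refine h.congr_deriv ?_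
  rw [W2_eq]
  have e1 : P.g0 = P.s - 2 * P.r := rfl
  have e2 := P.r_mul
  have e3 : P.cZ (P.Φ τ c) = P.ζ * exp (P.g0 * P.T c τ - P.r * (P.Φ τ c).2.1) := rfl
  rw [e3, ← e2]
  simp only [Pi.sub_apply, e1]
  ring

lemma cZ_link (c : E) : P.cZ c = P.ζ * exp (P.g0 * c.1) * cX c ^ (- P.r) := by
  unfold cZ cX
  rw [← exp_mul, mul_assoc, ← exp_add]
  ring_nf

lemma T_zero (c : E) : P.T c 0 = c.1 := by unfold T; rw [Φ_zero]

lemma T_strictMono (c : E) : StrictMono (P.T c) :=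
  strictMono_of_deriv_pos (fun τ => by rw [(P.T_deriv c τ).deriv]; exact P.ρ_pos _)

noncomputable def iv (c : E) : ℝ → ℝ := Function.invFun (P.T c)
lemma iv_T (c : E) (τ : ℝ) : P.iv c (P.T c τ) = τ :=
  Function.leftInverse_invFun (P.T_strictMono c).injective τ

noncomputable def I (c : E) : Set ℝ := range (P.T c)
lemma T_iv {c : E} {t : ℝ} (ht : t ∈ P.I c) : P.T c (P.iv c t) = t := by
  obtain ⟨τ, rfl⟩ := ht
  rw [iv_T]

lemma Φ_cont_τ (c : E) : Continuous (fun τ => P.Φ τ c) :=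
  P.Φ_cont.comp (by fun_prop : Continuous fun τ : ℝ => (τ, c))

lemma T_map (c : E) (τ : ℝ) : map (P.T c) (𝓝 τ) = 𝓝 (P.T c τ) := by
  have h : HasStrictDerivAt (P.T c) (P.ρ (P.Φ τ c)) τ := by
    refine hasStrictDerivAt_of_hasDerivAt_of_continuousAt (f' := fun τ => P.ρ (P.Φ τ c)) ?_ ?_
    · exact Eventually.of_forall (fun y => P.T_deriv c y)
    · exact (P.contDiff_ρ.continuous.comp (P.Φ_cont_τ c)).continuousAt
  exact h.map_nhds_eq (P.ρ_pos _).ne'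

lemma I_open (c : E) : IsOpen (P.I c) := by
  rw [isOpen_iff_mem_nhds]
  rintro t ⟨τ, rfl⟩
  rw [← T_map]
  exact Filter.mem_map.2 (Filter.univ_mem' (fun y => ⟨y, rfl⟩))

lemma I_ord (c : E) : OrdConnected (P.I c) := by
  have : Continuous (P.T c) := continuous_fst.comp (P.Φ_cont_τ c)
  exact (isPreconnected_range this).ordConnected

lemma mem_I (c : E) : c.1 ∈ P.I c := ⟨0, P.T_zero c⟩

lemma iv_deriv {c : E} {t : ℝ} (ht : t ∈ P.I c) :
    HasDerivAt (P.iv c) (P.ρ (P.Φ (P.iv c t) c))⁻¹ t := by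
  obtain ⟨τ, rfl⟩ := ht
  have hT : HasDerivAt (P.T c) (P.ρ (P.Φ τ c)) (P.iv c (P.T c τ)) := by
    rw [iv_T]; exact P.T_deriv c τ
  rw [iv_T]
  refine hT.of_local_left_inverse ?_ (P.ρ_pos _).ne' ?_
  · unfold ContinuousAt
    rw [← T_map, tendsto_map'_iff, iv_T]
    have : P.iv c ∘ P.T c = id := by ext y; exact P.iv_T c y
    rw [this]; exact tendsto_id
  · filter_upwards [(P.I_open c).mem_nhds ⟨τ, rfl⟩] with y hy using P.T_iv hy

noncomputable def Xs (c : E) (t : ℝ) : ℝ := cX (P.Φ (P.iv c t) c)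
noncomputable def As (c : E) (t : ℝ) : ℝ := cA (P.Φ (P.iv c t) c)
noncomputable def Zs (c : E) (t : ℝ) : ℝ := P.cZ (P.Φ (P.iv c t) c)

lemma iv_fst (c : E) : P.iv c c.1 = 0 := by
  have := P.iv_T c 0
  rwa [T_zero] at this
lemma Xs_start (c : E) : P.Xs c c.1 = cX c := by unfold Xs; rw [iv_fst, Φ_zero]
lemma As_start (c : E) : P.As c c.1 = cA c := by unfold As; rw [iv_fst, Φ_zero]
lemma Zs_start (c : E) : P.Zs c c.1 = P.cZ c := by unfold Zs; rw [iv_fst, Φ_zero]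

lemma sol (c : E) : Sol P (P.I c) (P.Xs c) (P.As c) (P.Zs c) := by
  constructor
  · intro t ht
    refine ((P.X_deriv c (P.iv c t)).comp t (P.iv_deriv ht)).congr_deriv ?_
    have := P.ρ_pos (P.Φ (P.iv c t) c)
    unfold Xs As; field_simp
  · intro t ht
    refine ((P.A_deriv c (P.iv c t)).comp t (P.iv_deriv ht)).congr_deriv ?_
    have := P.ρ_pos (P.Φ (P.iv c t) c)
    unfold Xs As Zs; rw [← W3_eq]; field_simp
  · intro t ht
    refine ((P.Z_deriv c (P.iv c t)).comp t (P.iv_deriv ht)).congr_deriv ?_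
    have := P.ρ_pos (P.Φ (P.iv c t) c)
    unfold Xs As Zs
    rw [mul_comm (P.ρ _), mul_assoc, mul_inv_cancel₀ this.ne', mul_one]
  · intro t ht; exact cX_pos _
  · intro t ht; exact P.cZ_pos _
  · intro t ht
    have := P.cZ_link (P.Φ (P.iv c t) c)
    rw [show (P.Φ (P.iv c t) c).1 = t from P.T_iv ht] at this
    exact this

lemma ρ_lower (a b δ M : ℝ) (hδ : 0 < δ) : ∃ k > 0, ∀ c : E, c.1 ∈ Icc a b →
    δ ≤ cX c → cX c ≤ M → |cA c| ≤ M → k ≤ P.ρ c := by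
  set K : Set E := Icc a b ×ˢ (Icc (log δ) (log M) ×ˢ Icc (-M) M)
  have hK : IsCompact K := isCompact_Icc.prod (isCompact_Icc.prod isCompact_Icc)
  have mem : ∀ c : E, c.1 ∈ Icc a b → δ ≤ cX c → cX c ≤ M → |cA c| ≤ M → c ∈ K := by
    intro c h1 h2 h3 h4
    refine ⟨h1, ⟨?_, ?_⟩, abs_le.1 h4⟩
    · rw [log_le_iff_le_exp hδ]; exact h2
    · rw [le_log_iff_exp_le ((cX_pos c).trans_le h3)]; exact h3
  rcases K.eq_empty_or_nonempty with he | hne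
  · exact ⟨1, one_pos, fun c h1 h2 h3 h4 => absurd (mem c h1 h2 h3 h4) (by rw [he]; simp)⟩
  · obtain ⟨c0, hc0, hmin⟩ := hK.exists_isMinOn hne P.contDiff_ρ.continuous.continuousOn
    exact ⟨P.ρ c0, P.ρ_pos _, fun c h1 h2 h3 h4 => hmin (mem c h1 h2 h3 h4)⟩

lemma dies_fwd {c : E} {b : ℝ} (hb : ∀ t ∈ P.I c, t ≤ b) {δ M t0 : ℝ} (hδ : 0 < δ)
    (ht0 : t0 ∈ P.I c) :
    ∃ t ∈ P.I c, t0 ≤ t ∧ ¬ (δ ≤ P.Xs c t ∧ P.Xs c t ≤ M ∧ |P.As c t| ≤ M) := by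
  by_contra hc
  push Not at hc
  obtain ⟨τ0, rfl⟩ := ht0
  obtain ⟨k, hk, hkk⟩ := P.ρ_lower (P.T c τ0) b δ M hδ
  have key : ∀ τ, τ0 ≤ τ → k ≤ P.ρ (P.Φ τ c) := by
    intro τ hτ
    have h1 : P.T c τ0 ≤ P.T c τ := (P.T_strictMono c).monotone hτ
    have h2 : P.T c τ ∈ P.I c := ⟨τ, rfl⟩
    have := hc _ h2 h1
    unfold Xs As at this
    rw [iv_T] at this
    exact hkk _ ⟨h1, hb _ h2⟩ this.1 this.2.1 this.2.2
  set d := (b - P.T c τ0 + 1) / k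
  have hd : 0 ≤ d := by
    have := hb (P.T c τ0) ⟨τ0, rfl⟩
    exact div_nonneg (by linarith) hk.le
  have := mvt_ge (g := P.T c) (k := k) (a := τ0) (b := τ0 + d) (by linarith)
    (fun τ _ => P.T_deriv c τ) (fun τ h => key τ h.1)
  have e : k * (τ0 + d - τ0) = b - P.T c τ0 + 1 := by simp only [d]; field_simp; ring
  have := hb (P.T c (τ0 + d)) ⟨_, rfl⟩
  linarith

lemma dies_bwd {c : E} {a : ℝ} (hb : ∀ t ∈ P.I c, a ≤ t) {δ M t0 : ℝ} (hδ : 0 < δ)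
    (ht0 : t0 ∈ P.I c) :
    ∃ t ∈ P.I c, t ≤ t0 ∧ ¬ (δ ≤ P.Xs c t ∧ P.Xs c t ≤ M ∧ |P.As c t| ≤ M) := by
  by_contra hc
  push Not at hc
  obtain ⟨τ0, rfl⟩ := ht0
  obtain ⟨k, hk, hkk⟩ := P.ρ_lower a (P.T c τ0) δ M hδ
  have key : ∀ τ, τ ≤ τ0 → k ≤ P.ρ (P.Φ τ c) := by
    intro τ hτ
    have h1 : P.T c τ ≤ P.T c τ0 := (P.T_strictMono c).monotone hτ
    have h2 : P.T c τ ∈ P.I c := ⟨τ, rfl⟩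
    have := hc _ h2 h1
    unfold Xs As at this
    rw [iv_T] at this
    exact hkk _ ⟨hb _ h2, h1⟩ this.1 this.2.1 this.2.2
  set d := (P.T c τ0 - a + 1) / k
  have hd : 0 ≤ d := by
    have := hb (P.T c τ0) ⟨τ0, rfl⟩
    exact div_nonneg (by linarith) hk.le
  have := mvt_ge (g := P.T c) (k := k) (a := τ0 - d) (b := τ0) (by linarith)
    (fun τ _ => P.T_deriv c τ) (fun τ h => key τ h.2)
  have e : k * (τ0 - (τ0 - d)) = P.T c τ0 - a + 1 := by simp only [d]; field_simp; ring
  have := hb (P.T c (τ0 - d)) ⟨_, rfl⟩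
  linarith

/-- Forward life span. -/
lemma life_fwd (c : E) : Ici c.1 ⊆ P.I c ∨ ∃ b, c.1 < b ∧ (∀ t, c.1 ≤ t → (t ∈ P.I c ↔ t < b)) ∧
    ∀ δ M t0, 0 < δ → c.1 ≤ t0 → t0 < b → ∃ t ∈ Ico t0 b,
      ¬ (δ ≤ P.Xs c t ∧ P.Xs c t ≤ M ∧ |P.As c t| ≤ M) := by
  by_cases hb : BddAbove (P.I c)
  · right
    have hne : (P.I c).Nonempty := ⟨_, P.mem_I c⟩
    have hni : sSup (P.I c) ∉ P.I c := by
      intro h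
      obtain ⟨ε, hε, hsub⟩ := Metric.isOpen_iff.1 (P.I_open c) _ h
      have : sSup (P.I c) + ε/2 ∈ P.I c := hsub (by
        rw [Metric.mem_ball, Real.dist_eq, add_sub_cancel_left, abs_of_pos (by linarith)]; linarith)
      have := le_csSup hb this
      linarith
    have hlt : ∀ t ∈ P.I c, t < sSup (P.I c) := fun t ht =>
      lt_of_le_of_ne (le_csSup hb ht) (fun h => hni (h ▸ ht))
    have hiff : ∀ t, c.1 ≤ t → (t ∈ P.I c ↔ t < sSup (P.I c)) := by
      intro t ht
      refine ⟨hlt t, fun h => ?_⟩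
      obtain ⟨u, hu, htu⟩ := exists_lt_of_lt_csSup hne h
      exact (P.I_ord c).out (P.mem_I c) hu ⟨ht, htu.le⟩
    refine ⟨sSup (P.I c), hlt _ (P.mem_I c), hiff, ?_⟩
    intro δ M t0 hδ h1 h2
    obtain ⟨t, h3, h4, h5⟩ := P.dies_fwd (M := M) (fun t ht => (hlt t ht).le) hδ ((hiff t0 h1).2 h2)
    exact ⟨t, ⟨h4, hlt t h3⟩, h5⟩
  · left
    intro t ht
    rw [not_bddAbove_iff] at hb
    obtain ⟨u, hu, htu⟩ := hb t
    exact (P.I_ord c).out (P.mem_I c) hu ⟨ht, htu.le⟩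

/-- Backward life span. -/
lemma life_bwd (c : E) (δ M : ℝ → ℝ) (hδ : ∀ t, 0 < δ t)
    (h : ∀ a, ∀ t ∈ P.I c, a ≤ t → t ≤ c.1 → δ a ≤ P.Xs c t ∧ P.Xs c t ≤ M a ∧ |P.As c t| ≤ M a) :
    Iic c.1 ⊆ P.I c := by
  by_cases hb : BddBelow (P.I c)
  · exfalso
    obtain ⟨a, ha⟩ := hb
    obtain ⟨t, h3, h4, h5⟩ := P.dies_bwd (M := M a) (fun t ht => ha ht) (hδ a) (P.mem_I c)
    exact h5 (h a t h3 (ha h3) h4)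
  · intro t ht
    rw [not_bddBelow_iff] at hb
    obtain ⟨u, hu, htu⟩ := hb t
    exact (P.I_ord c).out hu (P.mem_I c) ⟨htu.le, ht⟩

end Par


lemma barrier_cont_back {g : ℝ → ℝ} {a b : ℝ} (hg : ContinuousOn g (Icc a b)) (hb : 0 < g b)
    (h : ∀ t ∈ Ico a b, (∀ s ∈ Ioc t b, 0 < g s) → g t = 0 → False) :
    ∀ t ∈ Icc a b, 0 < g t := by
  intro t ht
  have := barrier_cont (g := fun s => g (-s)) (a := -b) (b := -a)
    (hg.comp continuous_neg.continuousOn (fun s hs => ⟨by linarith [hs.2], by linarith [hs.1]⟩))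
    (by simpa using hb) (fun s hs h1 h2 => by
      exact h (-s) ⟨by linarith [hs.2], by linarith [hs.1]⟩ (fun w hw => by
        have := h1 (-w) ⟨by linarith [hw.2], by linarith [hw.1]⟩
        simpa using this) h2) (-t) ⟨by linarith [ht.2], by linarith [ht.1]⟩
  simpa using this

namespace Par
variable (P : Par)

lemma isOpen_forall {Y : Type*} [TopologicalSpace Y] {c : Y → E} (hc : Continuous c) {O : Set E}
    (hO : IsOpen O) (a b : ℝ) : IsOpen {y | ∀ s ∈ Icc a b, P.Φ s (c y) ∈ O} := by
  rw [isOpen_iff_mem_nhds]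
  intro y hy
  refine isCompact_Icc.eventually_forall_of_forall_eventually (P := fun y s => P.Φ s (c y) ∈ O) ?_
  intro s hs
  have : Continuous (fun z : Y × ℝ => P.Φ z.2 (c z.1)) :=
    P.Φ_cont.comp (by fun_prop : Continuous fun z : Y × ℝ => (z.2, c z.1))
  exact this.continuousAt.eventually (hO.mem_nhds (hy s hs))

lemma cont_cA : Continuous cA := by unfold cA; fun_prop
lemma cont_cX : Continuous cX := by unfold cX; fun_prop
lemma cont_cZ : Continuous P.cZ := by unfold cZ; fun_prop

/-- Backward orbit stays in the closed strip. -/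
def Good (c : E) : Prop :=
  ∀ τ ≤ 0, 0 ≤ cA (P.Φ τ c) ∧ cA (P.Φ τ c) ≤ P.α / P.n ∧ cA (P.Φ τ c) ≤ P.q * cX (P.Φ τ c)

lemma good_closed : IsClosed {c : E | P.Good c} := by
  have : {c : E | P.Good c} = ⋂ τ : Iic (0:ℝ), {c | 0 ≤ cA (P.Φ τ c) ∧ cA (P.Φ τ c) ≤ P.α / P.n ∧
      cA (P.Φ τ c) ≤ P.q * cX (P.Φ τ c)} := by
    ext c; simp [Good]
  rw [this]
  refine isClosed_iInter fun τ => ?_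
  have h : Continuous (fun c => P.Φ τ c) :=
    P.Φ_cont.comp (by fun_prop : Continuous fun c : E => ((τ:ℝ), c))
  have h1 := cont_cA.comp h
  have h2 := cont_cX.comp h
  exact (isClosed_le continuous_const h1).inter ((isClosed_le h1 continuous_const).inter
    (isClosed_le h1 (continuous_const.mul h2)))

def Lo (c : E) : Prop := ∃ τ ≤ 0, cA (P.Φ τ c) < 0 ∧
  ∀ s ∈ Icc τ 0, P.Φ s c ∈ {d : E | cA d < P.α / P.n ∧ cA d < P.q * cX d}
def Hi (c : E) : Prop := ∃ τ ≤ 0, (P.α / P.n < cA (P.Φ τ c) ∨ P.q * cX (P.Φ τ c) < cA (P.Φ τ c)) ∧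
  ∀ s ∈ Icc τ 0, P.Φ s c ∈ {d : E | 0 < cA d}

lemma lo_hi_disj {c : E} (h1 : P.Lo c) (h2 : P.Hi c) : False := by
  obtain ⟨τ1, ht1, ha1, hb1⟩ := h1
  obtain ⟨τ2, ht2, ha2, hb2⟩ := h2
  rcases le_total τ1 τ2 with h | h
  · have := hb1 τ2 ⟨h, ht2⟩
    simp only [mem_ofPred_eq] at this
    rcases ha2 with h' | h' <;> linarith [this.1, this.2]
  · have := hb2 τ1 ⟨h, ht1⟩
    simp only [mem_ofPred_eq] at this
    linarith

lemma lo_open {Y : Type*} [TopologicalSpace Y] {c : Y → E} (hc : Continuous c) :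
    IsOpen {y | P.Lo (c y)} := by
  have : {y | P.Lo (c y)} = ⋃ τ : Iic (0:ℝ), ({y | cA (P.Φ τ (c y)) < 0} ∩
    {y | ∀ s ∈ Icc (τ:ℝ) 0, P.Φ s (c y) ∈ {d : E | cA d < P.α / P.n ∧ cA d < P.q * cX d}}) := by
    ext y; simp [Lo]; grind
  rw [this]
  refine isOpen_iUnion fun τ => (isOpen_lt ?_ continuous_const).inter (P.isOpen_forall hc ?_ _ _)
  · exact cont_cA.comp (P.Φ_cont.comp (by fun_prop : Continuous fun y => ((τ:ℝ), c y)))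
  · exact (isOpen_lt cont_cA continuous_const).inter
      (isOpen_lt cont_cA (continuous_const.mul cont_cX))

lemma hi_open {Y : Type*} [TopologicalSpace Y] {c : Y → E} (hc : Continuous c) :
    IsOpen {y | P.Hi (c y)} := by
  have : {y | P.Hi (c y)} = ⋃ τ : Iic (0:ℝ), (({y | P.α / P.n < cA (P.Φ τ (c y))} ∪
      {y | P.q * cX (P.Φ τ (c y)) < cA (P.Φ τ (c y))}) ∩
    {y | ∀ s ∈ Icc (τ:ℝ) 0, P.Φ s (c y) ∈ {d : E | 0 < cA d}}) := by
    ext y; simp [Hi]; grind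
  rw [this]
  have h (τ : ℝ) : Continuous (fun y => P.Φ τ (c y)) :=
    P.Φ_cont.comp (by fun_prop : Continuous fun y => ((τ:ℝ), c y))
  refine isOpen_iUnion fun τ => IsOpen.inter (IsOpen.union ?_ ?_) (P.isOpen_forall hc ?_ _ _)
  · exact isOpen_lt continuous_const (cont_cA.comp (h τ))
  · exact isOpen_lt (continuous_const.mul (cont_cX.comp (h τ))) (cont_cA.comp (h τ))
  · exact isOpen_lt continuous_const cont_cA

lemma left_interval {p : ℝ → Prop} {t : ℝ} (h : ∀ᶠ s in 𝓝 t, p s) {r : ℝ → Prop}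
    (h2 : ∀ᶠ s in 𝓝[<] t, r s) : ∃ u < t, r u ∧ ∀ s ∈ Icc u t, p s := by
  obtain ⟨ε, hε, h1⟩ := Metric.eventually_nhds_iff.1 h
  have h3 : ∀ᶠ s in 𝓝[<] t, s ∈ Ico (t - ε/2) t := Ico_mem_nhdsLT (by linarith)
  obtain ⟨u, hu, hu2⟩ := (h2.and h3).exists
  refine ⟨u, hu2.2, hu, fun s hs => h1 ?_⟩
  rw [Real.dist_eq, abs_lt]
  constructor <;> linarith [hs.1, hs.2, hu2.1]

lemma eventually_neg_left {g : ℝ → ℝ} {a d : ℝ} (h : HasDerivAt g d a) (ha : g a = 0)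
    (hd : 0 < d) : ∀ᶠ t in 𝓝[<] a, g t < 0 := by
  have h1 := hasDerivAt_iff_tendsto_slope_left_right.1 h |>.1
  have h2 := h1.eventually (lt_mem_nhds hd)
  filter_upwards [h2, self_mem_nhdsWithin] with s hs hs'
  rw [slope_def_field, ha, sub_zero] at hs
  simp only [mem_Iio] at hs'
  by_contra hc
  push Not at hc
  have := div_nonpos_of_nonneg_of_nonpos hc (show s - a ≤ 0 by linarith)
  linarith

lemma exit_lo {c : E} {τ : ℝ} (hτ : τ ≤ 0)
    (h : ∀ s ∈ Icc τ 0, P.Φ s c ∈ {d : E | cA d < P.α / P.n ∧ cA d < P.q * cX d})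
    (h0 : cA (P.Φ τ c) = 0) (hZ : P.cZ (P.Φ τ c) < P.α) : P.Lo c := by
  have h1 := eventually_neg_left (P.A_deriv c τ) h0 (by
    refine mul_pos (P.ρ_pos _) ?_
    rw [W3_eq, h0]; simp; exact hZ)
  have hO : IsOpen {d : E | cA d < P.α / P.n ∧ cA d < P.q * cX d} :=
    (isOpen_lt cont_cA continuous_const).inter
      (isOpen_lt cont_cA (continuous_const.mul cont_cX))
  obtain ⟨u, hu, hu1, hu2⟩ := left_interval
    ((P.Φ_cont_τ c).continuousAt.eventually (hO.mem_nhds (h τ ⟨le_rfl, hτ⟩))) h1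
  refine ⟨u, by linarith, hu1, fun s hs => ?_⟩
  rcases le_total s τ with h' | h'
  · exact hu2 s ⟨hs.1, h'⟩
  · exact h s ⟨h', hs.2⟩

lemma exit_hi {c : E} {τ : ℝ} (hτ : τ ≤ 0)
    (h : ∀ s ∈ Icc τ 0, P.Φ s c ∈ {d : E | 0 < cA d})
    (h0 : cA (P.Φ τ c) = P.α / P.n ∨ cA (P.Φ τ c) = P.q * cX (P.Φ τ c)) : P.Hi c := by
  have hApos : 0 < cA (P.Φ τ c) := h τ ⟨le_rfl, hτ⟩
  have hXpos := cX_pos (P.Φ τ c)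
  have hZpos := P.cZ_pos (P.Φ τ c)
  have hβ := P.hβ
  have hev : ∀ᶠ s in 𝓝[<] τ, (P.α / P.n < cA (P.Φ s c) ∨ P.q * cX (P.Φ s c) < cA (P.Φ s c)) := by
    rcases h0 with h0 | h0
    · have h1 := eventually_neg_left ((P.A_deriv c τ).const_sub (P.α / P.n)) (by linarith) (by
        rw [← mul_neg]
        refine mul_pos (P.ρ_pos _) ?_
        have : P.n * cA (P.Φ τ c) = P.α := by rw [h0]; have := P.n_pos; field_simp
        rw [W3_eq, this]
        have : 0 < cA (P.Φ τ c) * (cA (P.Φ τ c) + P.β) / cX (P.Φ τ c) := by positivity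
        linarith)
      filter_upwards [h1] with s hs
      left; linarith
    · have h1 := eventually_neg_left (((P.X_deriv c τ).const_mul P.q).sub (P.A_deriv c τ))
        (by simp only [Pi.sub_apply]; linarith) (by
        have e : P.q * (P.ρ (P.Φ τ c) * ((P.m - 1) * cA (P.Φ τ c) - 2 * cX (P.Φ τ c))) -
          P.ρ (P.Φ τ c) * P.W3 (P.Φ τ c) = P.ρ (P.Φ τ c) * (P.q * cX (P.Φ τ c) *
            (P.m * P.q + P.n - 2) + P.cZ (P.Φ τ c)) := by
          rw [W3_eq, h0, ← P.q_mul]; field_simp; ring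
        rw [e]
        refine mul_pos (P.ρ_pos _) ?_
        have h1 := P.q_m
        have h2 := P.q_pos
        have h3 := P.n_pos
        have : 0 < P.m * P.q + P.n - 2 := by nlinarith
        positivity)
      filter_upwards [h1] with s hs
      simp only [Pi.sub_apply] at hs
      right; linarith
  have hO : IsOpen {d : E | 0 < cA d} := isOpen_lt continuous_const cont_cA
  obtain ⟨u, hu, hu1, hu2⟩ := left_interval
    ((P.Φ_cont_τ c).continuousAt.eventually (hO.mem_nhds (h τ ⟨le_rfl, hτ⟩))) hev
  refine ⟨u, by linarith, hu1, fun s hs => ?_⟩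
  rcases le_total s τ with h' | h'
  · exact hu2 s ⟨hs.1, h'⟩
  · exact h s ⟨h', hs.2⟩

lemma good_of_not {c : E} (h0 : 0 ≤ cA c) (h1 : cA c ≤ P.α / P.n) (h2 : cA c ≤ P.q * cX c)
    (hZ : P.cZ c < P.α) (hL : ¬ P.Lo c) (hH : ¬ P.Hi c) : P.Good c := by
  have hαn : 0 < P.α / P.n := div_pos P.hα P.n_pos
  have hqX : ∀ d : E, 0 < P.q * cX d := fun d => mul_pos P.q_pos (cX_pos d)
  have c1 : 0 < cA c := by
    refine h0.lt_of_ne' fun h => hL (P.exit_lo (τ := 0) le_rfl ?_ ?_ ?_)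
    · intro s hs
      have : s = 0 := le_antisymm hs.2 hs.1
      rw [this, Φ_zero]
      simp only [mem_ofPred_eq, h]; exact ⟨hαn, hqX c⟩
    · rw [Φ_zero]; exact h
    · rw [Φ_zero]; exact hZ
  have c2 : ¬ (cA c = P.α / P.n ∨ cA c = P.q * cX c) := by
    intro h
    refine hH (P.exit_hi (τ := 0) le_rfl ?_ ?_)
    · intro s hs
      have : s = 0 := le_antisymm hs.2 hs.1
      rw [this, Φ_zero]
      exact c1
    · rw [Φ_zero]; exact h
  push Not at c2
  have c3 := lt_of_le_of_ne h1 c2.1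
  have c4 := lt_of_le_of_ne h2 c2.2
  set g : ℝ → ℝ := fun τ => min (cA (P.Φ τ c)) (min (P.α / P.n - cA (P.Φ τ c))
    (P.q * cX (P.Φ τ c) - cA (P.Φ τ c))) with hg
  have hgc : Continuous g := by
    have h := P.Φ_cont_τ c
    have h1 := cont_cA.comp h
    have h2 := cont_cX.comp h
    exact h1.min ((continuous_const.sub h1).min ((continuous_const.mul h2).sub h1))
  have hgpos : ∀ τ, 0 < g τ ↔ 0 < cA (P.Φ τ c) ∧ cA (P.Φ τ c) < P.α / P.n ∧
      cA (P.Φ τ c) < P.q * cX (P.Φ τ c) := by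
    intro τ; simp only [hg, lt_min_iff, sub_pos]
  intro τ hτ
  have := barrier_cont_back (g := g) (a := τ) (b := 0) hgc.continuousOn
    (by rw [hgpos, Φ_zero]; exact ⟨c1, c3, c4⟩) (by
    intro t ht hin h00
    have hin' : ∀ s ∈ Ioc t 0, _ := fun s hs => (hgpos s).1 (hin s hs)
    have hge : 0 ≤ g t := h00.ge
    simp only [hg, le_min_iff, sub_nonneg] at hge
    have hZt : P.cZ (P.Φ t c) < P.α := by
      have := mvt_ge (g := fun τ => P.cZ (P.Φ τ c)) (k := 0) ht.2.le
        (fun τ _ => P.Z_deriv c τ) (fun s hs => by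
          refine mul_nonneg (P.ρ_pos _).le (mul_nonneg (P.cZ_pos _).le ?_)
          have hA : cA (P.Φ s c) ≤ P.q * cX (P.Φ s c) := by
            rcases hs.1.eq_or_lt with h | h
            · rw [← h]; exact hge.2.2
            · exact (hin' s ⟨h, hs.2⟩).2.2.le
          have h1 : cA (P.Φ s c) / cX (P.Φ s c) ≤ P.q := by
            rw [div_le_iff₀ (cX_pos _)]; exact hA
          have h2 := P.s'_pos
          unfold s' at h2
          have h3 := mul_le_mul_of_nonneg_left h1 (show 0 ≤ 1 - P.p by linarith [P.hp1])
          rw [mul_div_assoc]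
          linarith)
      simp only [zero_mul, Φ_zero] at this
      linarith
    by_cases hA0 : cA (P.Φ t c) = 0
    · refine hL (P.exit_lo ht.2.le ?_ hA0 hZt)
      intro s hs
      rcases hs.1.eq_or_lt with h | h
      · simp only [mem_ofPred_eq]
        rw [← h, hA0]; exact ⟨hαn, hqX _⟩
      · exact (hin' s ⟨h, hs.2⟩).2
    · have hA1 : 0 < cA (P.Φ t c) := hge.1.lt_of_ne' hA0
      refine hH (P.exit_hi ht.2.le ?_ ?_)
      · intro s hs
        rcases hs.1.eq_or_lt with h | h
        · rw [← h]; exact hA1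
        · exact (hin' s ⟨h, hs.2⟩).1
      · by_contra hcon
        push Not at hcon
        have : 0 < g t := (hgpos t).2 ⟨hA1, lt_of_le_of_ne hge.2.1 hcon.1,
          lt_of_le_of_ne hge.2.2 hcon.2⟩
        linarith) τ ⟨le_rfl, hτ⟩
  have := (hgpos τ).1 this
  exact ⟨this.1.le, this.2.1.le, this.2.2.le⟩

lemma cZ_indep (t x a b : ℝ) : P.cZ (t, x, a) = P.cZ (t, x, b) := rfl

lemma exists_good (t x : ℝ) (hZ : P.cZ (t, x, 0) < P.α) : ∃ a, P.Good (t, x, a) := by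
  have hαn : 0 < P.α / P.n := div_pos P.hα P.n_pos
  set c : ℝ → E := fun a => (t, x, a) with hc
  have hcc : Continuous c := by fun_prop
  set M := min (P.α / P.n) (P.q * exp x) with hM
  have hM0 : 0 < M := lt_min hαn (mul_pos P.q_pos (exp_pos _))
  by_contra hno
  push Not at hno
  have hcov : Icc 0 M ⊆ {a | P.Lo (c a)} ∪ {a | P.Hi (c a)} := by
    intro a ha
    by_contra hcon
    simp only [mem_union, mem_ofPred_eq, not_or] at hcon
    exact hno a (P.good_of_not ha.1 (ha.2.trans (min_le_left _ _)) (ha.2.trans (min_le_right _ _))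
      hZ hcon.1 hcon.2)
  have h0 : P.Lo (c 0) := by
    refine P.exit_lo (τ := 0) le_rfl ?_ ?_ ?_
    · intro s hs
      have : s = 0 := le_antisymm hs.2 hs.1
      rw [this, Φ_zero]
      exact ⟨hαn, mul_pos P.q_pos (exp_pos _)⟩
    · rw [Φ_zero]; rfl
    · rw [Φ_zero]; exact hZ
  have h1 : P.Hi (c M) := by
    refine P.exit_hi (τ := 0) le_rfl ?_ ?_
    · intro s hs
      have : s = 0 := le_antisymm hs.2 hs.1
      rw [this, Φ_zero]
      exact hM0
    · rw [Φ_zero]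
      exact min_choice (P.α / P.n) (P.q * exp x)
  obtain ⟨a, -, ha1, ha2⟩ := isPreconnected_Icc _ _ (P.lo_open hcc) (P.hi_open hcc) hcov
    ⟨0, ⟨le_rfl, hM0.le⟩, h0⟩ ⟨M, ⟨hM0.le, le_rfl⟩, h1⟩
  exact P.lo_hi_disj ha1 ha2

end Par

/-- Solutions on a left half line, in the strip. -/
structure BSol (P : Par) (t1 : ℝ) (X A Z : ℝ → ℝ) : Prop extends Sol P (Iic t1) X A Z where
  A0 : ∀ t ≤ t1, 0 ≤ A t
  An : ∀ t ≤ t1, A t ≤ P.α / P.n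
  Aq : ∀ t ≤ t1, A t ≤ P.q * X t

namespace Par
variable (P : Par)

lemma good_bsol {c : E} (h : P.Good c) : Iic c.1 ⊆ P.I c ∧
    BSol P c.1 (P.Xs c) (P.As c) (P.Zs c) := by
  have key : ∀ t ∈ P.I c, t ≤ c.1 →
      0 ≤ P.As c t ∧ P.As c t ≤ P.α / P.n ∧ P.As c t ≤ P.q * P.Xs c t := by
    intro t ht htc
    refine h (P.iv c t) ?_
    rw [← (P.T_strictMono c).le_iff_le, P.T_iv ht, T_zero]
    exact htc
  have hS := P.sol c
  have hI : Iic c.1 ⊆ P.I c := by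
    refine P.life_bwd c (fun a => P.Xs c c.1 * exp (-(P.s' * (c.1 - a))))
      (fun a => max (P.Xs c c.1 * exp (2 * (c.1 - a))) (P.α / P.n)) (fun a =>
        mul_pos (hS.pX _ (P.mem_I c)) (exp_pos _)) ?_
    intro a t ht hat htc
    have hsub : Icc t c.1 ⊆ P.I c := (P.I_ord c).out ht (P.mem_I c)
    have hXpos := hS.pX _ (P.mem_I c)
    refine ⟨?_, le_max_of_le_left ?_, le_max_of_le_right ?_⟩
    · have := exp_le' (g := P.Xs c) (k := P.s') htc (fun s hs => hS.dX s (hsub hs)) (fun s hs => by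
        have := key s (hsub hs) hs.2
        rw [s'_eq]
        have := mul_le_mul_of_nonneg_left this.2.2 P.hm1.le
        linarith)
      have h2 : P.Xs c c.1 * exp (-(P.s' * (c.1 - t))) ≤ P.Xs c t := by
        rw [exp_neg, ← div_eq_mul_inv, div_le_iff₀ (exp_pos _)]; exact this
      refine le_trans ?_ h2
      gcongr
      exact P.s'_pos.le
    · have := exp_ge (g := P.Xs c) (k := -2) htc (fun s hs => hS.dX s (hsub hs)) (fun s hs => by
        have := key s (hsub hs) hs.2
        have := mul_nonneg P.hm1.le this.1
        linarith)
      have h2 : P.Xs c t ≤ P.Xs c c.1 * exp (2 * (c.1 - t)) := by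
        rw [neg_mul, exp_neg, ← div_eq_mul_inv, div_le_iff₀ (exp_pos _)] at this; exact this
      refine h2.trans ?_
      gcongr
    · have := key t ht htc
      rw [abs_of_nonneg this.1]; exact this.2.1
  exact ⟨hI, ⟨hS.mono hI, fun t ht => (key t (hI ht) ht).1, fun t ht => (key t (hI ht) ht).2.1,
    fun t ht => (key t (hI ht) ht).2.2⟩⟩

end Par

lemma bsol_unique_aux {P : Par} {t1 : ℝ} {X A Z X' A' Z' : ℝ → ℝ} (h : BSol P t1 X A Z)
    (h' : BSol P t1 X' A' Z') (hX : X t1 = X' t1) : A t1 ≤ A' t1 := by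
  by_contra hc
  push Not at hc
  have hm := P.hm1
  -- comparison on an interval where A - A' is nonnegative
  have grow : ∀ t ≤ t1, (∀ s ∈ Icc t t1, A' s ≤ A s) →
      (A t1 - A' t1) * exp (P.n * (t1 - t)) ≤ A t - A' t := by
    intro t ht hpos
    have hD : ∀ s ∈ Icc t t1, X s ≤ X' s := by
      intro s hs
      have := mvt_le (g := fun w => (X' w - X w) * exp (2 * w))
        (g' := fun w => (P.m - 1) * (A' w - A w) * exp (2 * w)) (k := 0) hs.2 (fun w hw => by
          have e : HasDerivAt (fun w : ℝ => exp (2 * w)) (exp (2 * w) * (2 * 1)) w :=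
            ((hasDerivAt_id w).const_mul 2).exp
          exact (((h'.dX w hw.2).sub (h.dX w hw.2)).mul e).congr_deriv (by
            simp only [Pi.sub_apply]; ring))
        (fun w hw => by
          have := hpos w ⟨hs.1.trans hw.1, hw.2⟩
          exact mul_nonpos_of_nonpos_of_nonneg
            (mul_nonpos_of_nonneg_of_nonpos hm.le (by linarith)) (exp_pos _).le)
      simp only [hX, sub_self, zero_mul] at this
      have h2 : 0 ≤ (X' s - X s) * exp (2 * s) := by linarith
      have := nonneg_of_mul_nonneg_left h2 (exp_pos _)
      linarith
    have := exp_le' (g := fun w => A w - A' w) (k := - P.n) ht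
      (fun s hs => (h.dA s hs.2).sub (h'.dA s hs.2)) (fun s hs => by
        have a1 := hpos s hs
        have a2 := hD s hs
        have a3 := h'.A0 s hs.2
        have p1 := h.pX s hs.2
        have p2 := h'.pX s hs.2
        have hβ := P.hβ
        have a4 : 0 ≤ A s := a3.trans a1
        have b1 : A' s * (A' s + P.β) / X' s ≤ A s * (A s + P.β) / X s := by gcongr
        have b2 : Z' s ≤ Z s := by
          rw [h.link s hs.2, h'.link s hs.2]
          refine mul_le_mul_of_nonneg_left ?_ (mul_pos P.ζ_pos (exp_pos _)).le
          exact rpow_le_rpow_of_nonpos p1 a2 (by linarith [P.r_pos])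
        linarith)
    rw [neg_mul, exp_neg, ← div_eq_mul_inv, le_div_iff₀ (exp_pos _)] at this
    exact this
  have pos : ∀ t ≤ t1, 0 < A t - A' t := by
    intro t ht
    refine barrier_cont_back (g := fun s => A s - A' s) (a := t) (b := t1) ?_ (by linarith) ?_ t
      ⟨le_rfl, ht⟩
    · intro s hs
      exact ((h.dA s hs.2).continuousAt.sub (h'.dA s hs.2).continuousAt).continuousWithinAt
    · intro s hs hin h0
      have := grow s hs.2.le (fun w hw => by
        rcases hw.1.eq_or_lt with e | e
        · rw [← e]; linarith
        · linarith [hin w ⟨e, hw.2⟩])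
      have h3 : 0 < (A t1 - A' t1) * exp (P.n * (t1 - s)) := mul_pos (by linarith) (exp_pos _)
      linarith
  set d := A t1 - A' t1
  have hd : 0 < d := by simp only [d]; linarith
  set w := P.α / P.n / (d * P.n)
  have hn := P.n_pos
  have hw : 0 ≤ w := by
    have := P.hα
    positivity
  have h1 := grow (t1 - w) (by linarith) (fun s hs => by linarith [pos s hs.2])
  have h2 := h.An (t1 - w) (by linarith)
  have h3 := h'.A0 (t1 - w) (by linarith)
  have h4 := add_one_le_exp (P.n * (t1 - (t1 - w)))
  have h5 : d * (P.n * (t1 - (t1 - w)) + 1) ≤ d * exp (P.n * (t1 - (t1 - w))) := by gcongr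
  have h6 : d * (P.n * (t1 - (t1 - w)) + 1) = P.α / P.n + d := by
    simp only [w, sub_sub_cancel]; field_simp
  linarith

namespace Par
variable (P : Par)

lemma good_unique {t x a b : ℝ} (ha : P.Good (t, x, a)) (hb : P.Good (t, x, b)) : a = b := by
  have h1 := (P.good_bsol ha).2
  have h2 := (P.good_bsol hb).2
  have e1 := P.Xs_start (t, x, a)
  have e2 := P.Xs_start (t, x, b)
  have e3 := P.As_start (t, x, a)
  have e4 := P.As_start (t, x, b)
  have f1 := bsol_unique_aux h1 h2 (by rw [e1]; rw [show P.Xs (t, x, b) (t, x, a).1 = cX (t, x, b) from e2]; rfl)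
  have f2 := bsol_unique_aux h2 h1 (by rw [e2]; rw [show P.Xs (t, x, a) (t, x, b).1 = cX (t, x, a) from e1]; rfl)
  rw [e3, show P.As (t, x, b) (t, x, a).1 = cA (t, x, b) from e4] at f1
  rw [e4, show P.As (t, x, a) (t, x, b).1 = cA (t, x, a) from e3] at f2
  exact le_antisymm f1 f2

/-- Continuous selection of good backward orbits. -/
lemma exists_branch (t : ℝ) : ∃ g : ℝ → ℝ, (∀ x, P.cZ (t, x, 0) < P.α → P.Good (t, x, g x)) ∧
    ContinuousOn g {x | P.cZ (t, x, 0) < P.α} := by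
  choose! g hg using P.exists_good t
  refine ⟨g, hg, ?_⟩
  have hS : IsOpen {x | P.cZ (t, x, 0) < P.α} :=
    isOpen_lt (P.cont_cZ.comp (by fun_prop : Continuous fun x : ℝ => ((t, x, 0) : E))) continuous_const
  intro x0 hx0
  refine ContinuousAt.continuousWithinAt ?_
  have hev : ∀ᶠ x in 𝓝 x0, x ∈ {x | P.cZ (t, x, 0) < P.α} := hS.mem_nhds hx0
  refine isCompact_Icc (a := (0:ℝ)) (b := P.α / P.n) |>.tendsto_nhds_of_unique_mapClusterPt ?_ ?_
  · filter_upwards [hev] with x hx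
    have := hg x hx 0 le_rfl
    rw [Φ_zero] at this
    exact ⟨this.1, this.2.1⟩
  · intro y _ hy
    refine P.good_unique ?_ (hg x0 hx0)
    by_contra hno
    have hop : IsOpen {z : ℝ × ℝ | ¬ P.Good (t, z.1, z.2)} :=
      (P.good_closed.preimage (by fun_prop : Continuous fun z : ℝ × ℝ => ((t, z.1, z.2) : E))).isOpen_compl
    have hmem : {z : ℝ × ℝ | ¬ P.Good (t, z.1, z.2)} ∈ 𝓝 (x0, y) := hop.mem_nhds hno
    rw [nhds_prod_eq] at hmem
    obtain ⟨u, hu, v, hv, huv⟩ := Filter.mem_prod_iff.1 hmem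
    have hfr := (mapClusterPt_iff_frequently.1 hy v hv)
    obtain ⟨x, hx1, hx2, hx3⟩ := (hfr.and_eventually (hev.and hu)).exists
    exact huv (Set.mk_mem_prod hx3 hx1) (hg x hx2)

end Par


lemma lim_left_mono {g : ℝ → ℝ} {T B : ℝ} (hg : ∀ s t, s ≤ t → t ≤ T → g s ≤ g t)
    (hB : ∀ t ≤ T, B ≤ g t) : ∃ l, Tendsto g atBot (𝓝 l) ∧ ∀ t ≤ T, l ≤ g t := by
  have hmono : Monotone (fun t => g (min t T)) := fun s t hst =>
    hg _ _ (min_le_min_right _ hst) (min_le_right _ _)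
  have hb : BddBelow (range (fun t => g (min t T))) :=
    ⟨B, by rintro _ ⟨t, rfl⟩; exact hB _ (min_le_right _ _)⟩
  have h1 := tendsto_atBot_ciInf hmono hb
  refine ⟨_, h1.congr' ?_, fun t ht => ?_⟩
  · filter_upwards [eventually_le_atBot T] with t ht
    rw [min_eq_left ht]
  · have := ciInf_le hb t
    rwa [min_eq_left ht] at this

namespace BSol
variable {P : Par} {t1 : ℝ} {X A Z : ℝ → ℝ}

lemma Y_le (h : BSol P t1 X A Z) {t : ℝ} (ht : t ≤ t1) : A t / X t ≤ P.q := by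
  rw [div_le_iff₀ (h.pX t ht)]; exact h.Aq t ht

lemma Z_rate (h : BSol P t1 X A Z) {t : ℝ} (ht : t ≤ t1) :
    P.s' ≤ P.s - (1 - P.p) * A t / X t := by
  have h3 := mul_le_mul_of_nonneg_left (h.Y_le ht) (show 0 ≤ 1 - P.p by linarith [P.hp1])
  unfold Par.s'
  rw [mul_div_assoc]
  linarith

lemma Z_zero (h : BSol P t1 X A Z) : Tendsto Z atBot (𝓝 0) := by
  have key : ∀ t ≤ t1, Z t ≤ Z t1 * exp (-(P.s' * (t1 - t))) := by
    intro t ht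
    have := exp_ge (g := Z) (k := P.s') ht (fun s hs => h.dZ s hs.2) (fun s hs => by
      rw [mul_comm]
      exact mul_le_mul_of_nonneg_left (h.Z_rate hs.2) (h.pZ s hs.2).le)
    rw [exp_neg, ← div_eq_mul_inv, le_div_iff₀ (exp_pos _)]; exact this
  have hlim : Tendsto (fun t => Z t1 * exp (-(P.s' * (t1 - t)))) atBot (𝓝 0) := by
    rw [← mul_zero (Z t1)]
    refine Tendsto.const_mul _ (tendsto_exp_atBot.comp ?_)
    have : (fun t => -(P.s' * (t1 - t))) = fun t => P.s' * t + -(P.s' * t1) := by ext; ring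
    rw [this]
    exact tendsto_atBot_add_const_right _ _ (tendsto_id.const_mul_atBot P.s'_pos)
  refine tendsto_of_tendsto_of_tendsto_of_le_of_le' tendsto_const_nhds hlim ?_ ?_
  · filter_upwards [eventually_le_atBot t1] with t ht using (h.pZ t ht).le
  · filter_upwards [eventually_le_atBot t1] with t ht using key t ht

lemma restrict (h : BSol P t1 X A Z) {t0 : ℝ} (h0 : t0 ≤ t1) : BSol P t0 X A Z :=
  ⟨h.toSol.mono (Iic_subset_Iic.2 h0), fun t ht => h.A0 t (ht.trans h0),
    fun t ht => h.An t (ht.trans h0), fun t ht => h.Aq t (ht.trans h0)⟩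

lemma dU (h : BSol P t1 X A Z) {t : ℝ} (ht : t ≤ t1) :
    HasDerivAt (fun t => (P.m - 1) * A t - 2 * X t)
      ((P.m - 1) * (P.α - P.n * A t - A t * (A t + P.β) / X t - Z t) -
        2 * ((P.m - 1) * A t - 2 * X t)) t :=
  ((h.dA t ht).const_mul _).sub ((h.dX t ht).const_mul _)

lemma dV (h : BSol P t1 X A Z) {t : ℝ} (ht : t ≤ t1) :
    HasDerivAt (fun t => P.α - P.n * A t - A t * (A t + P.β) / X t - Z t)
      (- P.n * (P.α - P.n * A t - A t * (A t + P.β) / X t - Z t)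
       - (2 * A t + P.β) * (P.α - P.n * A t - A t * (A t + P.β) / X t - Z t) / X t
       + A t * (A t + P.β) * ((P.m - 1) * A t - 2 * X t) / X t ^ 2
       - Z t * (P.s - (1 - P.p) * A t / X t)) t := by
  have hX := h.pX t ht
  have hA := h.dA t ht
  refine ((((hA.const_mul P.n).const_sub P.α).sub
    ((hA.mul (hA.add_const P.β)).div (h.dX t ht) hX.ne')).sub (h.dZ t ht)).congr_deriv ?_
  simp only [Pi.mul_apply]
  field_simp
  ring

/-- never `X' ≤ 0` and `A' ≥ 0` -/
lemma claim1 (h : BSol P t1 X A Z) {s : ℝ} (hs : s ≤ t1)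
    (hU : (P.m - 1) * A s - 2 * X s ≤ 0) :
    P.α - P.n * A s - A s * (A s + P.β) / X s - Z s < 0 := by
  by_contra hV
  push Not at hV
  have hm := P.hm1
  have hβ := P.hβ
  have hn := P.n_pos
  have Ucl : ∀ t ≤ s, (∀ w ∈ Ioo t s, 0 < P.α - P.n * A w - A w * (A w + P.β) / X w - Z w) →
      (P.m - 1) * A t - 2 * X t ≤ 0 := by
    intro t ht hpos
    rcases ht.eq_or_lt with rfl | ht'
    · exact hU
    by_contra hc
    push Not at hc
    -- monotone on the open interval, by continuity
    have hd : ∀ w ∈ Icc t s, HasDerivAt (fun w => ((P.m - 1) * A w - 2 * X w) * exp (2 * w))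
        ((P.m - 1) * (P.α - P.n * A w - A w * (A w + P.β) / X w - Z w) * exp (2 * w)) w := by
      intro w hw
      have e : HasDerivAt (fun w : ℝ => exp (2 * w)) (exp (2 * w) * (2 * 1)) w :=
        ((hasDerivAt_id w).const_mul 2).exp
      exact ((h.dU (hw.2.trans hs)).mul e).congr_deriv (by ring)
    obtain ⟨w, hw, hw'⟩ := exists_hasDerivAt_eq_slope _ _ ht'
      (fun w hw => (hd w hw).continuousAt.continuousWithinAt)
      (fun w hw => hd w (Ioo_subset_Icc_self hw))
    have p1 : 0 < (P.m - 1) * (P.α - P.n * A w - A w * (A w + P.β) / X w - Z w) * exp (2 * w) :=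
      mul_pos (mul_pos hm (hpos w hw)) (exp_pos _)
    rw [hw'] at p1
    have p2 := (div_pos_iff_of_pos_right (show 0 < s - t by linarith)).1 p1
    have p3 : ((P.m - 1) * A s - 2 * X s) * exp (2 * s) ≤ 0 :=
      mul_nonpos_of_nonpos_of_nonneg hU (exp_pos _).le
    have p4 : 0 < ((P.m - 1) * A t - 2 * X t) * exp (2 * t) := mul_pos hc (exp_pos _)
    linarith
  have Vder : ∀ t ≤ t1, (P.m - 1) * A t - 2 * X t ≤ 0 →
      0 ≤ P.α - P.n * A t - A t * (A t + P.β) / X t - Z t →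
      (- P.n * (P.α - P.n * A t - A t * (A t + P.β) / X t - Z t)
       - (2 * A t + P.β) * (P.α - P.n * A t - A t * (A t + P.β) / X t - Z t) / X t
       + A t * (A t + P.β) * ((P.m - 1) * A t - 2 * X t) / X t ^ 2
       - Z t * (P.s - (1 - P.p) * A t / X t)) < 
       - P.n * (P.α - P.n * A t - A t * (A t + P.β) / X t - Z t) := by
    intro t ht hu hv
    have a0 := h.A0 t ht
    have x0 := h.pX t ht
    have z1 : 0 < Z t * (P.s - (1 - P.p) * A t / X t) :=
      mul_pos (h.pZ t ht) (P.s'_pos.trans_le (h.Z_rate ht))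
    have z2 : 0 ≤ (2 * A t + P.β) * (P.α - P.n * A t - A t * (A t + P.β) / X t - Z t) / X t := by
      apply div_nonneg (mul_nonneg (by linarith) hv) x0.le
    have z3 : A t * (A t + P.β) * ((P.m - 1) * A t - 2 * X t) / X t ^ 2 ≤ 0 :=
      div_nonpos_of_nonpos_of_nonneg (mul_nonpos_of_nonneg_of_nonpos (by positivity) hu) (by positivity)
    linarith
  have Vpos : ∀ t < s, 0 < P.α - P.n * A t - A t * (A t + P.β) / X t - Z t := by
    intro t ht
    refine barrier_back0 (a := t) (b := s) (fun w hw => h.dV (hw.2.trans hs)) hV ?_ t ⟨le_rfl, ht⟩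
    intro w hw hpos h0
    have := Vder w (hw.2.trans hs) (Ucl w hw.2 hpos) h0.ge
    rw [h0] at this ⊢
    linarith
  have Uneg : ∀ t ≤ s, (P.m - 1) * A t - 2 * X t ≤ 0 := fun t ht =>
    Ucl t ht (fun w hw => Vpos w hw.2)
  set s0 := s - 1
  have hs0 : s0 < s := by simp [s0]
  set k := P.α - P.n * A s0 - A s0 * (A s0 + P.β) / X s0 - Z s0
  have hk : 0 < k := Vpos s0 hs0
  have Vge : ∀ t ≤ s0, k ≤ P.α - P.n * A t - A t * (A t + P.β) / X t - Z t := by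
    intro t ht
    have := mvt_le (k := 0) ht (fun w hw => h.dV ((hw.2.trans hs0.le).trans hs)) (fun w hw => by
      have a1 : w < s := hw.2.trans_lt hs0
      have a2 := Vpos w a1
      have := Vder w (a1.le.trans hs) (Uneg w a1.le) a2.le
      have : 0 < P.n * (P.α - P.n * A w - A w * (A w + P.β) / X w - Z w) := mul_pos hn a2
      linarith)
    simp only [zero_mul] at this
    linarith
  have := left_bound (g := A) (B := 0) (c := A s0) (T := s0) hk
    (fun t ht => h.dA t ((ht.trans hs0.le).trans hs))
    (fun t ht => h.A0 t ((ht.trans hs0.le).trans hs)) (fun t ht _ => Vge t ht) s0 le_rfl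
  exact lt_irrefl _ this

lemma claim2 (h : BSol P t1 X A Z) {s t : ℝ} (hst : s ≤ t) (ht : t ≤ t1)
    (hU : (P.m - 1) * A s - 2 * X s ≤ 0) : (P.m - 1) * A t - 2 * X t ≤ 0 := by
  rcases hst.eq_or_lt with rfl | hst
  · exact hU
  have := barrier0 (g := fun t => - ((P.m - 1) * A t - 2 * X t)) (a := s) (b := t)
    (fun w hw => (h.dU (hw.2.trans ht)).neg) (by linarith) (fun w hw _ h0 => by
      have := h.claim1 (hw.2.trans ht) (by linarith)
      have h2 := mul_neg_of_pos_of_neg P.hm1 this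
      linarith) t ⟨hst, le_rfl⟩
  linarith

lemma lim_deriv_zero {g g' : ℝ → ℝ} {T l d : ℝ} (hg : ∀ t ≤ T, HasDerivAt g (g' t) t)
    (h1 : Tendsto g atBot (𝓝 l)) (h2 : Tendsto g' atBot (𝓝 d)) : d = 0 := by
  have aux : ∀ (g g' : ℝ → ℝ) (T l d : ℝ), (∀ t ≤ T, HasDerivAt g (g' t) t) →
      Tendsto g atBot (𝓝 l) → Tendsto g' atBot (𝓝 d) → d ≤ 0 := by
    intro g g' T l d hg h1 h2
    by_contra hc
    push Not at hc
    have e1 := h1.eventually (lt_mem_nhds (show l - 1 < l by linarith))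
    have e2 := h2.eventually (lt_mem_nhds (show d / 2 < d by linarith))
    obtain ⟨S, hS⟩ := eventually_atBot.1 ((e1.and e2).and (eventually_le_atBot T))
    have := left_bound (g := g) (B := l - 1) (c := g S) (T := S) (k := d/2) (by linarith)
      (fun t ht => hg t (hS t ht).2) (fun t ht => (hS t ht).1.1.le)
      (fun t ht _ => (hS t ht).1.2.le) S le_rfl
    exact lt_irrefl _ this
  refine le_antisymm (aux g g' T l d hg h1 h2) ?_
  have := aux (fun t => - g t) (fun t => - g' t) T (-l) (-d) (fun t ht => (hg t ht).neg) h1.neg h2.neg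
  linarith

/-- limit of `A` from the limit of `1/X` -/
lemma A_lim (h : BSol P t1 X A Z) {l a : ℝ} (hl : 0 ≤ l) (ha : 0 ≤ a)
    (hX : Tendsto (fun t => (X t)⁻¹) atBot (𝓝 l))
    (heq : P.α - P.n * a - a * (a + P.β) * l = 0) : Tendsto A atBot (𝓝 a) := by
  have hβ := P.hβ
  have hn := P.n_pos
  have hlim : ∀ c, Tendsto (fun t => P.α - P.n * c - c * (c + P.β) * (X t)⁻¹ - Z t) atBot
      (𝓝 (P.α - P.n * c - c * (c + P.β) * l - 0)) := fun c =>
    ((tendsto_const_nhds.sub (hX.const_mul _))).sub h.Z_zero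
  refine tendsto_order.2 ⟨fun c hc => ?_, fun c hc => ?_⟩
  · rcases lt_or_ge c 0 with h0 | h0
    · filter_upwards [eventually_le_atBot t1] with t ht
      linarith [h.A0 t ht]
    have hd : 0 < P.α - P.n * c - c * (c + P.β) * l - 0 := by
      have : c * (c + P.β) * l ≤ a * (a + P.β) * l := by gcongr
      nlinarith
    obtain ⟨S, hS⟩ := eventually_atBot.1 (((hlim c).eventually (lt_mem_nhds
      (half_lt_self hd))).and (eventually_le_atBot t1))
    have := left_bound (g := A) (B := 0) (c := c) (T := S) (half_pos hd)
      (fun t ht => h.dA t (hS t ht).2) (fun t ht => h.A0 t (hS t ht).2) (fun t ht hAc => by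
        have h1 := (hS t ht).1
        have a0 := h.A0 t (hS t ht).2
        have x0 := h.pX t (hS t ht).2
        have : A t * (A t + P.β) / X t ≤ c * (c + P.β) * (X t)⁻¹ := by
          rw [div_eq_mul_inv]; gcongr
        have : P.n * A t ≤ P.n * c := by gcongr
        linarith)
    filter_upwards [eventually_le_atBot S] with t ht using this t ht
  · have c0 : 0 < c := ha.trans_lt hc
    have hd : 0 < -(P.α - P.n * c - c * (c + P.β) * l - 0) := by
      have : a * (a + P.β) * l ≤ c * (c + P.β) * l := by gcongr
      nlinarith
    obtain ⟨S, hS⟩ := eventually_atBot.1 (((hlim c).neg.eventually (lt_mem_nhds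
      (half_lt_self hd))).and (eventually_le_atBot t1))
    have := left_bound (g := fun t => - A t) (B := - (P.α / P.n)) (c := -c) (T := S) (half_pos hd)
      (fun t ht => (h.dA t (hS t ht).2).neg) (fun t ht => neg_le_neg (h.An t (hS t ht).2))
      (fun t ht hAc => by
        have h1 := (hS t ht).1
        have hAc' : c ≤ A t := by linarith
        have hA0' : 0 ≤ A t := by linarith
        have x0 := h.pX t (hS t ht).2
        have : c * (c + P.β) * (X t)⁻¹ ≤ A t * (A t + P.β) / X t := by
          rw [div_eq_mul_inv]; gcongr
        have : P.n * c ≤ P.n * A t := by gcongr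
        linarith)
    filter_upwards [eventually_le_atBot S] with t ht
    linarith [this t ht]

lemma case_pos (h : BSol P t1 X A Z) {l : ℝ} (hl : 0 < l) (hX : Tendsto X atBot (𝓝 l)) :
    l = (P.m - 1) / (2 * (P.m * P.n - P.n + 2)) := by
  have hβ := P.hβ
  have hn := P.n_pos
  have hα := P.hα
  have hm := P.hm1
  -- zero of the quadratic
  have hcont : ContinuousOn (fun a => P.α - P.n * a - a * (a + P.β) * l⁻¹) (Icc 0 (P.α / P.n)) := by
    fun_prop
  have hαn : 0 ≤ P.α / P.n := by positivity
  obtain ⟨a, ha, ha0⟩ := intermediate_value_Icc' hαn hcont (show (0:ℝ) ∈ _ by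
    constructor
    · have : 0 ≤ P.α / P.n * (P.α / P.n + P.β) * l⁻¹ := by positivity
      have : P.n * (P.α / P.n) = P.α := by field_simp
      linarith
    · simp; exact hα.le)
  simp only at ha0
  have hA := h.A_lim (inv_nonneg.2 hl.le) ha.1 (hX.inv₀ hl.ne') ha0
  have hd := lim_deriv_zero (fun t ht => h.dX t ht) hX ((hA.const_mul (P.m - 1)).sub (hX.const_mul 2))
  have e1 : a = 2 * l / (P.m - 1) := by field_simp; linarith
  have hab := P.hab
  rw [e1] at ha0
  have h3 : P.m * P.n - P.n + 2 = P.n * (P.m - 1) + 2 := by ring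
  have h4 : 0 < P.n * (P.m - 1) + 2 := by positivity
  rw [h3, eq_div_iff (by positivity)]
  field_simp at ha0
  have e2 : (P.α * (P.m - 1) - 2 * P.β) * (P.m - 1) = l * (2 * (P.n * (P.m - 1) + 2)) := by
    linarith
  rw [hab] at e2
  linarith

lemma dv (h : BSol P t1 X A Z) {t : ℝ} (ht : t ≤ t1) :
    HasDerivAt (fun t => X t * exp (2 * t)) ((P.m - 1) * A t * exp (2 * t)) t := by
  have e : HasDerivAt (fun w : ℝ => exp (2 * w)) (exp (2 * t) * (2 * 1)) t :=
    ((hasDerivAt_id t).const_mul 2).exp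
  exact ((h.dX t ht).mul e).congr_deriv (by ring)

lemma case_top (h : BSol P t1 X A Z) (hX : Tendsto X atBot atTop) : ∃ v0, 0 < v0 ∧
    Tendsto (fun t => (X t * exp (2 * t) - v0) / exp (2 * t)) atBot
      (𝓝 ((P.m - 1) * (P.α / P.n) / 2)) := by
  have hn := P.n_pos
  have hα := P.hα
  have hA := h.A_lim le_rfl (div_pos hα hn).le hX.inv_tendsto_atTop (by field_simp; ring)
  obtain ⟨v0, hv, hv0⟩ := lim_left_mono (g := fun t => X t * exp (2 * t)) (T := t1) (B := 0)
    (fun s t hst ht => by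
      have := mvt_ge (k := 0) hst (fun w hw => h.dv (hw.2.trans ht)) (fun w hw =>
        mul_nonneg (mul_nonneg P.hm1.le (h.A0 w (hw.2.trans ht))) (exp_pos _).le)
      linarith) (fun t ht => (mul_pos (h.pX t ht) (exp_pos _)).le)
  have hexp : Tendsto (fun t : ℝ => exp (2 * t)) atBot (𝓝 0) :=
    tendsto_exp_atBot.comp (tendsto_id.const_mul_atBot two_pos)
  have hlim : Tendsto (fun t => (X t * exp (2 * t) - v0) / exp (2 * t)) atBot
      (𝓝 ((P.m - 1) * (P.α / P.n) / 2)) := by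
    refine HasDerivAt.lhopital_zero_atBot (f' := fun t => (P.m - 1) * A t * exp (2 * t))
      (g' := fun t => exp (2 * t) * (2 * 1)) ?_ ?_ ?_ ?_ hexp ?_
    · filter_upwards [eventually_le_atBot t1] with t ht using (h.dv ht).sub_const v0
    · exact Eventually.of_forall fun t => ((hasDerivAt_id t).const_mul 2).exp
    · exact Eventually.of_forall fun t => by positivity
    · have := hv.sub_const v0
      rwa [sub_self] at this
    · refine ((hA.const_mul (P.m - 1)).div_const 2).congr (fun t => ?_)
      have := exp_pos (2 * t)
      field_simp
  refine ⟨v0, ?_, hlim⟩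
  have hv00 : 0 ≤ v0 := ge_of_tendsto hv (by
    filter_upwards [eventually_le_atBot t1] with t ht using (mul_pos (h.pX t ht) (exp_pos _)).le)
  refine hv00.lt_of_ne' fun h0 => ?_
  have : Tendsto X atBot (𝓝 ((P.m - 1) * (P.α / P.n) / 2)) := by
    refine hlim.congr fun t => ?_
    rw [h0, sub_zero]; field_simp
  exact not_tendsto_nhds_of_tendsto_atTop hX _ this

lemma dY (h : BSol P t1 X A Z) {t : ℝ} (ht : t ≤ t1) :
    HasDerivAt (fun t => A t / X t) ((P.α - P.β * (A t / X t) - Z t -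
      X t * (P.m * (A t / X t) ^ 2 + (P.n - 2) * (A t / X t))) / X t) t := by
  have hX := h.pX t ht
  refine ((h.dA t ht).div (h.dX t ht) hX.ne').congr_deriv ?_
  field_simp
  ring

lemma case_zero (h : BSol P t1 X A Z) (hX : Tendsto X atBot (𝓝 0)) : ∃ K, 0 < K ∧
    Tendsto (fun t => X t * exp (2 * t) * exp (-((P.m - 1) * P.q * t))) atBot (𝓝 K) := by
  have hβ := P.hβ
  have hn := P.n_pos
  have hm := P.hm1
  have hq := P.q_pos
  have hs' := P.s'_pos
  have Y0 : ∀ t ≤ t1, 0 ≤ A t / X t := fun t ht => div_nonneg (h.A0 t ht) (h.pX t ht).le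
  -- Y tends to q from below
  have Ylow : ∀ c < P.q, ∀ᶠ t in atBot, c < A t / X t := by
    intro c hc
    have hd : 0 < P.α - P.β * c := by
      have := P.q_mul
      nlinarith
    set C := P.m * P.q ^ 2 + P.n * P.q
    have hl : Tendsto (fun t => P.α - P.β * c - Z t - X t * C) atBot
        (𝓝 (P.α - P.β * c - 0 - 0 * C)) := (tendsto_const_nhds.sub h.Z_zero).sub (hX.mul_const C)
    obtain ⟨S, hS⟩ := eventually_atBot.1 (((hl.eventually (lt_mem_nhds (show
      (P.α - P.β * c) / 2 < P.α - P.β * c - 0 - 0 * C by linarith))).and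
      (hX.eventually (gt_mem_nhds one_pos))).and (eventually_le_atBot t1))
    have := left_bound (g := fun t => A t / X t) (B := 0) (c := c) (T := S) (half_pos hd)
      (fun t ht => h.dY (hS t ht).2) (fun t ht => Y0 t (hS t ht).2) (fun t ht hAc => by
        obtain ⟨⟨h1, h2⟩, h3⟩ := hS t ht
        have x0 := h.pX t h3
        have y0 := Y0 t h3
        have y1 := h.Y_le h3
        rw [le_div_iff₀ x0]
        have b1 : P.m * (A t / X t) ^ 2 + (P.n - 2) * (A t / X t) ≤ C := by
          have : P.m * (A t / X t) ^ 2 ≤ P.m * P.q ^ 2 := by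
            have := P.hm
            gcongr
          have : P.n * (A t / X t) ≤ P.n * P.q := by gcongr
          simp only [C]
          linarith
        have b2 := mul_le_mul_of_nonneg_left b1 x0.le
        have b3 : P.β * (A t / X t) ≤ P.β * c := by gcongr
        have b4 : (P.α - P.β * c) / 2 * X t ≤ (P.α - P.β * c) / 2 * 1 := by gcongr
        linarith)
    filter_upwards [eventually_le_atBot S] with t ht using this t ht
  have hrate : ∀ᶠ t in atBot, P.s' / 2 < (P.m - 1) * (A t / X t) - 2 := by
    have hc : (P.s' / 2 + 2) / (P.m - 1) < P.q := by
      rw [div_lt_iff₀ hm]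
      have := P.s'_eq
      linarith
    filter_upwards [Ylow _ hc] with t ht
    rw [div_lt_iff₀ hm] at ht
    linarith
  obtain ⟨S, hS⟩ := eventually_atBot.1 (hrate.and (eventually_le_atBot t1))
  have hSt : S ≤ t1 := (hS S le_rfl).2
  -- the corrected logarithm
  set R : ℝ → ℝ := fun t => log (X t) + (2 - (P.m - 1) * P.q) * t + (P.m - 1) / P.β * A t with hR
  have dR : ∀ t ≤ t1, HasDerivAt R (-((P.m - 1) / P.β * (Z t + A t * (P.n + A t / X t)))) t := by
    intro t ht
    have x0 := h.pX t ht
    refine ((((h.dX t ht).log x0.ne').add ((hasDerivAt_id t).const_mul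
      (2 - (P.m - 1) * P.q))).add ((h.dA t ht).const_mul ((P.m - 1) / P.β))).congr_deriv ?_
    rw [← P.q_mul]
    field_simp
    ring
  set C := P.q * (P.n + P.q) with hC
  have hCpos : 0 < C := by positivity
  obtain ⟨l, hl, -⟩ := lim_left_mono (g := fun t => - R t) (T := S)
    (B := - (R S + (P.m - 1) / P.β * (Z S / P.s' + 2 * C / P.s' * X S))) (fun s t hst ht => by
      have := mvt_le (k := 0) hst (fun w hw => dR w ((hw.2.trans ht).trans hSt)) (fun w hw => by
        have hw1 := (hw.2.trans ht).trans hSt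
        have := h.pZ w hw1
        have := h.A0 w hw1
        have := Y0 w hw1
        have : 0 ≤ (P.m - 1) / P.β * (Z w + A w * (P.n + A w / X w)) := by positivity
        linarith)
      linarith) (fun t ht => by
      have := mvt_ge (g := fun w => R w + (P.m - 1) / P.β * (Z w / P.s' + 2 * C / P.s' * X w))
        (k := 0) ht (fun w hw => (dR w (hw.2.trans hSt)).add
          ((((h.dZ w (hw.2.trans hSt)).div_const P.s').add
            ((h.dX w (hw.2.trans hSt)).const_mul (2 * C / P.s'))).const_mul ((P.m - 1) / P.β)))
        (fun w hw => by
          have hw1 := hw.2.trans hSt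
          have x0 := h.pX w hw1
          have z0 := h.pZ w hw1
          have b1 := h.Z_rate hw1
          have b2 := (hS w hw.2).1.le
          have b3 : A w * (P.n + A w / X w) ≤ X w * C := by
            have e : A w = (A w / X w) * X w := by field_simp
            have y0 := Y0 w hw1
            have y1 := h.Y_le hw1
            have : (A w / X w) * (P.n + A w / X w) ≤ C := by simp only [hC]; gcongr
            calc A w * (P.n + A w / X w) = X w * ((A w / X w) * (P.n + A w / X w)) := by
                  field_simp
              _ ≤ X w * C := by gcongr
          have b4 : Z w ≤ Z w * (P.s - (1 - P.p) * A w / X w) / P.s' := by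
            rw [le_div_iff₀ hs']; gcongr
          have b5 : X w * C ≤ 2 * C / P.s' * ((P.m - 1) * A w - 2 * X w) := by
            have e : (P.m - 1) * A w - 2 * X w = X w * ((P.m - 1) * (A w / X w) - 2) := by field_simp
            rw [e]
            calc X w * C = 2 * C / P.s' * (X w * (P.s' / 2)) := by field_simp
              _ ≤ _ := by gcongr
          have b6 : 0 ≤ (P.m - 1) / P.β := by positivity
          have := mul_le_mul_of_nonneg_left (show Z w + A w * (P.n + A w / X w) ≤
            Z w * (P.s - (1 - P.p) * A w / X w) / P.s' +
            2 * C / P.s' * ((P.m - 1) * A w - 2 * X w) by linarith) b6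
          linarith)
      simp only [zero_mul] at this
      have x0 := h.pX t (ht.trans hSt)
      have z0 := h.pZ t (ht.trans hSt)
      have : 0 ≤ (P.m - 1) / P.β * (Z t / P.s' + 2 * C / P.s' * X t) := by positivity
      linarith)
  have hAz : Tendsto A atBot (𝓝 0) := by
    refine tendsto_of_tendsto_of_tendsto_of_le_of_le' tendsto_const_nhds
      (by simpa using hX.const_mul P.q : Tendsto (fun t => P.q * X t) atBot (𝓝 0)) ?_ ?_
    · filter_upwards [eventually_le_atBot t1] with t ht using h.A0 t ht
    · filter_upwards [eventually_le_atBot t1] with t ht using h.Aq t ht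
  have hfin : Tendsto (fun t => R t - (P.m - 1) / P.β * A t) atBot (𝓝 (-l - (P.m - 1) / P.β * 0)) := by
    have := hl.neg
    simp only [neg_neg] at this
    exact this.sub (hAz.const_mul _)
  refine ⟨exp (-l - (P.m - 1) / P.β * 0), exp_pos _, ((continuous_exp.tendsto _).comp hfin).congr' ?_⟩
  filter_upwards [eventually_le_atBot t1] with t ht
  have x0 := h.pX t ht
  simp only [Function.comp, hR]
  rw [show log (X t) + (2 - (P.m - 1) * P.q) * t + (P.m - 1) / P.β * A t - (P.m - 1) / P.β * A t =
    log (X t) + 2 * t + -((P.m - 1) * P.q * t) by ring, exp_add, exp_add, exp_log x0]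

/-- Classification at `-∞`. -/
lemma classify (h : BSol P t1 X A Z) :
    (∃ v0, 0 < v0 ∧ Tendsto (fun t => (X t * exp (2 * t) - v0) / exp (2 * t)) atBot
      (𝓝 ((P.m - 1) * (P.α / P.n) / 2))) ∨
    Tendsto X atBot (𝓝 ((P.m - 1) / (2 * (P.m * P.n - P.n + 2)))) ∨
    (∃ K, 0 < K ∧
      Tendsto (fun t => X t * exp (2 * t) * exp (-((P.m - 1) * P.q * t))) atBot (𝓝 K)) := by
  have fin : ∀ l, 0 ≤ l → Tendsto X atBot (𝓝 l) →
      Tendsto X atBot (𝓝 ((P.m - 1) / (2 * (P.m * P.n - P.n + 2)))) ∨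
      (∃ K, 0 < K ∧
      Tendsto (fun t => X t * exp (2 * t) * exp (-((P.m - 1) * P.q * t))) atBot (𝓝 K)) := by
    intro l hl hX
    rcases hl.eq_or_lt with rfl | hl
    · exact Or.inr (h.case_zero hX)
    · left
      rw [← h.case_pos hl hX]; exact hX
  by_cases ha : ∃ t0 ≤ t1, ∀ t ≤ t0, 0 < (P.m - 1) * A t - 2 * X t
  · right
    obtain ⟨t0, ht0, hU⟩ := ha
    obtain ⟨l, hl, -⟩ := lim_left_mono (g := X) (T := t0) (B := 0) (fun s t hst ht => by
      have := mvt_ge (k := 0) hst (fun w hw => h.dX w ((hw.2.trans ht).trans ht0))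
        (fun w hw => (hU w (hw.2.trans ht)).le)
      linarith) (fun t ht => (h.pX t (ht.trans ht0)).le)
    refine fin l (ge_of_tendsto hl ?_) hl
    filter_upwards [eventually_le_atBot t1] with t ht using (h.pX t ht).le
  · push Not at ha
    have hU : ∀ t ≤ t1, (P.m - 1) * A t - 2 * X t ≤ 0 := by
      intro t ht
      obtain ⟨s, hs, hs'⟩ := ha t ht
      exact h.claim2 hs ht hs'
    have anti : ∀ s t, s ≤ t → t ≤ t1 → X t ≤ X s := by
      intro s t hst ht
      have := mvt_le (k := 0) hst (fun w hw => h.dX w (hw.2.trans ht))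
        (fun w hw => hU w (hw.2.trans ht))
      linarith
    by_cases hb : ∃ M, ∀ t ≤ t1, X t ≤ M
    · right
      obtain ⟨M, hM⟩ := hb
      obtain ⟨l, hl, -⟩ := lim_left_mono (g := fun t => - X t) (T := t1) (B := -M)
        (fun s t hst ht => neg_le_neg (anti s t hst ht)) (fun t ht => neg_le_neg (hM t ht))
      have hl' : Tendsto X atBot (𝓝 (-l)) := by simpa using hl.neg
      refine fin (-l) (ge_of_tendsto hl' ?_) hl'
      filter_upwards [eventually_le_atBot t1] with t ht using (h.pX t ht).le
    · left
      push Not at hb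
      refine h.case_top (tendsto_atTop.2 fun M => ?_)
      obtain ⟨t, ht, hMt⟩ := hb M
      filter_upwards [eventually_le_atBot t] with s hs
      exact hMt.le.trans (anti s t hs ht)

end BSol


namespace Par
variable (P : Par)
noncomputable def κ : ℝ := 1 / (2 * (P.β + P.n + P.s))
lemma κ_pos : 0 < P.κ := by
  have := P.hβ; have := P.n_pos; have := P.hs
  unfold κ; positivity
lemma κ_mul : P.κ * (P.β + P.n + P.s) = 1 / 2 := by
  have := P.hβ; have := P.n_pos; have := P.hs
  unfold κ; field_simp
noncomputable def Λ : ℝ := 2 * P.α + 2 + P.s / (P.κ * (P.m + P.p - 2))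
lemma Λ_gt : 2 * P.α + 2 < P.Λ := by
  have := P.κ_pos; have := P.hs; have : 0 < P.m + P.p - 2 := by linarith [P.hmp]
  have : 0 < P.s / (P.κ * (P.m + P.p - 2)) := by positivity
  unfold Λ; linarith
lemma Λ_s : P.s ≤ P.κ * P.Λ * (P.m + P.p - 2) := by
  have h1 := P.κ_pos; have h2 := P.hs; have h3 : 0 < P.m + P.p - 2 := by linarith [P.hmp]
  have h4 := P.hα
  have : P.κ * P.Λ * (P.m + P.p - 2) = P.κ * (2 * P.α + 2) * (P.m + P.p - 2) + P.s := by
    unfold Λ; field_simp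
  rw [this]
  have : 0 < P.κ * (2 * P.α + 2) * (P.m + P.p - 2) := by positivity
  linarith

/-- The trapping region leading to Type II interfaces. -/
def U (X A Z : ℝ) : Prop := ∃ θ, 0 < θ ∧ θ < 1 ∧ X < 1 ∧ P.Λ < Z ∧ P.κ * X * Z < - A ∧ - A < θ * P.β ∧
  X * Z < θ * (1 - θ) * P.β ^ 2
end Par

namespace Sol
variable {P : Par} {I : Set ℝ} {X A Z : ℝ → ℝ}

lemma strip {a b : ℝ} (h : Sol P (Icc a b) X A Z) (h1 : A a ≤ P.α / P.n) (h2 : A a ≤ P.q * X a) :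
    ∀ t ∈ Icc a b, A t ≤ P.α / P.n ∧ A t ≤ P.q * X t := by
  have hn := P.n_pos
  have hα := P.hα
  have hβ := P.hβ
  have hq := P.q_pos
  have e1 := barrier0 (g := fun t => P.α / P.n - A t)
    (g' := fun t => - (P.α - P.n * A t - A t * (A t + P.β) / X t - Z t)) (a := a) (b := b)
    (fun t ht => ((h.dA t ht).const_sub _)) (by simpa using h1) (fun t ht _ h0 => by
      have hX := h.pX t ht
      have hZ := h.pZ t ht
      have hA : A t = P.α / P.n := by linarith
      have : 0 < A t := by rw [hA]; positivity
      have h3 : 0 < A t * (A t + P.β) / X t := by positivity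
      have h4 : P.n * A t = P.α := by rw [hA]; field_simp
      linarith)
  have e2 := barrier0 (g := fun t => P.q * X t - A t)
    (g' := fun t => P.q * ((P.m - 1) * A t - 2 * X t) - (P.α - P.n * A t - A t * (A t + P.β) / X t - Z t))
    (a := a) (b := b)
    (fun t ht => ((h.dX t ht).const_mul _).sub (h.dA t ht)) (by simpa using h2) (fun t ht _ h0 => by
      have hX := h.pX t ht
      have hZ := h.pZ t ht
      have hA : A t = P.q * X t := by linarith
      have h3 : A t * (A t + P.β) / X t = P.q * (A t + P.β) := by rw [hA]; field_simp
      have h5 := P.q_mul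
      rw [h3, hA]
      have h6 := P.q_m
      have h7 : 0 < P.q * X t := by positivity
      have h8 := P.hn
      nlinarith)
  intro t ht
  rcases ht.1.eq_or_lt with rfl | hlt
  · exact ⟨h1, h2⟩
  · have := e1 t ⟨hlt, ht.2⟩
    have := e2 t ⟨hlt, ht.2⟩
    constructor <;> linarith

lemma cX (h : Sol P I X A Z) {J : Set ℝ} (hJ : J ⊆ I) : ContinuousOn X J :=
  fun t ht => (h.dX t (hJ ht)).continuousAt.continuousWithinAt
lemma cA (h : Sol P I X A Z) {J : Set ℝ} (hJ : J ⊆ I) : ContinuousOn A J :=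
  fun t ht => (h.dA t (hJ ht)).continuousAt.continuousWithinAt
lemma cZ (h : Sol P I X A Z) {J : Set ℝ} (hJ : J ⊆ I) : ContinuousOn Z J :=
  fun t ht => (h.dZ t (hJ ht)).continuousAt.continuousWithinAt

lemma dXZ (h : Sol P I X A Z) {t : ℝ} (ht : t ∈ I) :
    HasDerivAt (fun t => X t * Z t) (X t * Z t * ((P.m + P.p - 2) * (A t / X t) + P.s - 2)) t := by
  have hX := h.pX t ht
  exact ((h.dX t ht).mul (h.dZ t ht)).congr_deriv (by field_simp; ring)

/-- derivative of `G = H - κ X Z` -/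
lemma dG (h : Sol P I X A Z) {t : ℝ} (ht : t ∈ I) :
    HasDerivAt (fun t => - A t - P.κ * (X t * Z t))
    (-(P.α - P.n * A t - A t * (A t + P.β) / X t - Z t) -
      P.κ * (X t * Z t * ((P.m + P.p - 2) * (A t / X t) + P.s - 2))) t :=
  (h.dA t ht).neg.sub ((h.dXZ ht).const_mul _)

/-- as long as `0 ≤ H ≤ κ X Z`, `H` increases -/
lemma H_incr {x a z : ℝ} (hx : 0 < x) (hx1 : x ≤ 1) (hz : 0 < z) (h0 : a ≤ 0) (h1 : - a ≤ P.κ * (x * z)) :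
    z / 2 + P.κ * P.s * z - P.α ≤ -(P.α - P.n * a - a * (a + P.β) / x - z) := by
  have hκ := P.κ_pos
  have hκm := P.κ_mul
  have hβ := P.hβ
  have hn := P.n_pos
  have e : a * (a + P.β) / x = a ^ 2 / x - (-a / x) * P.β := by field_simp; ring
  have e1 : 0 ≤ a ^ 2 / x := by positivity
  have e2 : -a / x ≤ P.κ * z := by rw [div_le_iff₀ hx]; linarith
  have e3 : (-a / x) * P.β ≤ P.κ * z * P.β := mul_le_mul_of_nonneg_right e2 hβ.le
  have e4 : P.n * (-a) ≤ P.n * (P.κ * z) := by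
    refine mul_le_mul_of_nonneg_left (h1.trans ?_) hn.le
    have : x * z ≤ 1 * z := mul_le_mul_of_nonneg_right hx1 hz.le
    nlinarith
  have e5 : P.κ * (P.β + P.n + P.s) * z = 1 / 2 * z := by rw [hκm]
  rw [e]; nlinarith

lemma G_pos {x a z : ℝ} (hx : 0 < x) (hx1 : x ≤ 1) (hz : P.Λ ≤ z) (h1 : - a = P.κ * (x * z)) :
    0 < -(P.α - P.n * a - a * (a + P.β) / x - z) -
      P.κ * (x * z * ((P.m + P.p - 2) * (a / x) + P.s - 2)) := by
  have hα := P.hα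
  have hΛ := P.Λ_gt
  have hz0 : 0 < z := by linarith
  have hκ := P.κ_pos
  have ha : a ≤ 0 := by have : 0 < P.κ * (x * z) := by positivity
                        linarith
  have := H_incr (P := P) hx hx1 hz0 ha h1.le
  have h2 : x * z * ((P.m + P.p - 2) * (a / x) + P.s - 2) ≤ z * P.s := by
    have h3 : (P.m + P.p - 2) * (a / x) ≤ 0 :=
      mul_nonpos_of_nonneg_of_nonpos (by linarith [P.hmp]) (div_nonpos_of_nonpos_of_nonneg ha hx.le)
    have h4 : x * z ≤ 1 * z := mul_le_mul_of_nonneg_right hx1 hz0.le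
    have h5 : 0 < x * z := by positivity
    have h6 := P.hs
    nlinarith
  have h3 := mul_le_mul_of_nonneg_left h2 hκ.le
  nlinarith

lemma U_inv {a b : ℝ} (h : Sol P (Icc a b) X A Z) {θ : ℝ} (hθ : 0 < θ) (hθ1 : θ < 1)
    (h1 : X a < 1) (h2 : P.Λ < Z a) (h3 : P.κ * X a * Z a < - A a) (h4 : - A a < θ * P.β)
    (h5 : X a * Z a < θ * (1 - θ) * P.β ^ 2) :
    ∀ t ∈ Icc a b, X t < 1 ∧ P.Λ < Z t ∧ P.κ * X t * Z t < - A t ∧ - A t < θ * P.β ∧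
      X t * Z t < θ * (1 - θ) * P.β ^ 2 := by
  have hκ := P.κ_pos
  have hΛ := P.Λ_gt
  have hα := P.hα
  have hm1 := P.hm1
  have hmp : 0 < P.m + P.p - 2 := by linarith [P.hmp]
  have hΛs := P.Λ_s
  have hs := P.hs
  -- consequences of G ≥ 0
  have key : ∀ t ∈ Icc a b, (∀ u ∈ Icc a t, P.κ * (X u * Z u) ≤ - A u) →
      X t < 1 ∧ P.Λ < Z t ∧ X t * Z t < θ * (1 - θ) * P.β ^ 2 := by
    intro t ht hu
    have hsub : Icc a t ⊆ Icc a b := Icc_subset_Icc_right ht.2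
    have hneg : ∀ u ∈ Icc a t, A u < 0 := fun u hu' => by
      have := h.pX u (hsub hu'); have := h.pZ u (hsub hu')
      have : 0 < P.κ * (X u * Z u) := by positivity
      linarith [hu u hu']
    have e1 := mvt_le (k := 0) ht.1 (fun u hu' => h.dX u (hsub hu')) (fun u hu' => by
      have := h.pX u (hsub hu')
      nlinarith [hneg u hu'])
    have e2 : ∀ u ∈ Icc a t, 0 * (u - a) ≤ Z u - Z a := fun u hu' =>
      mvt_ge (k := 0) hu'.1 (fun w hw => h.dZ w (hsub ⟨hw.1, hw.2.trans hu'.2⟩)) (fun w hw => by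
      have hw' : w ∈ Icc a t := ⟨hw.1, hw.2.trans hu'.2⟩
      have hx := h.pX w (hsub hw'); have hz := h.pZ w (hsub hw')
      have : (1 - P.p) * A w / X w ≤ 0 := div_nonpos_of_nonpos_of_nonneg
        (mul_nonpos_of_nonneg_of_nonpos (by linarith [P.hp1]) (hneg w hw').le) hx.le
      apply mul_nonneg hz.le; linarith)
    have e3 := mvt_le (k := 0) ht.1 (fun u hu' => h.dXZ (hsub hu')) (fun u hu' => by
      have hx := h.pX u (hsub hu'); have hz := h.pZ u (hsub hu')
      have f1 : A u / X u ≤ - (P.κ * Z u) := by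
        rw [div_le_iff₀ hx]; nlinarith [hu u hu']
      have f2 : P.Λ ≤ Z u := by linarith [e2 u hu']
      have f3 : P.κ * P.Λ ≤ P.κ * Z u := mul_le_mul_of_nonneg_left f2 hκ.le
      have f4 : (P.m + P.p - 2) * (A u / X u) ≤ (P.m + P.p - 2) * (-(P.κ * P.Λ)) :=
        mul_le_mul_of_nonneg_left (by linarith) hmp.le
      exact mul_nonpos_of_nonneg_of_nonpos (by positivity) (by nlinarith))
    have e2' := e2 t ⟨ht.1, le_rfl⟩
    refine ⟨by linarith, by linarith, by linarith⟩
  have main := barrier_cont (g := fun t => min (- A t - P.κ * (X t * Z t)) (θ * P.β + A t)) (a := a) (b := b)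
    (by
      have := h.cX subset_rfl; have := h.cA subset_rfl; have := h.cZ subset_rfl
      fun_prop)
    (lt_min (by nlinarith) (by linarith)) (fun t ht hpos h0 => by
      have hti : t ∈ Icc a b := Ioc_subset_Icc_self ht
      have hx := h.pX t hti
      have hz := h.pZ t hti
      have hG0 : 0 ≤ - A t - P.κ * (X t * Z t) := by rw [← h0]; exact min_le_left _ _
      have hk := key t hti (fun u hu => by
        rcases hu.2.eq_or_lt with rfl | hlt
        · linarith
        · have := (lt_min_iff.mp (hpos u ⟨hu.1, hlt⟩)).1
          linarith)
      rcases min_choice (- A t - P.κ * (X t * Z t)) (θ * P.β + A t) with hc | hc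
      · rw [hc] at h0
        have := deriv_nonpos_of_left ht.1 (h.dG hti) (fun u hu => (lt_min_iff.mp (hpos u hu)).1.le) h0.le
        have := G_pos (P := P) hx hk.1.le hk.2.1.le (a := A t) (by linarith)
        linarith
      · rw [hc] at h0
        have := deriv_nonpos_of_left ht.1 ((h.dA t hti).const_add (θ * P.β))
          (fun u hu => (lt_min_iff.mp (hpos u hu)).2.le) h0.le
        have hA : A t = - (θ * P.β) := by linarith
        have e : A t * (A t + P.β) / X t = - (θ * (1 - θ) * P.β ^ 2) / X t := by rw [hA]; ring
        have e1 : θ * (1 - θ) * P.β ^ 2 / X t > Z t := by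
          rw [gt_iff_lt, lt_div_iff₀ hx]; linarith [hk.2.2]
        rw [e, neg_div] at this
        have : 0 < P.n * (θ * P.β) := by have := P.n_pos; have := P.hβ; positivity
        have : P.n * A t = - (P.n * (θ * P.β)) := by rw [hA]; ring
        linarith)
  intro t ht
  have hk := key t ht (fun u hu => by
    have := (lt_min_iff.mp (main u ⟨hu.1, hu.2.trans ht.2⟩)).1
    linarith)
  have := lt_min_iff.mp (main t ht)
  exact ⟨hk.1, hk.2.1, by linarith [this.1], by linarith [this.2], hk.2.2⟩

end Sol


namespace Sol
variable {P : Par} {I : Set ℝ} {X A Z : ℝ → ℝ}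

lemma A_neg_persist {a b : ℝ} (h : Sol P (Icc a b) X A Z) (h0 : A a < 0) (hZ : ∀ t ∈ Icc a b, P.Λ ≤ Z t) :
    ∀ t ∈ Icc a b, A t < 0 := by
  have := barrier (g := fun t => - A t) (fun t ht => (h.dA t ht).neg) (by simpa using h0) (fun t ht _ h1 => by
    have hA : A t = 0 := by linarith
    have := hZ t (Ioc_subset_Icc_self ht)
    have := P.Λ_gt
    have := P.hα
    rw [hA]; simp only [mul_zero, zero_mul, zero_div]; linarith)
  intro t ht
  linarith [this t ht]

lemma G_persist {a b : ℝ} (h : Sol P (Icc a b) X A Z) (h0 : P.κ * (X a * Z a) < - A a)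
    (hX : ∀ t ∈ Icc a b, X t ≤ 1) (hZ : ∀ t ∈ Icc a b, P.Λ ≤ Z t) :
    ∀ t ∈ Icc a b, P.κ * (X t * Z t) < - A t := by
  have := barrier (fun t ht => h.dG ht) (by linarith) (fun t ht _ h1 => by
    have ht' := Ioc_subset_Icc_self ht
    exact G_pos (h.pX t ht') (hX t ht') (hZ t ht') (by linarith))
  intro t ht
  linarith [this t ht]

lemma Icc_sub_Ici {a s t : ℝ} (h : a ≤ s) : Icc s t ⊆ Ici a := fun _ hu => h.trans hu.1

lemma Z_rate' {x a z : ℝ} (hx : 0 < x) (hz : 0 < z) (h : a ≤ P.q * x) :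
    P.s' * z ≤ z * (P.s - (1 - P.p) * a / x) := by
  have h1 : a / x ≤ P.q := by rw [div_le_iff₀ hx]; exact h
  have h2 : (1 - P.p) * a / x = (1 - P.p) * (a / x) := by ring
  have h3 := mul_le_mul_of_nonneg_left h1 (by linarith [P.hp1] : 0 ≤ 1 - P.p)
  unfold Par.s'
  rw [h2]
  nlinarith

lemma no_forever {a : ℝ} (h : Sol P (Ici a) X A Z) (h1 : A a ≤ P.α / P.n) (h2 : A a ≤ P.q * X a)
    (hβ : ∀ t ≥ a, - P.β ≤ A t) : False := by
  have hs' := P.s'_pos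
  have hΛ := P.Λ_gt
  have hα := P.hα
  have hn := P.n_pos
  have hβ0 := P.hβ
  have hst : ∀ t ≥ a, A t ≤ P.α / P.n ∧ A t ≤ P.q * X t := fun t ht =>
    (h.mono (Icc_sub_Ici le_rfl)).strip h1 h2 t ⟨ht, le_rfl⟩
  obtain ⟨t2, ht2, hZ2⟩ : ∃ t2 ≥ a, ∀ t ≥ t2, P.Λ ≤ Z t := by
    have e : ∀ t ≥ a, Z a * exp (P.s' * (t - a)) ≤ Z t := fun t ht =>
      exp_ge ht (fun u hu => h.dZ u hu.1) (fun u hu => Z_rate' (h.pX u hu.1) (h.pZ u hu.1) (hst u hu.1).2)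
    have hza := h.pZ a self_mem_Ici
    have lim : Tendsto (fun t => Z a * exp (P.s' * (t - a))) atTop atTop := by
      refine Tendsto.const_mul_atTop hza (tendsto_exp_atTop.comp ?_)
      exact Tendsto.const_mul_atTop hs' (tendsto_atTop_add_const_right _ _ tendsto_id)
    obtain ⟨t2, ht2⟩ := eventually_atTop.1 (lim.eventually_ge_atTop P.Λ)
    refine ⟨max a t2, le_max_left _ _, fun t ht => ?_⟩
    exact (ht2 t (le_trans (le_max_right _ _) ht)).trans (e t (le_trans (le_max_left _ _) ht))
  obtain ⟨t3, ht3, hA3⟩ : ∃ t3 ≥ t2, A t3 < 0 := by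
    by_contra hcon
    push Not at hcon
    have hk := hcon t2 le_rfl
    have e := mvt_le (k := -1) (a := t2) (b := t2 + (A t2 + 1)) (by linarith)
      (fun u hu => h.dA u (ht2.trans hu.1)) (fun u hu => by
        have e1 := hcon u hu.1
        have e2 := hZ2 u hu.1
        have hx := h.pX u (ht2.trans hu.1)
        have e3 : 0 ≤ A u * (A u + P.β) / X u := by positivity
        have e4 : 0 ≤ P.n * A u := by positivity
        linarith)
    have := hcon (t2 + (A t2 + 1)) (by linarith)
    linarith
  have ht3' : a ≤ t3 := ht2.trans ht3
  have hA : ∀ t ≥ t3, A t < 0 := fun t ht =>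
    (h.mono (Icc_sub_Ici ht3')).A_neg_persist hA3 (fun u hu => hZ2 u (ht3.trans hu.1)) t ⟨ht, le_rfl⟩
  obtain ⟨t4, ht4, hX4⟩ : ∃ t4 ≥ t3, ∀ t ≥ t4, X t ≤ 1 := by
    have e : ∀ t ≥ t3, X t ≤ X t3 * exp ((-2) * (t - t3)) := fun t ht =>
      exp_le' ht (fun u hu => h.dX u (ht3'.trans hu.1)) (fun u hu => by
        have := hA u hu.1
        have := P.hm1
        nlinarith)
    have lim : Tendsto (fun t => X t3 * exp ((-2) * (t - t3))) atTop (𝓝 (X t3 * 0)) := by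
      refine Tendsto.const_mul _ (tendsto_exp_atBot.comp ?_)
      exact Tendsto.const_mul_atTop_of_neg (by norm_num) (tendsto_atTop_add_const_right _ _ tendsto_id)
    rw [mul_zero] at lim
    obtain ⟨t4, ht4⟩ := eventually_atTop.1 (lim.eventually (gt_mem_nhds zero_lt_one))
    refine ⟨max t3 t4, le_max_left _ _, fun t ht => ?_⟩
    exact (e t (le_trans (le_max_left _ _) ht)).trans (ht4 t (le_trans (le_max_right _ _) ht)).le
  have ht4' : a ≤ t4 := ht3'.trans ht4
  have hκ := P.κ_pos
  have hs := P.hs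
  obtain ⟨t5, ht5, hG5⟩ : ∃ t5 ≥ t4, P.κ * (X t5 * Z t5) < - A t5 := by
    by_contra hcon
    push Not at hcon
    have e := mvt_ge (k := 1) (a := t4) (b := t4 + (P.β + 1)) (by linarith)
      (fun u hu => (h.dA u (ht4'.trans hu.1)).neg) (fun u hu => by
        have hz := h.pZ u (ht4'.trans hu.1)
        have e1 := H_incr (P := P) (h.pX u (ht4'.trans hu.1)) (hX4 u hu.1) hz
          (hA u (ht4.trans hu.1)).le (hcon u hu.1)
        have e2 := hZ2 u (ht3.trans (ht4.trans hu.1))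
        have : 0 < P.κ * P.s * Z u := by positivity
        linarith)
    have := hβ (t4 + (P.β + 1)) (by linarith)
    have := hA t4 ht4
    simp only [Pi.neg_apply] at e
    linarith
  have ht5' : a ≤ t5 := ht4'.trans ht5
  have hG : ∀ t ≥ t5, P.κ * (X t * Z t) < - A t := fun t ht =>
    (h.mono (Icc_sub_Ici ht5')).G_persist hG5 (fun u hu => hX4 u (ht5.trans hu.1))
      (fun u hu => hZ2 u (ht3.trans (ht4.trans (ht5.trans hu.1)))) t ⟨ht, le_rfl⟩
  have hp : 0 < 1 - P.p := by linarith [P.hp1]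
  have hk : 0 < (1 - P.p) * P.κ := by positivity
  have hz5 := h.pZ t5 ht5'
  set k := (Z t5)⁻¹ / ((1 - P.p) * P.κ) with hkdef
  have hk0 : 0 < k := by positivity
  have e := mvt_le (k := - ((1 - P.p) * P.κ)) (a := t5) (b := t5 + k) (by linarith)
    (fun u hu => (h.dZ u (ht5'.trans hu.1)).inv (h.pZ u (ht5'.trans hu.1)).ne') (fun u hu => by
      have hz := h.pZ u (ht5'.trans hu.1)
      have hx := h.pX u (ht5'.trans hu.1)
      have e1 := hG u hu.1
      have e2 : A u / X u ≤ - (P.κ * Z u) := by rw [div_le_iff₀ hx]; nlinarith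
      have e3 : (1 - P.p) * A u / X u ≤ (1 - P.p) * (- (P.κ * Z u)) := by
        rw [mul_div_assoc]; exact mul_le_mul_of_nonneg_left e2 hp.le
      rw [div_le_iff₀ (by positivity)]
      have : Z u * (P.s - (1 - P.p) * A u / X u) ≥ Z u * ((1 - P.p) * (P.κ * Z u)) :=
        mul_le_mul_of_nonneg_left (by linarith) hz.le
      nlinarith)
  have e2 : (1 - P.p) * P.κ * k = (Z t5)⁻¹ := by rw [hkdef]; field_simp
  have e3 : 0 < (Z (t5 + k))⁻¹ := inv_pos.2 (h.pZ _ (by simp only [mem_Ici]; linarith))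
  simp only [Pi.inv_apply] at e
  rw [show t5 + k - t5 = k by ring] at e
  linarith

end Sol

namespace Par
variable (P : Par)

lemma fwd_dies {c : E} (h1 : cA c ≤ P.α / P.n) (h2 : cA c ≤ P.q * cX c)
    (hβ : ∀ t ∈ P.I c, c.1 ≤ t → - P.β ≤ P.As c t) :
    ∃ b, c.1 < b ∧ (∀ t, c.1 ≤ t → (t ∈ P.I c ↔ t < b)) ∧ Tendsto (P.Xs c) (𝓝[<] b) (𝓝 0) := by
  have hsol := P.sol c
  rw [← P.As_start] at h1 h2
  rw [← P.Xs_start] at h2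
  rcases P.life_fwd c with hall | ⟨b, hb, hbI, hesc⟩
  · exact (((P.sol c).mono hall).no_forever h1 h2 (fun t ht => hβ t (hall ht) ht)).elim
  refine ⟨b, hb, hbI, ?_⟩
  have hm1 := P.hm1
  have hs' := P.s'_pos
  have hn := P.n_pos
  have hα := P.hα
  have hβ0 := P.hβ
  have hsub : ∀ t, t < b → Icc c.1 t ⊆ P.I c := fun t ht u hu => (hbI u hu.1).2 (hu.2.trans_lt ht)
  have hst : ∀ t, c.1 ≤ t → t < b → P.As c t ≤ P.α / P.n ∧ P.As c t ≤ P.q * P.Xs c t := fun t ht htb =>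
    (hsol.mono (hsub t htb)).strip h1 h2 t ⟨ht, le_rfl⟩
  set M := P.Xs c c.1 * exp (P.s' * (b - c.1)) with hM
  have hMpos : 0 < M := mul_pos (hsol.pX _ (P.mem_I c)) (exp_pos _)
  have hXM : ∀ t, c.1 ≤ t → t < b → P.Xs c t ≤ M := fun t ht htb => by
    have e := exp_le' (k := P.s') ht (fun u hu => hsol.dX u (hsub t htb hu)) (fun u hu => by
      have := (hst u hu.1 (hu.2.trans_lt htb)).2
      rw [P.s'_eq]
      nlinarith)
    refine e.trans (mul_le_mul_of_nonneg_left (exp_le_exp.2 ?_) (hsol.pX _ (P.mem_I c)).le)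
    exact mul_le_mul_of_nonneg_left (by linarith) hs'.le
  set K := (P.m - 1) * P.β + 2 * M with hK
  have hKpos : 0 < K := by positivity
  rw [Metric.tendsto_nhdsWithin_nhds]
  intro ε hε
  refine ⟨min (b - c.1) (ε / (2 * K)), lt_min (by linarith) (by positivity), fun {t} ht hd => ?_⟩
  simp only [mem_Iio] at ht
  rw [Real.dist_eq, abs_of_neg (by linarith)] at hd
  have d1 := hd.trans_le (min_le_left _ _)
  have d2 := hd.trans_le (min_le_right _ _)
  have hct : c.1 ≤ t := by linarith
  by_contra hcon
  push Not at hcon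
  rw [Real.dist_eq, sub_zero, abs_of_pos (hsol.pX t ((hbI t hct).2 ht))] at hcon
  obtain ⟨u, hu, hno⟩ := hesc (ε / 2) (max M (max P.β (P.α / P.n))) t (by positivity) hct ht
  apply hno
  have hcu : c.1 ≤ u := hct.trans hu.1
  have e := mvt_ge (k := - K) hu.1 (fun w hw => hsol.dX w ((hbI w (hct.trans hw.1)).2 (hw.2.trans_lt hu.2)))
    (fun w hw => by
      have hwI := (hbI w (hct.trans hw.1)).2 (hw.2.trans_lt hu.2)
      have f1 := hβ w hwI (hct.trans hw.1)
      have f2 := hXM w (hct.trans hw.1) (hw.2.trans_lt hu.2)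
      nlinarith)
  have e2 : K * (u - t) ≤ ε / 2 := by
    rw [lt_div_iff₀ (by positivity)] at d2
    nlinarith [hu.2]
  refine ⟨by linarith, (hXM u hcu hu.2).trans (le_max_left _ _), ?_⟩
  refine le_trans ?_ (le_max_right _ _)
  have f1 := hβ u ((hbI u hcu).2 hu.2) hcu
  have f2 := (hst u hcu hu.2).1
  exact abs_le.2 ⟨by linarith [le_max_left P.β (P.α / P.n)], f2.trans (le_max_right _ _)⟩

end Par


lemma ev_iff {a b : ℝ} (hab : a < b) {p : ℝ → Prop} :
    (∀ᶠ t in 𝓝[<] b, p t) ↔ ∃ t0 ∈ Ico a b, ∀ t ∈ Ico t0 b, p t := by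
  constructor
  · intro h
    obtain ⟨l, hl, hs⟩ := (mem_nhdsLT_iff_exists_Ico_subset).1 h
    refine ⟨max a l, ⟨le_max_left _ _, max_lt hab hl⟩, fun t ht => hs ⟨(le_max_right _ _).trans ht.1, ht.2⟩⟩
  · rintro ⟨t0, ht0, h⟩
    filter_upwards [Ico_mem_nhdsLT ht0.2] with t ht using h t ht

structure Dy (P : Par) (a b : ℝ) (X A Z : ℝ → ℝ) : Prop extends Sol P (Ico a b) X A Z where
  hab : a < b
  Aβ : ∀ t ∈ Ico a b, - P.β ≤ A t
  X0 : Tendsto X (𝓝[<] b) (𝓝 0)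

namespace Dy
variable {P : Par} {a b : ℝ} {X A Z : ℝ → ℝ}

lemma restrict (h : Dy P a b X A Z) {t : ℝ} (ht : t ∈ Ico a b) : Dy P t b X A Z where
  toSol := h.toSol.mono (Ico_subset_Ico_left ht.1)
  hab := ht.2
  Aβ := fun u hu => h.Aβ u ⟨ht.1.trans hu.1, hu.2⟩
  X0 := h.X0

lemma ev_mem (h : Dy P a b X A Z) : ∀ᶠ t in 𝓝[<] b, t ∈ Ico a b := Ico_mem_nhdsLT h.hab

lemma X0' (h : Dy P a b X A Z) : Tendsto X (𝓝[<] b) (𝓝[>] 0) :=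
  tendsto_nhdsWithin_iff.2 ⟨h.X0, h.ev_mem.mono (fun t ht => h.pX t ht)⟩

lemma r_lt (P : Par) : P.r < 1 := by
  unfold Par.r; rw [div_lt_one P.hm1]; linarith [P.hmp]

lemma exp_lim (P : Par) (b : ℝ) : Tendsto (fun t => P.ζ * exp (P.g0 * t)) (𝓝[<] b) (𝓝 (P.ζ * exp (P.g0 * b))) := by
  have : Continuous (fun t => P.ζ * exp (P.g0 * t)) := by fun_prop
  exact this.continuousAt.tendsto.mono_left nhdsWithin_le_nhds

lemma Z_top (h : Dy P a b X A Z) : Tendsto Z (𝓝[<] b) atTop := by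
  have e1 : Tendsto (fun t => X t ^ (- P.r)) (𝓝[<] b) atTop :=
    (tendsto_rpow_neg_nhdsGT_zero (by linarith [P.r_pos])).comp h.X0'
  have e2 := (exp_lim P b).pos_mul_atTop (mul_pos P.ζ_pos (exp_pos _)) e1
  refine e2.congr' ?_
  filter_upwards [h.ev_mem] with t ht
  rw [h.link t ht]

lemma XZ_zero (h : Dy P a b X A Z) : Tendsto (fun t => X t * Z t) (𝓝[<] b) (𝓝 0) := by
  have hr := r_lt P
  have e1 : Tendsto (fun t => X t ^ (1 - P.r)) (𝓝[<] b) (𝓝 0) := by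
    have := (continuousAt_rpow_const 0 (1 - P.r) (Or.inr (by linarith))).tendsto.comp h.X0
    rwa [zero_rpow (by linarith)] at this
  have e2 := (exp_lim P b).mul e1
  rw [mul_zero] at e2
  refine e2.congr' ?_
  filter_upwards [h.ev_mem] with t ht
  rw [h.link t ht, rpow_sub (h.pX t ht), rpow_neg (h.pX t ht).le, rpow_one]
  ring

lemma eventual (h : Dy P a b X A Z) : ∃ t0 ∈ Ico a b, ∀ t ∈ Ico t0 b,
    A t < 0 ∧ X t < 1 ∧ P.Λ < Z t ∧ P.κ * X t * Z t < - A t := by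
  have hΛ := P.Λ_gt
  have hα := P.hα
  have hκ := P.κ_pos
  have hs := P.hs
  obtain ⟨t1, ht1, h1⟩ := (ev_iff h.hab).1 (((h.X0.eventually (gt_mem_nhds zero_lt_one)).and
    (h.Z_top.eventually_gt_atTop P.Λ)))
  have h' := h.restrict ht1
  obtain ⟨t2, ht2, hA2⟩ : ∃ t2 ∈ Ico t1 b, A t2 < 0 := by
    by_contra hcon
    push Not at hcon
    have e : ∀ t ∈ Ico t1 b, X t1 * exp ((-2) * (b - t1)) ≤ X t := fun t ht => by
      have := exp_ge (k := -2) ht.1 (fun u hu => h'.dX u ⟨hu.1, hu.2.trans_lt ht.2⟩) (fun u hu => by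
        have := hcon u ⟨hu.1, hu.2.trans_lt ht.2⟩
        have := P.hm1
        nlinarith)
      refine le_trans (mul_le_mul_of_nonneg_left (exp_le_exp.2 (by linarith [ht.2])) ?_) this
      exact (h'.pX t1 ⟨le_rfl, ht1.2⟩).le
    have e2 := ge_of_tendsto h.X0 (h'.ev_mem.mono e)
    have := mul_pos (h'.pX t1 ⟨le_rfl, ht1.2⟩) (exp_pos ((-2) * (b - t1)))
    linarith
  have hA : ∀ t ∈ Ico t2 b, A t < 0 := fun t ht =>
    (h'.toSol.mono (fun u hu => ⟨ht2.1.trans hu.1, hu.2.trans_lt ht.2⟩)).A_neg_persist hA2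
      (fun u hu => (h1 u ⟨ht2.1.trans hu.1, hu.2.trans_lt ht.2⟩).2.le) t ⟨ht.1, le_rfl⟩
  have h'' := h'.restrict ht2
  have h1' : ∀ t ∈ Ico t2 b, X t < 1 ∧ P.Λ < Z t := fun t ht => h1 t ⟨ht2.1.trans ht.1, ht.2⟩
  obtain ⟨t3, ht3, hG3⟩ : ∃ t3 ∈ Ico t2 b, P.κ * (X t3 * Z t3) < - A t3 := by
    by_contra hcon
    push Not at hcon
    have e : ∀ t ∈ Ico t2 b, - A t2 ≤ P.κ * (X t * Z t) := fun t ht => by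
      have := mvt_ge (k := 0) ht.1 (fun u hu => (h''.dA u ⟨hu.1, hu.2.trans_lt ht.2⟩).neg) (fun u hu => by
        have hu' : u ∈ Ico t2 b := ⟨hu.1, hu.2.trans_lt ht.2⟩
        have hz := h''.pZ u hu'
        have e1 := Sol.H_incr (P := P) (h''.pX u hu') (h1' u hu').1.le hz (hA u hu').le (hcon u hu')
        have e2 := (h1' u hu').2
        have : 0 < P.κ * P.s * Z u := by positivity
        linarith)
      simp only [Pi.neg_apply] at this
      linarith [hcon t ht]
    have e2 := ge_of_tendsto (h.XZ_zero.const_mul P.κ) (h''.ev_mem.mono e)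
    linarith
  refine ⟨t3, ⟨ht1.1.trans (ht2.1.trans ht3.1), ht3.2⟩, fun t ht => ?_⟩
  have ht' : t ∈ Ico t2 b := ⟨ht3.1.trans ht.1, ht.2⟩
  refine ⟨hA t ht', (h1' t ht').1, (h1' t ht').2, ?_⟩
  have := (h''.toSol.mono (fun u hu => ⟨ht3.1.trans hu.1, hu.2.trans_lt ht.2⟩)).G_persist hG3
    (fun u hu => (h1' u ⟨ht3.1.trans hu.1, hu.2.trans_lt ht.2⟩).1.le)
    (fun u hu => (h1' u ⟨ht3.1.trans hu.1, hu.2.trans_lt ht.2⟩).2.le) t ⟨ht.1, le_rfl⟩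
  linarith

lemma typeI (h : Dy P a b X A Z) (hU : ∀ t ∈ Ico a b, ¬ P.U (X t) (A t) (Z t)) :
    Tendsto A (𝓝[<] b) (𝓝 (- P.β)) := by
  have hβ := P.hβ
  have he := (ev_iff h.hab).2 h.eventual
  rw [tendsto_order]
  constructor
  · intro c hc
    filter_upwards [h.ev_mem] with t ht
    linarith [h.Aβ t ht]
  · intro c hc
    -- choose θ
    obtain ⟨θ, h0, h1, h2⟩ : ∃ θ, 0 < θ ∧ θ < 1 ∧ - c < θ * P.β := by
      have h3 : max 0 (- c / P.β) < 1 := max_lt zero_lt_one (by rw [div_lt_one hβ]; linarith)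
      obtain ⟨θ, h4, h5⟩ := exists_between h3
      refine ⟨θ, (le_max_left _ _).trans_lt h4, h5, ?_⟩
      have := (le_max_right 0 (- c / P.β)).trans_lt h4
      rwa [div_lt_iff₀ hβ] at this
    have hpos : 0 < θ * (1 - θ) * P.β ^ 2 := by
      have : 0 < 1 - θ := by linarith
      positivity
    filter_upwards [he, h.ev_mem, h.XZ_zero.eventually (gt_mem_nhds hpos)] with t ht1 ht2 ht3
    by_contra hcon
    push Not at hcon
    exact hU t ht2 ⟨θ, h0, h1, ht1.2.1, ht1.2.2.1, ht1.2.2.2, by linarith, ht3⟩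

lemma typeII (h : Dy P a b X A Z) (hU : ∃ t ∈ Ico a b, P.U (X t) (A t) (Z t)) :
    Tendsto A (𝓝[<] b) (𝓝 0) ∧ Tendsto (fun t => - A t / (X t * Z t)) (𝓝[<] b) (𝓝 (1 / P.β)) := by
  obtain ⟨a', ha', θ, hθ0, hθ1, u1, u2, u3, u4, u5⟩ := hU
  have hβ := P.hβ
  have hα := P.hα
  have hm1 := P.hm1
  have hn := P.n_pos
  have hκ := P.κ_pos
  have h' := h.restrict ha'
  have hab := ha'.2
  have inv : ∀ t ∈ Ico a' b, X t < 1 ∧ P.Λ < Z t ∧ P.κ * X t * Z t < - A t ∧ - A t < θ * P.β ∧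
      X t * Z t < θ * (1 - θ) * P.β ^ 2 := fun t ht =>
    (h'.toSol.mono (fun u hu => ⟨hu.1, hu.2.trans_lt ht.2⟩)).U_inv hθ0 hθ1 u1 u2 u3 u4 u5 t ⟨ht.1, le_rfl⟩
  have hpos : ∀ t ∈ Ico a' b, 0 < - A t := fun t ht => by
    have := h'.pX t ht; have := h'.pZ t ht
    have : 0 < P.κ * X t * Z t := by positivity
    linarith [(inv t ht).2.2.1]
  have hθ2 : 0 < 1 - θ := by linarith
  set C := (P.m - 1) * P.β + 2 with hC
  have hC0 : 0 < C := by positivity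
  have hXC : ∀ t ∈ Ico a' b, X t ≤ C * (b - t) := fun t ht => by
    have e : ∀ u ∈ Ico t b, X t - C * (b - t) ≤ X u := fun u hu => by
      have := mvt_ge (k := - C) hu.1 (fun w hw => h'.dX w ⟨ht.1.trans hw.1, hw.2.trans_lt hu.2⟩) (fun w hw => by
        have hw' : w ∈ Ico a' b := ⟨ht.1.trans hw.1, hw.2.trans_lt hu.2⟩
        have := h'.Aβ w hw'
        have := (inv w hw').1
        nlinarith)
      nlinarith [hu.2]
    have := ge_of_tendsto h.X0 ((h'.restrict ht).ev_mem.mono e)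
    linarith
  have hdiv : ∀ t ∈ Ico a' b, ∀ k > 0, - k / X t ≤ - (k / C) / (b - t) := fun t ht k hk => by
    have hx := h'.pX t ht
    have h1 : 0 < b - t := by linarith [ht.2]
    rw [neg_div, neg_div, neg_le_neg_iff, div_div]
    exact div_le_div_of_nonneg_left hk.le hx (hXC t ht)
  have hA0 : Tendsto A (𝓝[<] b) (𝓝 0) := by
    rw [tendsto_order]
    constructor
    · intro c hc
      have hk : 0 < - c * (1 - θ) * P.β / 2 := by
        have : 0 < -c := by linarith
        positivity
      obtain ⟨t1, ht1, e1⟩ := (ev_iff hab).1 (h.XZ_zero.eventually (gt_mem_nhds hk))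
      have h1 := h'.restrict ht1
      have := finite_decay (g := fun t => - A t) (c := - c) (k := (- c * (1 - θ) * P.β / 2) / C) ht1.2
        (by positivity) (fun t ht => (h1.dA t ht).neg) (fun t ht hc1 => by
          have ht' : t ∈ Ico a' b := ⟨ht1.1.trans ht.1, ht.2⟩
          have hx := h1.pX t ht
          refine le_trans ?_ (hdiv t ht' _ hk)
          rw [le_div_iff₀ hx]
          have f1 := hpos t ht'
          have f2 := (inv t ht').2.2.2.1
          have f3 := e1 t ht
          have f4 : A t * (A t + P.β) / X t * X t = A t * (A t + P.β) := by field_simp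
          have f5 : -(P.α - P.n * A t - A t * (A t + P.β) / X t - Z t) * X t =
            - (P.α * X t) - (P.n * (-A t) * X t) - (-A t) * (A t + P.β) + X t * Z t := by
            linear_combination f4
          rw [f5]
          have f6 : 0 < P.α * X t := by positivity
          have f7 : 0 < P.n * (-A t) * X t := by positivity
          have f8 : (1 - θ) * P.β ≤ A t + P.β := by linarith
          have f9 : (-c) * ((1 - θ) * P.β) ≤ (-A t) * (A t + P.β) :=
            mul_le_mul hc1 f8 (by positivity) f1.le
          linarith)
      obtain ⟨t2, ht2, e2⟩ := this
      filter_upwards [Ico_mem_nhdsLT ht2.2] with t ht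
      linarith [e2 t ht]
    · intro c hc
      filter_upwards [h'.ev_mem] with t ht
      linarith [hpos t ht]
  refine ⟨hA0, ?_⟩
  set B : ℝ → ℝ := fun t => P.β - (- A t) - (P.m + P.p - 2) * (- A t) + (P.n + P.s - 2) * X t with hB
  have hBlim : Tendsto B (𝓝[<] b) (𝓝 P.β) := by
    have := (((hA0.neg.const_sub P.β).sub (hA0.neg.const_mul (P.m + P.p - 2))).add
      (h.X0.const_mul (P.n + P.s - 2)))
    simpa [hB] using this
  set qq : ℝ → ℝ := fun t => - A t / (X t * Z t) with hqq
  have hdq : ∀ t ∈ Ico a' b, HasDerivAt qq ((1 - P.α / Z t - qq t * B t) / X t) t := fun t ht => by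
    have hx := h'.pX t ht
    have hz := h'.pZ t ht
    refine ((h'.dA t ht).neg.div (h'.dXZ ht) (by positivity)).congr_deriv ?_
    simp only [hqq, hB, Pi.neg_apply]
    field_simp
    ring
  have hqpos : ∀ t ∈ Ico a' b, 0 < qq t := fun t ht =>
    div_pos (hpos t ht) (mul_pos (h'.pX t ht) (h'.pZ t ht))
  have hZinv : Tendsto (fun t => P.α / Z t) (𝓝[<] b) (𝓝 0) := h.Z_top.const_div_atTop P.α
  rw [tendsto_order]
  constructor
  · intro c hc
    rcases le_or_gt c 0 with hc0 | hc0
    · filter_upwards [h'.ev_mem] with t ht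
      linarith [hqpos t ht]
    have hk : 0 < 1 - c * P.β := by rw [lt_div_iff₀ hβ] at hc; linarith
    have lim : Tendsto (fun t => 1 - P.α / Z t - c * B t) (𝓝[<] b) (𝓝 (1 - 0 - c * P.β)) :=
      (hZinv.const_sub 1).sub (hBlim.const_mul c)
    obtain ⟨t1, ht1, e1⟩ := (ev_iff hab).1 ((lim.eventually (lt_mem_nhds
      (show (1 - c * P.β) / 2 < 1 - 0 - c * P.β by linarith))).and
      (hBlim.eventually (lt_mem_nhds hβ)))
    have := finite_decay (g := fun t => - qq t) (c := - c) (k := ((1 - c * P.β) / 2) / C) ht1.2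
      (by positivity) (fun t ht => (hdq t ⟨ht1.1.trans ht.1, ht.2⟩).neg) (fun t ht hc1 => by
        have ht' : t ∈ Ico a' b := ⟨ht1.1.trans ht.1, ht.2⟩
        have hx := h'.pX t ht'
        refine le_trans ?_ (hdiv t ht' _ (by positivity))
        rw [neg_div, neg_le_neg_iff]
        apply div_le_div_of_nonneg_right _ hx.le
        have := e1 t ht
        have : qq t * B t ≤ c * B t := mul_le_mul_of_nonneg_right (by linarith) this.2.le
        linarith [(e1 t ht).1])
    obtain ⟨t2, ht2, e2⟩ := this
    filter_upwards [Ico_mem_nhdsLT ht2.2] with t ht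
    linarith [e2 t ht]
  · intro c hc
    have hk : 0 < c * P.β - 1 := by rw [gt_iff_lt, div_lt_iff₀ hβ] at hc; linarith
    have lim : Tendsto (fun t => c * B t - 1) (𝓝[<] b) (𝓝 (c * P.β - 1)) :=
      (hBlim.const_mul c).sub_const 1
    obtain ⟨t1, ht1, e1⟩ := (ev_iff hab).1 ((lim.eventually (lt_mem_nhds
      (show (c * P.β - 1) / 2 < c * P.β - 1 by linarith))).and
      (hBlim.eventually (lt_mem_nhds hβ)))
    have := finite_decay (g := qq) (c := c) (k := ((c * P.β - 1) / 2) / C) ht1.2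
      (by positivity) (fun t ht => (hdq t ⟨ht1.1.trans ht.1, ht.2⟩)) (fun t ht hc1 => by
        have ht' : t ∈ Ico a' b := ⟨ht1.1.trans ht.1, ht.2⟩
        have hx := h'.pX t ht'
        have hz := h'.pZ t ht'
        refine le_trans ?_ (hdiv t ht' _ (by positivity))
        apply div_le_div_of_nonneg_right _ hx.le
        have := e1 t ht
        have : c * B t ≤ qq t * B t := mul_le_mul_of_nonneg_right (by linarith) this.2.le
        have : 0 < P.α / Z t := by positivity
        linarith [(e1 t ht).1])
    obtain ⟨t2, ht2, e2⟩ := this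
    filter_upwards [Ico_mem_nhdsLT ht2.2] with t ht
    exact e2 t ht

end Dy


namespace Sol
variable {P : Par} {X A Z : ℝ → ℝ}

/-- `F9` trap. -/
lemma trap {a b xb z : ℝ} (h : Sol P (Icc a b) X A Z) (h0 : 0 ≤ A a) (hz : ∀ t ∈ Icc a b, Z t ≤ z)
    (hx : ∀ t ∈ Icc a b, X t ≤ xb) (hxz : xb * z < P.β ^ 2 / 4) : ∀ t ∈ Icc a b, - (P.β / 2) < A t := by
  have hβ := P.hβ
  have := barrier (g := fun t => P.β / 2 + A t) (fun t ht => (h.dA t ht).const_add (P.β / 2)) (by linarith)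
    (fun t ht _ h1 => by
      have ht' := Ioc_subset_Icc_self ht
      have hA : A t = - (P.β / 2) := by linarith
      have px := h.pX t ht'
      have pz := h.pZ t ht'
      have e1 : X t * Z t < P.β ^ 2 / 4 := lt_of_le_of_lt
        (mul_le_mul (hx t ht') (hz t ht') pz.le (px.le.trans (hx t ht'))) hxz
      have e2 : A t * (A t + P.β) / X t = - ((P.β ^ 2 / 4) / X t) := by rw [hA]; ring
      have e3 : Z t < (P.β ^ 2 / 4) / X t := by rw [lt_div_iff₀ px]; linarith
      have e4 : P.n * A t = - (P.n * (P.β / 2)) := by rw [hA]; ring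
      have : 0 < P.n * (P.β / 2) := by have := P.n_pos; positivity
      have := P.hα
      rw [e2, e4]; linarith)
  intro t ht
  linarith [this t ht]

end Sol

namespace Par
variable (P : Par)

lemma Icc_sub {c : E} {u : ℝ} (hu : u ∈ P.I c) : Icc c.1 u ⊆ P.I c := (P.I_ord c).out (P.mem_I c) hu

set_option maxHeartbeats 1000000 in
lemma reach_U : ∃ ε > 0, ∀ c : E, P.cZ c = P.α / 2 → cX c ≤ ε → 0 ≤ cA c → cA c ≤ P.α / P.n →
    cA c ≤ P.q * cX c → ∃ t ∈ P.I c, c.1 ≤ t ∧ P.U (P.Xs c t) (P.As c t) (P.Zs c t) ∧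
      ∀ u ∈ Icc c.1 t, - P.β < P.As c u := by
  have hβ := P.hβ
  have hα := P.hα
  have hn := P.n_pos
  have hΛ := P.Λ_gt
  have hΛ0 : 0 < P.Λ := by linarith
  have hs' := P.s'_pos
  have hs := P.hs
  have hκ := P.κ_pos
  have hq := P.q_pos
  have hp : 0 < 1 - P.p := by linarith [P.hp1]
  have hm1 := P.hm1
  obtain ⟨D, hD0, hD⟩ : ∃ D > 0, 4 * P.Λ ≤ P.α / 2 * exp (P.s' * D) := by
    have lim : Tendsto (fun D => P.α / 2 * exp (P.s' * D)) atTop atTop :=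
      Tendsto.const_mul_atTop (by positivity) (tendsto_exp_atTop.comp (Tendsto.const_mul_atTop hs' tendsto_id))
    obtain ⟨D, h1, h2⟩ := ((lim.eventually_ge_atTop (4 * P.Λ)).and (eventually_gt_atTop 0)).exists
    exact ⟨D, h2, h1⟩
  set R := P.s + (1 - P.p) * (P.κ * (3 * P.Λ)) with hR
  have hR0 : 0 < R := by positivity
  obtain ⟨xb, hxb0, hxb1, hxb2, hxb3⟩ : ∃ xb : ℝ, 0 < xb ∧ xb < 1 ∧ xb * (3 * P.Λ) < P.β ^ 2 / 4 ∧
      xb * (P.κ * (3 * P.Λ) + P.q) < 1 / (3 * R) := by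
    have e : ∀ k C : ℝ, 0 < C → ∀ᶠ x in 𝓝[>] (0:ℝ), x * k < C := fun k C hC => by
      have : Tendsto (fun x : ℝ => x * k) (𝓝[>] 0) (𝓝 (0 * k)) :=
        (tendsto_id.mul_const k).mono_left nhdsWithin_le_nhds
      rw [zero_mul] at this
      exact this.eventually (gt_mem_nhds hC)
    obtain ⟨x, h1, h2, h3, h4⟩ := ((e 1 1 one_pos).and ((e (3 * P.Λ) (P.β ^ 2 / 4) (by positivity)).and
      ((e (P.κ * (3 * P.Λ) + P.q) (1 / (3 * R)) (by positivity)).and self_mem_nhdsWithin))).exists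
    exact ⟨x, h4, by linarith, h2, h3⟩
  refine ⟨xb * exp (-(P.s' * D)), by positivity, fun c hZ hX hA0 hA1 hA2 => ?_⟩
  have hsol := P.sol c
  rw [← P.As_start] at hA0 hA1 hA2
  rw [← P.Xs_start] at hX hA2
  rw [← P.Zs_start] at hZ
  have hst : ∀ t ∈ P.I c, c.1 ≤ t → P.As c t ≤ P.α / P.n ∧ P.As c t ≤ P.q * P.Xs c t := fun t ht h1 =>
    (hsol.mono (P.Icc_sub ht)).strip hA1 hA2 t ⟨h1, le_rfl⟩
  have hXb : ∀ t ∈ P.I c, c.1 ≤ t → t ≤ c.1 + D → P.Xs c t ≤ xb := fun t ht h1 h2 => by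
    have e := exp_le' (k := P.s') h1 (fun u hu => hsol.dX u (P.Icc_sub ht hu)) (fun u hu => by
      have := (hst u (P.Icc_sub ht hu) hu.1).2
      rw [P.s'_eq]
      nlinarith)
    have e1 : P.Xs c c.1 * exp (P.s' * (t - c.1)) ≤ xb * exp (-(P.s' * D)) * exp (P.s' * D) :=
      mul_le_mul hX (exp_le_exp.2 (mul_le_mul_of_nonneg_left (by linarith) hs'.le)) (exp_pos _).le (by positivity)
    rw [mul_assoc, ← exp_add, neg_add_cancel, exp_zero, mul_one] at e1
    exact e.trans e1
  have hZe : ∀ t ∈ P.I c, c.1 ≤ t → ∀ u ∈ Icc c.1 t, P.Zs c u * exp (P.s' * (t - u)) ≤ P.Zs c t :=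
    fun t ht h1 u hu => exp_ge hu.2 (fun w hw => hsol.dZ w (P.Icc_sub ht ⟨hu.1.trans hw.1, hw.2⟩)) (fun w hw => by
      have hw' := P.Icc_sub ht ⟨hu.1.trans hw.1, hw.2⟩
      exact Sol.Z_rate' (hsol.pX w hw') (hsol.pZ w hw') (hst w hw' (hu.1.trans hw.1)).2)
  have hZm : ∀ t ∈ P.I c, c.1 ≤ t → ∀ u ∈ Icc c.1 t, P.Zs c u ≤ P.Zs c t := fun t ht h1 u hu => by
    refine le_trans ?_ (hZe t ht h1 u hu)
    have : 1 ≤ exp (P.s' * (t - u)) := one_le_exp (mul_nonneg hs'.le (by linarith [hu.2]))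
    nlinarith [hsol.pZ u (P.Icc_sub ht hu)]
  obtain ⟨w, hwI, hw1, hw2, hw3⟩ : ∃ w ∈ P.I c, c.1 ≤ w ∧ w ≤ c.1 + D ∧ 3 * P.Λ < P.Zs c w := by
    by_contra hcon
    push Not at hcon
    rcases P.life_fwd c with hall | ⟨b, hb, hbI, hesc⟩
    · have hm : c.1 + D ∈ P.I c := hall (by simp only [mem_Ici]; linarith)
      have := hZe _ hm (by linarith) c.1 ⟨le_rfl, by linarith⟩
      rw [hZ, add_sub_cancel_left] at this
      linarith [hcon _ hm (by linarith) le_rfl]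
    rcases lt_or_ge (c.1 + D) b with hbD | hbD
    · have hm : c.1 + D ∈ P.I c := (hbI _ (by linarith)).2 hbD
      have := hZe _ hm (by linarith) c.1 ⟨le_rfl, by linarith⟩
      rw [hZ, add_sub_cancel_left] at this
      linarith [hcon _ hm (by linarith) le_rfl]
    set ww := 3 * P.Λ / (P.ζ * exp (P.g0 * c.1)) with hww
    have hζ := P.ζ_pos
    have hww0 : 0 < ww := by positivity
    obtain ⟨t, ht, hno⟩ := hesc (ww ^ (-(1 / P.r))) (max xb (max P.β (P.α / P.n))) c.1 (by positivity) le_rfl hb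
    have htI := (hbI t ht.1).2 ht.2
    apply hno
    have htD : t ≤ c.1 + D := by linarith [ht.2]
    have htrap := (hsol.mono (P.Icc_sub htI)).trap (z := 3 * P.Λ) (xb := xb) hA0
      (fun u hu => hcon u (P.Icc_sub htI hu) hu.1 (hu.2.trans htD))
      (fun u hu => hXb u (P.Icc_sub htI hu) hu.1 (hu.2.trans htD)) hxb2 t ⟨ht.1, le_rfl⟩
    refine ⟨?_, (hXb t htI ht.1 htD).trans (le_max_left _ _), ?_⟩
    · have px := hsol.pX t htI
      have hr := P.r_pos
      have e1 : P.Xs c t ^ (-P.r) ≤ ww := by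
        rw [hww, le_div_iff₀ (by positivity)]
        have e2 := hcon t htI ht.1 htD
        rw [hsol.link t htI] at e2
        refine le_trans ?_ e2
        rw [mul_comm]
        refine mul_le_mul_of_nonneg_right (mul_le_mul_of_nonneg_left (exp_le_exp.2 ?_) hζ.le) (by positivity)
        exact mul_le_mul_of_nonneg_left ht.1 P.g0_pos.le
      have e2 := rpow_le_rpow_of_nonpos (by positivity) e1 (show -(1 / P.r) ≤ 0 by
        have : 0 < 1 / P.r := by positivity
        linarith)
      rwa [← rpow_mul px.le, show -P.r * -(1 / P.r) = 1 by field_simp, rpow_one] at e2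
    · refine le_trans ?_ (le_max_right _ _)
      have f2 := (hst t htI ht.1).1
      exact abs_le.2 ⟨by linarith [le_max_left P.β (P.α / P.n)], f2.trans (le_max_right _ _)⟩
  have hcont : ContinuousOn (P.Zs c) (Icc c.1 w) := hsol.cZ (P.Icc_sub hwI)
  obtain ⟨s2, hs2, hZ2⟩ := intermediate_value_Icc hw1 hcont
    (show 3 * P.Λ ∈ Icc _ _ from ⟨by rw [hZ]; linarith, hw3.le⟩)
  have hs2I := P.Icc_sub hwI hs2
  obtain ⟨s1, hs1, hZ1⟩ := intermediate_value_Icc hs2.1 (hcont.mono (Icc_subset_Icc_right hs2.2))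
    (show 2 * P.Λ ∈ Icc _ _ from ⟨by rw [hZ]; linarith, by rw [hZ2]; linarith⟩)
  have hI : ∀ u ∈ Icc c.1 s2, u ∈ P.I c := fun u hu => P.Icc_sub hs2I hu
  have hXb' : ∀ u ∈ Icc c.1 s2, P.Xs c u ≤ xb := fun u hu => hXb u (hI u hu) hu.1 (hu.2.trans (hs2.2.trans hw2))
  have hZ3 : ∀ u ∈ Icc c.1 s2, P.Zs c u ≤ 3 * P.Λ := fun u hu => by
    rw [← hZ2]; exact hZm s2 hs2I hs2.1 u hu
  have hZ4 : ∀ u ∈ Icc s1 s2, 2 * P.Λ ≤ P.Zs c u := fun u hu => by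
    rw [← hZ1]; exact hZm u (hI u ⟨hs1.1.trans hu.1, hu.2⟩) (hs1.1.trans hu.1) s1 ⟨hs1.1, hu.1⟩
  have htrap := (hsol.mono (P.Icc_sub hs2I)).trap (z := 3 * P.Λ) (xb := xb) hA0 hZ3 hXb' hxb2
  obtain ⟨t, ht, hG⟩ : ∃ t ∈ Icc s1 s2, P.κ * (P.Xs c t * P.Zs c t) < - P.As c t := by
    by_contra hcon
    push Not at hcon
    have hmem : ∀ u ∈ Icc s1 s2, u ∈ Icc c.1 s2 := fun u hu => ⟨hs1.1.trans hu.1, hu.2⟩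
    have e1 := mvt_ge (k := 1) hs1.2 (fun u hu => (hsol.dA u (hI u (hmem u hu))).neg) (fun u hu => by
      have px := hsol.pX u (hI u (hmem u hu))
      have pz := hsol.pZ u (hI u (hmem u hu))
      have hz := hZ4 u hu
      rcases le_or_gt (P.As c u) 0 with ha | ha
      · have := Sol.H_incr (P := P) px ((hXb' u (hmem u hu)).trans hxb1.le) pz ha (hcon u hu)
        have : 0 < P.κ * P.s * P.Zs c u := by positivity
        linarith
      · have f1 : 0 < P.As c u * (P.As c u + P.β) / P.Xs c u := by positivity
        have f2 : 0 < P.n * P.As c u := by positivity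
        linarith)
    have e2 := mvt_le (k := 3 * P.Λ * R) hs1.2 (fun u hu => (hsol.dZ u (hI u (hmem u hu)))) (fun u hu => by
      have px := hsol.pX u (hI u (hmem u hu))
      have pz := hsol.pZ u (hI u (hmem u hu))
      have f1 : - P.As c u / P.Xs c u ≤ P.κ * (3 * P.Λ) := by
        rw [div_le_iff₀ px]
        refine (hcon u hu).trans ?_
        have := mul_le_mul_of_nonneg_left (hZ3 u (hmem u hu)) (mul_pos hκ px).le
        linarith
      have f2 : P.s - (1 - P.p) * P.As c u / P.Xs c u ≤ R := by
        have := mul_le_mul_of_nonneg_left f1 hp.le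
        have e : (1 - P.p) * (- P.As c u / P.Xs c u) = - ((1 - P.p) * P.As c u / P.Xs c u) := by ring
        rw [e] at this
        linarith
      calc _ ≤ P.Zs c u * R := mul_le_mul_of_nonneg_left f2 pz.le
        _ ≤ _ := mul_le_mul_of_nonneg_right (hZ3 u (hmem u hu)) hR0.le)
    rw [hZ1, hZ2] at e2
    simp only [Pi.neg_apply] at e1
    have f1 := hcon s2 ⟨hs1.2, le_rfl⟩
    have f2 : P.Xs c s2 * P.Zs c s2 ≤ xb * (3 * P.Λ) :=
      mul_le_mul (hXb' s2 ⟨hs2.1, le_rfl⟩) (hZ3 s2 ⟨hs2.1, le_rfl⟩) (hsol.pZ s2 hs2I).le hxb0.le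
    have f3 := mul_le_mul_of_nonneg_left f2 hκ.le
    have f4 := (hst s1 (hI s1 hs1) hs1.1).2
    have f5 := mul_le_mul_of_nonneg_left (hXb' s1 hs1) hq.le
    have f6 : 1 / (3 * R) ≤ s2 - s1 := by
      rw [div_le_iff₀ (by positivity)]
      have : P.Λ * 1 ≤ P.Λ * ((s2 - s1) * (3 * R)) := by linarith
      exact le_of_mul_le_mul_left this hΛ0
    have f7 : xb * (P.κ * (3 * P.Λ) + P.q) = P.κ * (xb * (3 * P.Λ)) + P.q * xb := by ring
    linarith
  have htm : t ∈ Icc c.1 s2 := ⟨hs1.1.trans ht.1, ht.2⟩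
  refine ⟨t, hI t htm, htm.1, ⟨1 / 2, by norm_num, by norm_num, (hXb' t htm).trans_lt hxb1, ?_, ?_, ?_, ?_⟩, ?_⟩
  · linarith [hZ4 t ht]
  · linarith
  · linarith [htrap t htm]
  · have : P.Xs c t * P.Zs c t ≤ xb * (3 * P.Λ) :=
      mul_le_mul (hXb' t htm) (hZ3 t htm) (hsol.pZ t (hI t htm)).le hxb0.le
    linarith
  · intro u hu
    linarith [htrap u ⟨hu.1, hu.2.trans ht.2⟩]

set_option maxHeartbeats 1000000 in
lemma reach_C (t1 : ℝ) : ∃ x0, ∀ x ≥ x0, ∀ a, a ≤ P.α / P.n → a ≤ P.q * exp x →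
    ∃ t ∈ P.I (t1, x, a), t1 ≤ t ∧ P.As (t1, x, a) t < - P.β := by
  have hβ := P.hβ
  have hα := P.hα
  have hn := P.n_pos
  have hm1 := P.hm1
  have hζ := P.ζ_pos
  set K := (P.m - 1) * (P.α / P.n) + (P.m - 1) * P.β with hK
  have hK0 : 0 < K := by positivity
  set lo := (P.m - 1) * P.β / 2 with hlo
  have hlo0 : 0 < lo := by positivity
  set hi := K * exp 2 with hhi
  have hhi0 : 0 < hi := by positivity
  set M := P.α + P.n * P.β + P.β ^ 2 / lo + P.α / P.n + P.β + 1 with hM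
  obtain ⟨T0, hT0⟩ : ∃ T0, ∀ T ≥ T0, t1 ≤ T - 1 ∧ M ≤ P.ζ * exp (P.g0 * (T - 1)) * hi ^ (- P.r) := by
    have lim : Tendsto (fun T => P.ζ * exp (P.g0 * (T - 1)) * hi ^ (- P.r)) atTop atTop := by
      refine Tendsto.atTop_mul_const (by positivity) ?_
      refine Tendsto.const_mul_atTop hζ (tendsto_exp_atTop.comp ?_)
      exact Tendsto.const_mul_atTop P.g0_pos (tendsto_atTop_add_const_right _ _ tendsto_id)
    obtain ⟨T0, h⟩ := eventually_atTop.1 ((eventually_ge_atTop (t1 + 1)).and (lim.eventually_ge_atTop M))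
    exact ⟨T0, fun T hT => ⟨by linarith [(h T hT).1], (h T hT).2⟩⟩
  refine ⟨log ((P.m - 1) * P.β) + 2 * T0 - 2 * t1, fun x hx a ha1 ha2 => ?_⟩
  set T := (x + 2 * t1 - log ((P.m - 1) * P.β)) / 2 with hT
  obtain ⟨hT1, hT2⟩ := hT0 T (by rw [hT]; linarith)
  have hv1 : exp (x + 2 * t1) = (P.m - 1) * P.β * exp (2 * T) := by
    rw [show x + 2 * t1 = log ((P.m - 1) * P.β) + 2 * T by rw [hT]; ring, exp_add, exp_log (by positivity)]
  set c : E := (t1, x, a) with hc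
  have hc1 : c.1 = t1 := rfl
  by_contra hcon
  push Not at hcon
  have hsol := P.sol c
  obtain ⟨b, hb, hbI, hX0⟩ := P.fwd_dies (c := c) ha1 ha2 hcon
  rw [hc1] at hb hbI
  have hst : ∀ t ∈ P.I c, c.1 ≤ t → P.As c t ≤ P.α / P.n ∧ P.As c t ≤ P.q * P.Xs c t := fun t ht h1 =>
    (hsol.mono (P.Icc_sub ht)).strip (by rw [P.As_start]; exact ha1)
      (by rw [P.As_start, P.Xs_start]; exact ha2) t ⟨h1, le_rfl⟩
  have hd : ∀ t ∈ P.I c, HasDerivAt (fun t => P.Xs c t * exp (2 * t)) ((P.m - 1) * P.As c t * exp (2 * t)) t :=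
    fun t ht => by
      have h2 : HasDerivAt (fun t : ℝ => exp (2 * t)) (exp (2 * t) * (2 * 1)) t :=
        ((hasDerivAt_id t).const_mul 2).exp
      exact ((hsol.dX t ht).mul h2).congr_deriv (by ring)
  have hde : ∀ k t : ℝ, HasDerivAt (fun t : ℝ => k * exp (2 * t)) (k * 2 * exp (2 * t)) t := fun k t => by
    have h2 : HasDerivAt (fun t : ℝ => exp (2 * t)) (exp (2 * t) * (2 * 1)) t :=
      ((hasDerivAt_id t).const_mul 2).exp
    exact (h2.const_mul k).congr_deriv (by ring)
  have hstart : P.Xs c t1 * exp (2 * t1) = (P.m - 1) * P.β * exp (2 * T) := by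
    rw [← hc1, P.Xs_start, ← hv1, exp_add]; rfl
  have hvlo : ∀ t ∈ P.I c, t1 ≤ t → t ≤ T → lo * exp (2 * T) ≤ P.Xs c t * exp (2 * t) := fun t ht h1 h2 => by
    have e := mvt_ge (k := 0) h1 (fun u hu => (hd u (P.Icc_sub ht hu)).add (hde lo u)) (fun u hu => by
      have f1 := hcon u (P.Icc_sub ht hu) hu.1
      have f2 := exp_pos (2 * u)
      have : (P.m - 1) * P.As c u * exp (2 * u) + lo * 2 * exp (2 * u) =
        (P.m - 1) * (P.As c u + P.β) * exp (2 * u) := by rw [hlo]; ring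
      rw [this]
      exact mul_nonneg (mul_nonneg hm1.le (by linarith)) f2.le)
    simp only [Pi.add_apply] at e
    rw [hstart] at e
    have f1 : lo * exp (2 * t) ≤ lo * exp (2 * T) :=
      mul_le_mul_of_nonneg_left (exp_le_exp.2 (by linarith)) hlo0.le
    have f2 : 0 < lo * exp (2 * t1) := by positivity
    have f3 : (P.m - 1) * P.β * exp (2 * T) = 2 * (lo * exp (2 * T)) := by rw [hlo]; ring
    linarith
  have hvhi : ∀ t ∈ P.I c, t1 ≤ t → t ≤ T → P.Xs c t * exp (2 * t) ≤ K * exp (2 * T) := fun t ht h1 h2 => by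
    set k := (P.m - 1) * (P.α / P.n) with hk
    have hk0 : 0 < k := by positivity
    have e := mvt_le (k := 0) h1 (fun u hu => (hd u (P.Icc_sub ht hu)).sub (hde k u)) (fun u hu => by
      have f1 := (hst u (P.Icc_sub ht hu) hu.1).1
      have f2 := exp_pos (2 * u)
      have f3 : (P.m - 1) * P.As c u ≤ k := mul_le_mul_of_nonneg_left f1 hm1.le
      have f4 : (P.m - 1) * P.As c u * exp (2 * u) ≤ k * 2 * exp (2 * u) :=
        mul_le_mul_of_nonneg_right (by linarith) f2.le
      linarith)
    simp only [Pi.sub_apply] at e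
    rw [hstart] at e
    have f1 : k * exp (2 * t) ≤ k * exp (2 * T) :=
      mul_le_mul_of_nonneg_left (exp_le_exp.2 (by linarith)) hk0.le
    have f2 : 0 < k * exp (2 * t1) := by positivity
    have f3 : K * exp (2 * T) = k * exp (2 * T) + (P.m - 1) * P.β * exp (2 * T) := by rw [hK]; ring
    linarith
  have hbT : T < b := by
    by_contra hbT
    push Not at hbT
    have e : ∀ᶠ t in 𝓝[<] b, lo ≤ P.Xs c t := by
      filter_upwards [Ico_mem_nhdsLT hb] with t ht
      have f1 := hvlo t ((hbI t ht.1).2 ht.2) ht.1 (by linarith [ht.2])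
      have f2 : exp (2 * t) ≤ exp (2 * T) := exp_le_exp.2 (by linarith [ht.2])
      have f3 : lo * exp (2 * t) ≤ P.Xs c t * exp (2 * t) :=
        le_trans (mul_le_mul_of_nonneg_left f2 hlo0.le) f1
      exact le_of_mul_le_mul_right f3 (exp_pos _)
    have := ge_of_tendsto hX0 e
    linarith
  have hTI : T ∈ P.I c := (hbI T (by linarith)).2 hbT
  have hmem : ∀ u ∈ Icc (T - 1) T, u ∈ P.I c := fun u hu => P.Icc_sub hTI ⟨hT1.trans hu.1, hu.2⟩
  have e := mvt_le (k := - (P.α / P.n + P.β + 1)) (show T - 1 ≤ T by linarith)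
    (fun u hu => hsol.dA u (hmem u hu)) (fun u hu => by
      have hu1 : t1 ≤ u := hT1.trans hu.1
      have px := hsol.pX u (hmem u hu)
      have f1 := hvlo u (hmem u hu) hu1 hu.2
      have f2 := hvhi u (hmem u hu) hu1 hu.2
      have g1 : lo ≤ P.Xs c u := by
        have : exp (2 * u) ≤ exp (2 * T) := exp_le_exp.2 (by linarith [hu.2])
        exact le_of_mul_le_mul_right ((mul_le_mul_of_nonneg_left this hlo0.le).trans f1) (exp_pos _)
      have g2 : P.Xs c u ≤ hi := by
        have : exp (2 * T) ≤ exp 2 * exp (2 * u) := by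
          rw [← exp_add]; exact exp_le_exp.2 (by linarith [hu.1])
        have := f2.trans (mul_le_mul_of_nonneg_left this hK0.le)
        rw [← mul_assoc] at this
        exact le_of_mul_le_mul_right this (exp_pos _)
      have g3 : M ≤ P.Zs c u := by
        refine hT2.trans ?_
        rw [hsol.link u (hmem u hu)]
        refine mul_le_mul ?_ (rpow_le_rpow_of_nonpos px g2 (by linarith [P.r_pos])) (by positivity) (by positivity)
        exact mul_le_mul_of_nonneg_left (exp_le_exp.2 (mul_le_mul_of_nonneg_left hu.1 P.g0_pos.le)) hζ.le
      have g4 := hcon u (hmem u hu) hu1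
      have g5 : - (P.As c u * (P.As c u + P.β) / P.Xs c u) ≤ P.β ^ 2 / lo := by
        rw [← neg_div]
        calc _ ≤ P.β ^ 2 / P.Xs c u := by
              apply div_le_div_of_nonneg_right _ px.le
              nlinarith [sq_nonneg (P.As c u + P.β / 2)]
          _ ≤ _ := div_le_div_of_nonneg_left (by positivity) hlo0 g1
      have g6 : - (P.n * P.As c u) ≤ P.n * P.β := by nlinarith
      linarith)
  have f1 := hcon T hTI (by linarith)
  have f2 := (hst (T - 1) (hmem _ ⟨le_rfl, by linarith⟩) hT1).1
  linarith

end Par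


namespace Sol
variable {P : Par} {X A Z : ℝ → ℝ}

/-- once `A < -β`, it stays so -/
lemma stay_below {a u b : ℝ} (h : Sol P (Icc a b) X A Z) (hu : u ∈ Icc a b) (h0 : 0 ≤ A a)
    (h1 : A a ≤ P.α / P.n) (h2 : A a ≤ P.q * X a) (hA : A u < - P.β) : A b < - P.β := by
  have hβ := P.hβ
  have hs' := P.s'_pos
  have hst := h.strip h1 h2
  have hZpos : ∀ t ∈ Icc a b, 0 < Z t * (P.s - (1 - P.p) * A t / X t) := fun t ht =>
    lt_of_lt_of_le (mul_pos hs' (h.pZ t ht)) (Z_rate' (h.pX t ht) (h.pZ t ht) (hst t ht).2)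
  have hZu : P.α + P.n * P.β ≤ Z u := by
    by_contra hcon
    push Not at hcon
    have hsub : Icc a u ⊆ Icc a b := Icc_subset_Icc_right hu.2
    have hZ : ∀ t ∈ Icc a u, Z t < P.α + P.n * P.β := fun t ht => by
      have := mvt_ge (k := 0) ht.2 (fun w hw => h.dZ w ⟨ht.1.trans hw.1, hw.2.trans hu.2⟩)
        (fun w hw => (hZpos w ⟨ht.1.trans hw.1, hw.2.trans hu.2⟩).le)
      linarith
    have := barrier (g := fun t => P.β + A t) (fun t ht => (h.dA t (hsub ht)).const_add P.β) (by linarith)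
      (fun t ht _ h3 => by
        have hA' : A t = - P.β := by linarith
        have := hZ t (Ioc_subset_Icc_self ht)
        rw [hA']; simp only [neg_add_cancel, mul_zero, zero_div]; linarith) u ⟨hu.1, le_rfl⟩
    linarith
  have hsub : Icc u b ⊆ Icc a b := Icc_subset_Icc_left hu.1
  have := barrier (g := fun t => - P.β - A t) (fun t ht => (h.dA t (hsub ht)).const_sub (- P.β)) (by linarith)
      (fun t ht _ h3 => by
        have hA' : A t = - P.β := by linarith
        have := mvt_gt (k := 0) ht.1 (fun w hw => h.dZ w (hsub ⟨hw.1, hw.2.trans ht.2⟩))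
          (fun w hw => (hZpos w (hsub ⟨hw.1, hw.2.trans ht.2⟩)))
        rw [hA']; simp only [neg_add_cancel, mul_zero, zero_div]; linarith) b ⟨hu.2, le_rfl⟩
  linarith

end Sol

namespace Par
variable (P : Par)

lemma T_mem (c : E) (τ : ℝ) : P.T c τ ∈ P.I c := ⟨τ, rfl⟩
lemma T_ge {c : E} {τ : ℝ} (h : 0 ≤ τ) : c.1 ≤ P.T c τ := by
  rw [← P.T_zero c]; exact (P.T_strictMono c).monotone h
lemma iv_nonneg {c : E} {t : ℝ} (h : t ∈ P.I c) (h1 : c.1 ≤ t) : 0 ≤ P.iv c t := by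
  rw [← (P.T_strictMono c).le_iff_le, P.T_zero, P.T_iv h]; exact h1
lemma Xs_T (c : E) (τ : ℝ) : P.Xs c (P.T c τ) = cX (P.Φ τ c) := by unfold Xs; rw [iv_T]
lemma As_T (c : E) (τ : ℝ) : P.As c (P.T c τ) = cA (P.Φ τ c) := by unfold As; rw [iv_T]
lemma Zs_T (c : E) (τ : ℝ) : P.Zs c (P.T c τ) = P.cZ (P.Φ τ c) := by unfold Zs; rw [iv_T]

def Uc (c : E) : Prop := P.U (cX c) (cA c) (P.cZ c)

lemma Uc_open : IsOpen {c | P.Uc c} := by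
  have h1 := cont_cX; have h2 := cont_cA; have h3 := P.cont_cZ
  have : {c | P.Uc c} = ⋃ θ ∈ Ioo (0:ℝ) 1, ({c | cX c < 1} ∩ {c | P.Λ < P.cZ c} ∩
    {c | P.κ * cX c * P.cZ c < - cA c} ∩ {c | - cA c < θ * P.β} ∩ {c | cX c * P.cZ c < θ * (1 - θ) * P.β ^ 2}) := by
    ext c
    simp only [Uc, U, mem_ofPred_eq, mem_iUnion, mem_inter_iff, mem_Ioo, exists_prop]
    constructor
    · rintro ⟨θ, a1, a2, a3, a4, a5, a6, a7⟩; exact ⟨θ, ⟨a1, a2⟩, ⟨⟨⟨⟨a3, a4⟩, a5⟩, a6⟩, a7⟩⟩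
    · rintro ⟨θ, ⟨a1, a2⟩, ⟨⟨⟨⟨a3, a4⟩, a5⟩, a6⟩, a7⟩⟩; exact ⟨θ, a1, a2, a3, a4, a5, a6, a7⟩
  rw [this]
  refine isOpen_biUnion fun θ _ => ?_
  refine ((((isOpen_lt ?_ ?_).inter (isOpen_lt ?_ ?_)).inter (isOpen_lt ?_ ?_)).inter (isOpen_lt ?_ ?_)).inter
    (isOpen_lt ?_ ?_) <;> fun_prop

def OC : Set E := {c | ∃ τ ≥ 0, cA (P.Φ τ c) < - P.β}
def OT : Set E := {c | ∃ τ ≥ 0, P.Uc (P.Φ τ c)}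

lemma cont_Φ (τ : ℝ) : Continuous (P.Φ τ) := P.Φ_cont.comp (by fun_prop : Continuous fun c : E => (τ, c))

lemma OC_open : IsOpen P.OC := by
  have : P.OC = ⋃ τ ∈ Ici (0:ℝ), (P.Φ τ) ⁻¹' {c | cA c < - P.β} := by
    ext c; simp [OC]
  rw [this]
  exact isOpen_biUnion fun τ _ => (isOpen_lt cont_cA continuous_const).preimage (P.cont_Φ τ)
lemma OT_open : IsOpen P.OT := by
  have : P.OT = ⋃ τ ∈ Ici (0:ℝ), (P.Φ τ) ⁻¹' {c | P.Uc c} := by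
    ext c; simp [OT]
  rw [this]
  exact isOpen_biUnion fun τ _ => P.Uc_open.preimage (P.cont_Φ τ)

lemma good_start {c : E} (h : P.Good c) : 0 ≤ cA c ∧ cA c ≤ P.α / P.n ∧ cA c ≤ P.q * cX c := by
  have := h 0 le_rfl
  rwa [Φ_zero] at this

lemma disj {c : E} (hg : P.Good c) (h1 : c ∈ P.OC) (h2 : c ∈ P.OT) : False := by
  obtain ⟨τ1, h1, hA⟩ := h1
  obtain ⟨τ2, h2, hU⟩ := h2
  have hβ := P.hβ
  obtain ⟨g0, g1, g2⟩ := P.good_start hg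
  unfold Uc at hU
  rw [← P.As_T] at hA
  rw [← P.Xs_T, ← P.As_T, ← P.Zs_T] at hU
  obtain ⟨θ, hθ0, hθ1, u1, u2, u3, u4, u5⟩ := hU
  have hlt : θ * P.β < P.β := by nlinarith
  rcases le_total τ1 τ2 with hle | hle
  · have := ((P.sol c).mono (P.Icc_sub (P.T_mem c τ2))).stay_below (u := P.T c τ1)
      ⟨P.T_ge h1, (P.T_strictMono c).monotone hle⟩ (by rwa [P.As_start]) (by rwa [P.As_start])
      (by rwa [P.As_start, P.Xs_start]) hA
    linarith
  · have := ((P.sol c).mono ((P.I_ord c).out (P.T_mem c τ2) (P.T_mem c τ1))).U_inv hθ0 hθ1 u1 u2 u3 u4 u5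
      (P.T c τ1) ⟨(P.T_strictMono c).monotone hle, le_rfl⟩
    linarith [this.2.2.2.1]

lemma shoot : (∃ c, P.Good c ∧ c ∉ P.OC ∧ c ∉ P.OT) ∧ (∃ c, P.Good c ∧ c ∉ P.OC ∧ c ∈ P.OT) := by
  obtain ⟨ε, hε, hU⟩ := P.reach_U
  have hα := P.hα
  have hζ := P.ζ_pos
  have hr := P.r_pos
  have hg0 := P.g0_pos
  set x1 := log ε with hx1
  set t1 := (log (P.α / (2 * P.ζ)) + P.r * x1) / P.g0 with ht1
  obtain ⟨g, hg, hgc⟩ := P.exists_branch t1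
  have hZ1 : ∀ a, P.cZ (t1, x1, a) = P.α / 2 := fun a => by
    unfold cZ
    simp only
    rw [show P.g0 * t1 - P.r * x1 = log (P.α / (2 * P.ζ)) by rw [ht1]; field_simp; ring, exp_log (by positivity)]
    field_simp
  have hanti : ∀ x y, x ≤ y → P.cZ (t1, y, 0) ≤ P.cZ (t1, x, 0) := fun x y hxy => by
    unfold cZ
    refine mul_le_mul_of_nonneg_left (exp_le_exp.2 ?_) hζ.le
    simp only
    nlinarith
  set D := {x | P.cZ (t1, x, 0) < P.α} with hD
  have hx1D : x1 ∈ D := by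
    show P.cZ (t1, x1, 0) < P.α
    rw [hZ1]; linarith
  have hup : IsUpperSet D := fun x y hxy hx => lt_of_le_of_lt (hanti x y hxy) hx
  have hpre : IsPreconnected D := hup.ordConnected.isPreconnected
  set γ : ℝ → E := fun x => (t1, x, g x) with hγ
  have hγc : ContinuousOn γ D := by
    refine continuousOn_const.prodMk (continuousOn_id.prodMk hgc)
  have hS := hpre.image γ hγc
  have hgood : ∀ c ∈ image γ D, P.Good c := by rintro _ ⟨x, hx, rfl⟩; exact hg x hx
  have hT : (image γ D ∩ P.OT).Nonempty := by
    refine ⟨γ x1, mem_image_of_mem _ hx1D, ?_⟩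
    obtain ⟨a0, a1, a2⟩ := P.good_start (hg x1 hx1D)
    obtain ⟨t, ht, hct, hUt, -⟩ := hU (γ x1) (hZ1 _) (by
      show exp x1 ≤ ε
      rw [hx1, exp_log hε]) a0 a1 a2
    exact ⟨P.iv _ t, P.iv_nonneg ht hct, hUt⟩
  have hC : (image γ D ∩ P.OC).Nonempty := by
    obtain ⟨x0, hx0⟩ := P.reach_C t1
    have hmem : max x0 x1 ∈ D := hup (le_max_right _ _) hx1D
    refine ⟨γ (max x0 x1), mem_image_of_mem _ hmem, ?_⟩
    obtain ⟨a0, a1, a2⟩ := P.good_start (hg _ hmem)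
    obtain ⟨t, ht, hct, hA⟩ := hx0 (max x0 x1) (le_max_left _ _) (g (max x0 x1)) a1 a2
    exact ⟨P.iv _ t, P.iv_nonneg ht hct, hA⟩
  constructor
  · by_contra hcon
    push Not at hcon
    obtain ⟨c, hc, h1, h2⟩ := hS P.OC P.OT P.OC_open P.OT_open (fun c hc => by
      by_cases h : c ∈ P.OC
      · exact Or.inl h
      · exact Or.inr (hcon c (hgood c hc) h)) hC hT
    exact P.disj (hgood c hc) h1 h2
  · obtain ⟨c, hc, h1⟩ := hT
    exact ⟨c, hgood c hc, fun h2 => P.disj (hgood c hc) h2 h1, h1⟩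

lemma full {c : E} (hg : P.Good c) (h1 : c ∉ P.OC) : ∃ b, Sol P (Iio b) (P.Xs c) (P.As c) (P.Zs c) ∧
    BSol P c.1 (P.Xs c) (P.As c) (P.Zs c) ∧ Dy P c.1 b (P.Xs c) (P.As c) (P.Zs c) ∧ Ico c.1 b ⊆ P.I c ∧
    (∀ t ∈ P.I c, c.1 ≤ t → t < b) := by
  obtain ⟨g0, g1, g2⟩ := P.good_start hg
  have hβ : ∀ t ∈ P.I c, c.1 ≤ t → - P.β ≤ P.As c t := fun t ht hct => by
    by_contra hcon
    push Not at hcon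
    exact h1 ⟨P.iv c t, P.iv_nonneg ht hct, hcon⟩
  obtain ⟨b, hb, hbI, hX⟩ := P.fwd_dies g1 g2 hβ
  obtain ⟨hI, hB⟩ := P.good_bsol hg
  have hsub : Iio b ⊆ P.I c := fun t ht => by
    rcases le_total c.1 t with h | h
    · exact (hbI t h).2 ht
    · exact hI h
  have hsub' : Ico c.1 b ⊆ P.I c := fun t ht => hsub ht.2
  exact ⟨b, (P.sol c).mono hsub, hB, ⟨(P.sol c).mono hsub', hb, fun t ht => hβ t (hsub' ht) ht.1, hX⟩, hsub',
    fun t ht h => (hbI t h).1 ht⟩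

theorem phase :
    (∃ b t1 X A Z, Sol P (Iio b) X A Z ∧ BSol P t1 X A Z ∧ Dy P t1 b X A Z ∧ Tendsto A (𝓝[<] b) (𝓝 (- P.β))) ∧
    (∃ b t1 X A Z, Sol P (Iio b) X A Z ∧ BSol P t1 X A Z ∧ Dy P t1 b X A Z ∧ Tendsto A (𝓝[<] b) (𝓝 0) ∧
      Tendsto (fun t => - A t / (X t * Z t)) (𝓝[<] b) (𝓝 (1 / P.β))) := by
  obtain ⟨⟨c, hc, hc1, hc2⟩, ⟨d, hd, hd1, hd2⟩⟩ := P.shoot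
  constructor
  · obtain ⟨b, h1, h2, h3, h4, h5⟩ := P.full hc hc1
    exact ⟨b, c.1, _, _, _, h1, h2, h3, h3.typeI (fun t ht hU =>
      hc2 ⟨P.iv c t, P.iv_nonneg (h4 ht) ht.1, hU⟩)⟩
  · obtain ⟨b, h1, h2, h3, h4, h5⟩ := P.full hd hd1
    obtain ⟨τ, hτ, hU⟩ := hd2
    refine ⟨b, d.1, _, _, _, h1, h2, h3, h3.typeII ⟨P.T d τ, ⟨P.T_ge hτ, h5 _ (P.T_mem d τ) (P.T_ge hτ)⟩, ?_⟩⟩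
    rw [P.Xs_T, P.As_T, P.Zs_T]; exact hU

end Par


lemma type_lim {f g' : ℝ → ℝ} {e a c L : ℝ} (he : 0 < e) (hL : 0 < L) (hac : a < c)
    (hf : ∀ ξ ∈ Ioo a c, 0 < f ξ) (hd : ∀ ξ ∈ Ioo a c, HasDerivAt (fun x => f x ^ e) (g' ξ) ξ)
    (h0 : Tendsto f (𝓝[<] c) (𝓝 0)) (hg : Tendsto g' (𝓝[<] c) (𝓝 (-L))) :
    ∃ C, 0 < C ∧ Tendsto (fun ξ => f ξ * (c - ξ) ^ (-(1 / e))) (𝓝[<] c) (𝓝 C) := by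
  have h1 : Tendsto (fun x => f x ^ e) (𝓝[<] c) (𝓝 0) := by
    have := h0.rpow_const (p := e) (Or.inr he.le)
    rwa [zero_rpow he.ne'] at this
  have h2 : Tendsto (fun x => c - x) (𝓝[<] c) (𝓝 0) := by
    have : Tendsto (fun x => c - x) (𝓝 c) (𝓝 (c - c)) := by
      apply Continuous.tendsto; fun_prop
    rw [sub_self] at this
    exact this.mono_left nhdsWithin_le_nhds
  have h3 : Tendsto (fun x => g' x / (-1)) (𝓝[<] c) (𝓝 L) := by
    have := hg.div_const (-1); simpa using this
  have key := HasDerivAt.lhopital_zero_left_on_Ioo hac hd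
    (fun x _ => (hasDerivAt_id x).const_sub c) (fun x _ => by norm_num) h1 h2 h3
  refine ⟨L ^ (1 / e), rpow_pos_of_pos hL _, ?_⟩
  refine (key.rpow_const (p := 1 / e) (Or.inl hL.ne')).congr' ?_
  filter_upwards [Ioo_mem_nhdsLT hac] with x hx
  have hfx := hf x hx
  have hx' : 0 < c - x := by linarith [hx.2]
  simp only [id]
  rw [div_rpow (rpow_nonneg hfx.le _) hx'.le, ← rpow_mul hfx.le, mul_one_div_cancel he.ne', rpow_one,
    rpow_neg hx'.le, div_eq_mul_inv]

lemma contDiffOn_step {g g' : ℝ → ℝ} {S : Set ℝ} {k : ℕ} (hS : IsOpen S)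
    (hd : ∀ x ∈ S, HasDerivAt g (g' x) x) (hg : ContDiffOn ℝ k g' S) : ContDiffOn ℝ (k + 1) g S := by
  rw [contDiffOn_succ_iff_deriv_of_isOpen hS]
  refine ⟨fun x hx => (hd x hx).differentiableAt.differentiableWithinAt, by simp, ?_⟩
  exact hg.congr (fun x hx => (hd x hx).deriv)

lemma Sol.smooth {P : Par} {b : ℝ} {X A Z : ℝ → ℝ} (h : Sol P (Iio b) X A Z) : ContDiffOn ℝ 2 X (Iio b) := by
  have cX : ContDiffOn ℝ 0 X (Iio b) := contDiffOn_zero.2 fun t ht => (h.dX t ht).continuousAt.continuousWithinAt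
  have cA : ContDiffOn ℝ 0 A (Iio b) := contDiffOn_zero.2 fun t ht => (h.dA t ht).continuousAt.continuousWithinAt
  have cZ : ContDiffOn ℝ 0 Z (Iio b) := contDiffOn_zero.2 fun t ht => (h.dZ t ht).continuousAt.continuousWithinAt
  have hX : ∀ t ∈ Iio b, X t ≠ 0 := fun t ht => (h.pX t ht).ne'
  have cX1 : ContDiffOn ℝ 1 X (Iio b) := by
    have := contDiffOn_step (k := 0) isOpen_Iio h.dX (by
      exact (contDiffOn_const.mul cA).sub (contDiffOn_const.mul cX))
    simpa using this
  have cA1 : ContDiffOn ℝ 1 A (Iio b) := by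
    have := contDiffOn_step (k := 0) isOpen_Iio h.dA (by
      exact (((contDiffOn_const.sub (contDiffOn_const.mul cA)).sub
        ((cA.mul (cA.add contDiffOn_const)).div cX hX)).sub cZ))
    simpa using this
  have := contDiffOn_step (k := 1) isOpen_Iio h.dX (by
      exact (contDiffOn_const.mul cA1).sub (contDiffOn_const.mul cX1))
  norm_num at this
  exact this

namespace Par

/-- The profile built from the phase variable `X`. -/
noncomputable def prof (P : Par) (v0 b : ℝ) (X : ℝ → ℝ) (ξ : ℝ) : ℝ :=
  if ξ ≤ 0 then (v0 / P.m) ^ (1 / (P.m - 1)) else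
    if ξ < exp b then (X (log ξ) * ξ ^ 2 / P.m) ^ (1 / (P.m - 1)) else 0

variable {P : Par} {v0 b : ℝ} {X A Z : ℝ → ℝ}

lemma prof_mid {ξ : ℝ} (h : ξ ∈ Ioo 0 (exp b)) :
    P.prof v0 b X ξ = (X (log ξ) * ξ ^ 2 / P.m) ^ (1 / (P.m - 1)) := by
  unfold prof; rw [if_neg (not_le.2 h.1), if_pos h.2]

lemma log_mem {ξ : ℝ} (h : ξ ∈ Ioo 0 (exp b)) : log ξ ∈ Iio b := (log_lt_iff_lt_exp h.1).2 h.2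

lemma prof_pos (h : Sol P (Iio b) X A Z) {ξ : ℝ} (hξ : ξ ∈ Ioo 0 (exp b)) : 0 < P.prof v0 b X ξ := by
  rw [prof_mid hξ]
  have h1 := h.pX _ (log_mem hξ)
  have h2 := hξ.1
  have h3 := P.hm
  have : 0 < P.m := by linarith
  positivity

lemma prof_m1 (h : Sol P (Iio b) X A Z) {ξ : ℝ} (hξ : ξ ∈ Ioo 0 (exp b)) :
    P.prof v0 b X ξ ^ (P.m - 1) = X (log ξ) * ξ ^ 2 / P.m := by
  rw [prof_mid hξ]
  have h1 := h.pX _ (log_mem hξ)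
  have h2 := hξ.1
  have h3 := P.hm1
  have : 0 < P.m := by linarith
  rw [← rpow_mul (by positivity), one_div_mul_cancel h3.ne', rpow_one]

lemma prof_Z (h : Sol P (Iio b) X A Z) {ξ : ℝ} (hξ : ξ ∈ Ioo 0 (exp b)) :
    P.prof v0 b X ξ ^ (1 - P.p) * Z (log ξ) = ξ ^ P.s := by
  have h1 := h.pX _ (log_mem hξ)
  have h2 := hξ.1
  have h3 := P.hm1
  have hm : 0 < P.m := by linarith
  rw [← P.r_mul, mul_comm P.r, rpow_mul (prof_pos h hξ).le, prof_m1 h hξ, h.link _ (log_mem hξ)]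
  have e1 : exp (P.g0 * log ξ) = ξ ^ P.g0 := by rw [rpow_def_of_pos h2, mul_comm]
  have e2 : ξ ^ P.s = ξ ^ (2 * P.r) * ξ ^ P.g0 := by
    rw [← rpow_add h2]; congr 1; unfold g0; ring
  have e3 : (ξ ^ 2) ^ P.r = ξ ^ (2 * P.r) := by rw [← rpow_natCast, ← rpow_mul h2.le]; norm_num
  rw [e1, e2, div_rpow (by positivity) hm.le, mul_rpow h1.le (by positivity), e3, rpow_neg h1.le]
  unfold ζ
  have : X (log ξ) ^ P.r ≠ 0 := (rpow_pos_of_pos h1 _).ne'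
  have : P.m ^ P.r ≠ 0 := (rpow_pos_of_pos hm _).ne'
  field_simp

lemma prof_deriv (h : Sol P (Iio b) X A Z) {ξ : ℝ} (hξ : ξ ∈ Ioo 0 (exp b)) :
    HasDerivAt (P.prof v0 b X) (P.prof v0 b X ξ * A (log ξ) / (X (log ξ) * ξ)) ξ := by
  have h1 := h.pX _ (log_mem hξ)
  have h2 := hξ.1
  have h3 := P.hm1
  have hm : 0 < P.m := by linarith
  have d1 := ((((h.dX _ (log_mem hξ)).comp ξ (hasDerivAt_log h2.ne')).mul (hasDerivAt_pow 2 ξ)).div_const P.m)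
  have d2 := d1.rpow_const (p := 1 / (P.m - 1)) (Or.inl (by
    simp only [Pi.mul_apply, Function.comp]; positivity))
  have d3 := d2.congr_of_eventuallyEq (f₁ := P.prof v0 b X) (by
    filter_upwards [isOpen_Ioo.mem_nhds hξ] with x hx
    rw [prof_mid hx]; simp only [Pi.mul_apply, Function.comp])
  refine d3.congr_deriv ?_
  rw [prof_mid hξ]
  simp only [Pi.mul_apply, Function.comp]
  rw [rpow_sub_one (by positivity)]
  generalize (X (log ξ) * ξ ^ 2 / P.m) ^ (1 / (P.m - 1)) = y
  field_simp
  push_cast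
  ring

lemma prof_deriv_e (h : Sol P (Iio b) X A Z) (e : ℝ) {ξ : ℝ} (hξ : ξ ∈ Ioo 0 (exp b)) :
    HasDerivAt (fun x => P.prof v0 b X x ^ e)
      (e * P.prof v0 b X ξ ^ e * A (log ξ) / (X (log ξ) * ξ)) ξ := by
  have hp := prof_pos (v0 := v0) h hξ
  refine ((prof_deriv h hξ).rpow_const (p := e) (Or.inl hp.ne')).congr_deriv ?_
  rw [rpow_sub_one hp.ne']
  field_simp

lemma prof_deriv_m (h : Sol P (Iio b) X A Z) {ξ : ℝ} (hξ : ξ ∈ Ioo 0 (exp b)) :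
    HasDerivAt (fun x => P.prof v0 b X x ^ P.m) (ξ * P.prof v0 b X ξ * A (log ξ)) ξ := by
  have hp := prof_pos (v0 := v0) h hξ
  have h1 := h.pX _ (log_mem hξ)
  have h2 := hξ.1
  have hm : 0 < P.m := by linarith [P.hm]
  refine (prof_deriv_e h P.m hξ).congr_deriv ?_
  have e : P.prof v0 b X ξ ^ P.m = P.prof v0 b X ξ ^ (P.m - 1) * P.prof v0 b X ξ := by
    rw [rpow_sub_one hp.ne']; field_simp
  rw [e, prof_m1 h hξ]
  field_simp

lemma prof_deriv_mm (h : Sol P (Iio b) X A Z) {ξ : ℝ} (hξ : ξ ∈ Ioo 0 (exp b)) :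
    HasDerivAt (deriv (fun x => P.prof v0 b X x ^ P.m))
      (P.prof v0 b X ξ * (P.α - (P.n - 1) * A (log ξ) - P.β * A (log ξ) / X (log ξ) - Z (log ξ))) ξ := by
  have h1 := h.pX _ (log_mem hξ)
  have h2 := hξ.1
  have d := (((hasDerivAt_id ξ).mul (prof_deriv (v0 := v0) h hξ))).mul
    ((h.dA _ (log_mem hξ)).comp ξ (hasDerivAt_log h2.ne'))
  refine (d.congr_of_eventuallyEq ?_).congr_deriv ?_
  · filter_upwards [isOpen_Ioo.mem_nhds hξ] with x hx
    rw [(prof_deriv_m h hx).deriv]; rfl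
  · simp only [Pi.mul_apply, Function.comp, id]
    field_simp
    ring

lemma prof_eq (h : Sol P (Iio b) X A Z) {ξ : ℝ} (hξ : ξ ∈ Ioo 0 (exp b)) :
    deriv (deriv fun x => P.prof v0 b X x ^ P.m) ξ + (P.n - 1) / ξ * deriv (fun x => P.prof v0 b X x ^ P.m) ξ
    - P.α * P.prof v0 b X ξ + P.β * ξ * deriv (P.prof v0 b X) ξ + ξ ^ P.s * P.prof v0 b X ξ ^ P.p = 0 := by
  rw [(prof_deriv_mm h hξ).deriv, (prof_deriv_m h hξ).deriv, (prof_deriv h hξ).deriv, ← prof_Z (v0 := v0) h hξ]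
  have h1 := h.pX _ (log_mem hξ)
  have h2 := hξ.1
  have hp := prof_pos (v0 := v0) h hξ
  have e : P.prof v0 b X ξ = P.prof v0 b X ξ ^ (1 - P.p) * P.prof v0 b X ξ ^ P.p := by
    rw [← rpow_add hp, sub_add_cancel, rpow_one]
  have e2 : P.prof v0 b X ξ ^ (1 - P.p) * Z (log ξ) * P.prof v0 b X ξ ^ P.p = P.prof v0 b X ξ * Z (log ξ) := by
    conv_rhs => rw [e]
    ring
  rw [e2]
  field_simp
  ring

lemma prof_C2 (h : Sol P (Iio b) X A Z) : ContDiffOn ℝ 2 (P.prof v0 b X) (Ioo 0 (exp b)) := by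
  have hm : 0 < P.m := by linarith [P.hm]
  have c1 : ContDiffOn ℝ 2 log (Ioo 0 (exp b)) := fun x hx =>
    (contDiffAt_log.2 hx.1.ne').contDiffWithinAt
  have c2 : ContDiffOn ℝ 2 (X ∘ log) (Ioo 0 (exp b)) := h.smooth.comp c1 (fun x hx => log_mem hx)
  have c3 : ContDiffOn ℝ 2 (fun x => (X (log x) * x ^ 2 / P.m)) (Ioo 0 (exp b)) :=
    (c2.mul (contDiffOn_id.pow 2)).div_const P.m
  refine (c3.rpow_const_of_ne (p := 1 / (P.m - 1)) (fun x hx => ?_)).congr (fun x hx => prof_mid hx)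
  have h1 := h.pX _ (log_mem hx)
  have h2 := hx.1
  positivity

lemma tendsto_log_lt : Tendsto log (𝓝[<] (exp b)) (𝓝[<] b) := by
  refine tendsto_nhdsWithin_iff.2 ⟨?_, ?_⟩
  · have := (continuousAt_log (exp_pos b).ne').tendsto
    rw [log_exp] at this
    exact this.mono_left nhdsWithin_le_nhds
  · filter_upwards [Ioo_mem_nhdsLT (exp_pos b)] with x hx using log_mem hx

lemma prof_end : P.prof v0 b X (exp b) = 0 := by
  unfold prof; rw [if_neg (not_le.2 (exp_pos b)), if_neg (lt_irrefl _)]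

lemma prof_zero : P.prof v0 b X 0 = (v0 / P.m) ^ (1 / (P.m - 1)) := by
  unfold prof; rw [if_pos le_rfl]

lemma prof_left (hX : Tendsto X (𝓝[<] b) (𝓝 0)) : Tendsto (P.prof v0 b X) (𝓝[<] (exp b)) (𝓝 0) := by
  have he : 0 < 1 / (P.m - 1) := one_div_pos.2 P.hm1
  have h1 : Tendsto (fun x => X (log x) * x ^ 2 / P.m) (𝓝[<] (exp b)) (𝓝 (0 * (exp b) ^ 2 / P.m)) :=
    ((hX.comp tendsto_log_lt).mul ((tendsto_id.mono_left nhdsWithin_le_nhds).pow 2)).div_const P.m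
  rw [zero_mul, zero_div] at h1
  have h2 := h1.rpow_const (p := 1 / (P.m - 1)) (Or.inr he.le)
  rw [zero_rpow he.ne'] at h2
  refine h2.congr' ?_
  filter_upwards [Ioo_mem_nhdsLT (exp_pos b)] with x hx using (prof_mid hx).symm

lemma prof_right (hv : Tendsto (fun t => X t * exp (2 * t)) atBot (𝓝 v0)) :
    Tendsto (P.prof v0 b X) (𝓝[>] 0) (𝓝 (P.prof v0 b X 0)) := by
  have he : 0 < 1 / (P.m - 1) := one_div_pos.2 P.hm1
  rw [prof_zero]
  refine (((hv.comp tendsto_log_nhdsGT_zero).div_const P.m).rpow_const (p := 1 / (P.m - 1))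
    (Or.inr he.le)).congr' ?_
  filter_upwards [Ioo_mem_nhdsGT (exp_pos b)] with x hx
  rw [prof_mid hx]
  simp only [Function.comp]
  rw [two_mul, exp_add, exp_log hx.1, sq]

lemma prof_cont (h : Sol P (Iio b) X A Z) (hX : Tendsto X (𝓝[<] b) (𝓝 0))
    (hv : Tendsto (fun t => X t * exp (2 * t)) atBot (𝓝 v0)) :
    ContinuousOn (P.prof v0 b X) (Icc 0 (exp b)) := by
  intro x hx
  rcases hx.1.eq_or_lt with rfl | h0
  · have := (prof_right (P := P) (b := b) hv)
    have h2 : ContinuousWithinAt (P.prof v0 b X) (Ici 0) 0 := by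
      rw [← continuousWithinAt_Ioi_iff_Ici]; exact this
    exact h2.mono Icc_subset_Ici_self
  rcases hx.2.eq_or_lt with rfl | h1
  · have h2 : ContinuousWithinAt (P.prof v0 b X) (Iic (exp b)) (exp b) := by
      rw [← continuousWithinAt_Iio_iff_Iic]
      unfold ContinuousWithinAt
      rw [prof_end]; exact prof_left hX
    exact h2.mono Icc_subset_Iic_self
  · exact (prof_deriv h ⟨h0, h1⟩).continuousAt.continuousWithinAt

lemma prof_flux (h : Sol P (Iio b) X A Z) (hX : Tendsto X (𝓝[<] b) (𝓝 0)) {l : ℝ}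
    (hA : Tendsto A (𝓝[<] b) (𝓝 l)) :
    Tendsto (fun ξ => deriv (fun x => P.prof v0 b X x ^ P.m) ξ) (𝓝[<] (exp b)) (𝓝 0) := by
  have h1 := ((tendsto_id.mono_left (nhdsWithin_le_nhds (s := Iio (exp b)) (a := exp b))).mul
    (prof_left (P := P) (v0 := v0) hX)).mul (hA.comp tendsto_log_lt)
  simp only [mul_zero, zero_mul] at h1
  refine h1.congr' ?_
  filter_upwards [Ioo_mem_nhdsLT (exp_pos b)] with x hx
  rw [(prof_deriv_m h hx).deriv]; rfl

lemma prof_typeI (h : Sol P (Iio b) X A Z) (hX : Tendsto X (𝓝[<] b) (𝓝 0))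
    (hA : Tendsto A (𝓝[<] b) (𝓝 (- P.β))) : ∃ c, 0 < c ∧
    Tendsto (fun ξ => P.prof v0 b X ξ * (exp b - ξ) ^ (-(1 / (P.m - 1)))) (𝓝[<] (exp b)) (𝓝 c) := by
  have hm : 0 < P.m := by linarith [P.hm]
  have hm1 := P.hm1
  have hβ := P.hβ
  refine type_lim (a := 0) (L := (P.m - 1) / P.m * (P.β * exp b)) P.hm1 (by positivity) (exp_pos b)
    (fun x hx => prof_pos h hx) (fun x hx => prof_deriv_e h _ hx) (prof_left hX) ?_
  have h1 := ((hA.comp tendsto_log_lt).mul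
    (tendsto_id.mono_left (nhdsWithin_le_nhds (s := Iio (exp b)) (a := exp b)))).const_mul ((P.m - 1) / P.m)
  rw [show (P.m - 1) / P.m * (- P.β * exp b) = - ((P.m - 1) / P.m * (P.β * exp b)) by ring] at h1
  refine h1.congr' ?_
  filter_upwards [Ioo_mem_nhdsLT (exp_pos b)] with x hx
  rw [prof_m1 h hx]
  have h1 := h.pX _ (log_mem hx)
  have h2 := hx.1
  simp only [Function.comp, id]
  field_simp

lemma prof_typeII (h : Sol P (Iio b) X A Z) (hX : Tendsto X (𝓝[<] b) (𝓝 0))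
    (hA : Tendsto (fun t => -A t / (X t * Z t)) (𝓝[<] b) (𝓝 (1 / P.β))) : ∃ c, 0 < c ∧
    Tendsto (fun ξ => P.prof v0 b X ξ * (exp b - ξ) ^ (-(1 / (1 - P.p)))) (𝓝[<] (exp b)) (𝓝 c) := by
  have hp : 0 < 1 - P.p := by linarith [P.hp1]
  have hβ := P.hβ
  have hb := exp_pos b
  refine type_lim (a := 0) (L := (1 - P.p) * (1 / P.β * (exp b ^ P.s / exp b))) hp (by positivity) (exp_pos b)
    (fun x hx => prof_pos h hx) (fun x hx => prof_deriv_e h _ hx) (prof_left hX) ?_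
  have i := tendsto_id.mono_left (nhdsWithin_le_nhds (s := Iio (exp b)) (a := exp b))
  have h1 := (((hA.comp tendsto_log_lt).mul
    ((i.rpow_const (p := P.s) (Or.inl hb.ne')).div i hb.ne')).const_mul (1 - P.p)).neg
  refine h1.congr' ?_
  filter_upwards [Ioo_mem_nhdsLT (exp_pos b)] with x hx
  have h1 := h.pX _ (log_mem hx)
  have h3 := h.pZ _ (log_mem hx)
  have h2 := hx.1
  simp only [Function.comp, id, Pi.div_apply]
  rw [← prof_Z (v0 := v0) h hx]
  field_simp

/-- behaviour at the origin -/
lemma prof_origin {t1 : ℝ} (h : Sol P (Iio b) X A Z) (hB : BSol P t1 X A Z) :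
    ∃ v0, Tendsto (fun t => X t * exp (2 * t)) atBot (𝓝 v0) ∧
    ((0 < P.prof v0 b X 0 ∧ Tendsto (fun ξ => (P.prof v0 b X ξ ^ (P.m - 1) - P.prof v0 b X 0 ^ (P.m - 1)) / ξ ^ 2)
      (𝓝[>] 0) (𝓝 (P.α * (P.m - 1) / (2 * P.m * P.n)))) ∨
    (P.prof v0 b X 0 = 0 ∧ Tendsto (fun ξ => P.prof v0 b X ξ * ξ ^ (-(2 / (P.m - 1)))) (𝓝[>] 0)
      (𝓝 (((P.m - 1) / (2 * P.m * (P.m * P.n - P.n + 2))) ^ (1 / (P.m - 1))))) ∨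
    (P.prof v0 b X 0 = 0 ∧ ∃ K, 0 < K ∧
      Tendsto (fun ξ => P.prof v0 b X ξ * ξ ^ (-((P.s + 2) / (P.m - P.p)))) (𝓝[>] 0) (𝓝 K))) := by
  have hm : 0 < P.m := by linarith [P.hm]
  have hm1 := P.hm1
  have hn := P.n_pos
  have he : 0 < 1 / (P.m - 1) := one_div_pos.2 P.hm1
  have hexp : ∀ k : ℝ, 0 < k → Tendsto (fun t => exp (k * t)) atBot (𝓝 0) := fun k hk =>
    tendsto_exp_atBot.comp (tendsto_id.const_mul_atBot hk)
  have z : P.prof 0 b X 0 = 0 := by rw [prof_zero, zero_div, zero_rpow he.ne']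
  have e2 : ∀ x : ℝ, 0 < x → exp (2 * log x) = x ^ 2 := fun x hx => by
    rw [two_mul, exp_add, exp_log hx, sq]
  rcases hB.classify with ⟨v0, hv, hl⟩ | hl | ⟨K, hK, hl⟩
  · refine ⟨v0, ?_, Or.inl ⟨?_, ?_⟩⟩
    · have := (hl.mul (hexp 2 two_pos)).add_const v0
      rw [mul_zero, zero_add] at this
      refine this.congr (fun t => ?_)
      rw [div_mul_cancel₀ _ (exp_pos _).ne']; ring
    · rw [prof_zero]; positivity
    · have := (hl.comp tendsto_log_nhdsGT_zero).div_const P.m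
      rw [show (P.m - 1) * (P.α / P.n) / 2 / P.m = P.α * (P.m - 1) / (2 * P.m * P.n) by field_simp] at this
      refine this.congr' ?_
      filter_upwards [Ioo_mem_nhdsGT (exp_pos b)] with x hx
      rw [prof_m1 h hx, prof_zero, ← rpow_mul (by positivity), one_div_mul_cancel hm1.ne', rpow_one]
      have := hx.1
      simp only [Function.comp, e2 x hx.1]
      field_simp
  · refine ⟨0, ?_, Or.inr (Or.inl ⟨z, ?_⟩)⟩
    · have := hl.mul (hexp 2 two_pos)
      rwa [mul_zero] at this
    · have := ((hl.comp tendsto_log_nhdsGT_zero).div_const P.m).rpow_const (p := 1 / (P.m - 1)) (Or.inr he.le)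
      have hpos : 0 < P.m * P.n - P.n + 2 := by nlinarith
      rw [show (P.m - 1) / (2 * (P.m * P.n - P.n + 2)) / P.m = (P.m - 1) / (2 * P.m * (P.m * P.n - P.n + 2)) by
        field_simp] at this
      refine this.congr' ?_
      filter_upwards [Ioo_mem_nhdsGT (exp_pos b)] with x hx
      have h0 := hx.1
      have h1 := h.pX _ (log_mem hx)
      rw [prof_mid hx]
      simp only [Function.comp]
      rw [show X (log x) * x ^ 2 / P.m = X (log x) / P.m * x ^ 2 by ring,
        mul_rpow (by positivity) (by positivity), ← rpow_natCast x 2, ← rpow_mul h0.le, mul_assoc,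
        ← rpow_add h0]
      rw [show ((2:ℕ):ℝ) * (1 / (P.m - 1)) + -(2 / (P.m - 1)) = 0 by push_cast; ring, rpow_zero, mul_one]
  · have hq := P.q_pos
    refine ⟨0, ?_, Or.inr (Or.inr ⟨z, (K / P.m) ^ (1 / (P.m - 1)), by positivity, ?_⟩)⟩
    · have := hl.mul (hexp ((P.m - 1) * P.q) (by positivity))
      rw [mul_zero] at this
      refine this.congr (fun t => ?_)
      rw [mul_assoc, ← exp_add, neg_add_cancel, exp_zero, mul_one]
    · have := ((hl.comp tendsto_log_nhdsGT_zero).div_const P.m).rpow_const (p := 1 / (P.m - 1)) (Or.inr he.le)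
      refine this.congr' ?_
      filter_upwards [Ioo_mem_nhdsGT (exp_pos b)] with x hx
      have h0 := hx.1
      have h1 := h.pX _ (log_mem hx)
      have hmp : 0 < P.m - P.p := by linarith [P.hp1, P.hm]
      have eq : (P.s + 2) / (P.m - P.p) = P.q := by rw [← P.q_mp]; field_simp
      rw [prof_mid hx, eq]
      simp only [Function.comp, e2 x h0]
      rw [show X (log x) * x ^ 2 * exp (-((P.m - 1) * P.q * log x)) / P.m =
        X (log x) * x ^ 2 / P.m * exp (-((P.m - 1) * P.q * log x)) by ring,
        mul_rpow (by positivity) (exp_pos _).le, ← exp_mul, rpow_def_of_pos h0]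
      congr 2
      field_simp

end Par

lemma Par.good_profile {P : Par} {N : ℕ} (hN : P.n = N) (hα : P.α = alphaC P.m P.p P.s)
    (hβ : P.β = betaC P.m P.p P.s) {b t1 l : ℝ} {X A Z : ℝ → ℝ} (h : Sol P (Iio b) X A Z)
    (hB : BSol P t1 X A Z) (hX : Tendsto X (𝓝[<] b) (𝓝 0)) (hA : Tendsto A (𝓝[<] b) (𝓝 l)) :
    ∃ v0, GoodProfile N P.m P.p P.s (P.prof v0 b X) (exp b) := by
  obtain ⟨v0, hv, hor⟩ := prof_origin h hB
  refine ⟨v0, ⟨exp_pos b, prof_cont h hX hv, fun x hx => prof_pos h hx, prof_C2 h, fun x hx => ?_, prof_end,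
    prof_flux h hX hA⟩, ?_⟩
  · unfold SSODE
    rw [← hN, ← hα, ← hβ]
    exact prof_eq h hx
  · unfold BehB1 BehB2 BehB3
    rw [← hN, ← hα]
    exact hor

theorem exists_good_profiles_typeI_typeII (m p σ : ℝ) (N : ℕ) (hm : 1 < m) (hp0 : 0 < p) (hp1 : p < 1)
    (hσ : 2 * (1 - p) / (m - 1) < σ) (hN : 1 ≤ N)
    (hmp : 2 < m + p) :
    (∃ f : ℝ → ℝ, ∃ ξ0 : ℝ, GoodProfile N m p σ f ξ0 ∧ TypeI m f ξ0) ∧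
    (∃ f : ℝ → ℝ, ∃ ξ0 : ℝ, GoodProfile N m p σ f ξ0 ∧ TypeII p f ξ0) := by
  have h1 : 0 < m - 1 := by linarith
  have hg : 2 * (1 - p) < σ * (m - 1) := (div_lt_iff₀ h1).1 hσ
  have hs : 0 < σ := lt_trans (div_pos (by linarith) h1) hσ
  have hL : 0 < σ * (m - 1) + 2 * (p - 1) := by linarith
  have hmp' : 0 < m - p := by linarith
  let P : Par :=
    { m := m, p := p, s := σ, n := N, α := alphaC m p σ, β := betaC m p σ, hm := hm, hp0 := hp0, hp1 := hp1
      hs := hs, hn := by exact_mod_cast hN, hα := div_pos (by linarith) hL, hβ := div_pos hmp' hL, hmp := hmp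
      hab := by unfold alphaC betaC; field_simp; ring
      hab2 := by unfold alphaC betaC; ring
      hg := hg }
  obtain ⟨⟨b, t1, X, A, Z, hS, hB, hD, hA⟩, ⟨b', t1', X', A', Z', hS', hB', hD', hA', hQ'⟩⟩ := P.phase
  constructor
  · obtain ⟨v0, hG⟩ := Par.good_profile (P := P) (N := N) rfl rfl rfl hS hB hD.X0 hA
    exact ⟨_, _, hG, Par.prof_typeI hS hD.X0 hA⟩
  · obtain ⟨v0, hG⟩ := Par.good_profile (P := P) (N := N) rfl rfl rfl hS' hB' hD'.X0 hA'
    exact ⟨_, _, hG, Par.prof_typeII hS' hD'.X0 hQ'⟩
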